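/- arXiv:2208.03304 — 3 statements merged into one kernel-verified Lean document; each statement's English description precedes it below -/
import Mathlib

section
/- Let K be a totally real number field of degree n ≥ 2 over ℚ that is unit reducible, with discriminant Δ_K. Then the number n_K of homothety classes of perfect unary forms over K satisfies n_K ≤ |Δ_K| · (2/π)^{2n} · Γ(2 + n/2)^4. -/
open NumberField Real

/-- An element of a number field is *totally positive* if it is positive under
every real embedding. -/
def TotPos {K : Type*} [Field K] (a : K) : Prop := ∀ φ : K →+* ℝ, 0 < φ a

/-- The value of the trace form `Tr_{K/ℚ}(a x²)` at an algebraic integer `x`. -/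
noncomputable def trForm {K : Type*} [Field K] [NumberField K] (a : K) (x : 𝓞 K) : ℚ :=
  Algebra.trace ℚ K (a * (x : K) ^ 2)

/-- `μ(a)`: the minimum of `Tr_{K/ℚ}(a x²)` over nonzero `x ∈ 𝓞 K`. -/
noncomputable def muMin {K : Type*} [Field K] [NumberField K] (a : K) : ℝ :=
  sInf {t : ℝ | ∃ x : 𝓞 K, x ≠ 0 ∧ (trForm a x : ℝ) = t}

/-- `M(a)`: the set of algebraic integers attaining `μ(a)`. -/
def MinVecs {K : Type*} [Field K] [NumberField K] (a : K) : Set (𝓞 K) :=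
  {x | ((trForm a x : ℚ) : ℝ) = muMin a}

/-- A totally positive `a` is *perfect* if it is the unique totally positive element `b`
with `Tr(b x²) = μ(a)` for all `x ∈ M(a)`. -/
def IsPerfectForm {K : Type*} [Field K] [NumberField K] (a : K) : Prop :=
  TotPos a ∧ ∀ b : K, TotPos b → (∀ x ∈ MinVecs a, ((trForm b x : ℚ) : ℝ) = muMin a) → b = a

/-- `a ~ a'` : equivalence by squares of units. -/
def UnitEquiv {K : Type*} [Field K] [NumberField K] (a a' : K) : Prop :=
  ∃ u : (𝓞 K)ˣ, a' = a * ((u : 𝓞 K) : K) ^ 2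

/-- Homothety: `a` and `b` are homothetic if `λ a ~ b` for some positive rational `λ`. -/
def Homothetic {K : Type*} [Field K] [NumberField K] (a b : K) : Prop :=
  ∃ q : ℚ, 0 < q ∧ UnitEquiv ((q : K) * a) b

/-- The number of homothety classes of perfect unary forms of `K`. -/
noncomputable def numClasses (K : Type*) [Field K] [NumberField K] : ℕ :=
  Nat.card (Quot (fun a b : {a : K // IsPerfectForm a} => Homothetic (a : K) (b : K)))

/-- `K` is `A`-reducible if minimal vectors of totally positive elements have norm at most `A`. -/
def IsAReducible (K : Type*) [Field K] [NumberField K] (A : ℝ) : Prop :=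
  ∀ a : K, TotPos a → ∀ x ∈ MinVecs a, |(Algebra.norm ℚ (x : K) : ℝ)| ≤ A

/-- `K` is totally real if every infinite place is real. -/
def TotallyReal (K : Type*) [Field K] [NumberField K] : Prop :=
  ∀ v : NumberField.InfinitePlace K, v.IsReal

namespace UnaryForm

open MeasureTheory
open scoped Pointwise

section Volume

variable {ι : Type*} [Fintype ι]

/-- The volume of the Euclidean unit ball in dimension `n`. -/
noncomputable def ballVol (n : ℕ) : ℝ := √π ^ n / Real.Gamma ((n : ℝ) / 2 + 1)

lemma ballVol_pos (n : ℕ) : 0 < ballVol n := by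
  unfold ballVol
  have := Real.Gamma_pos_of_pos (s := (n : ℝ) / 2 + 1) (by positivity)
  positivity

lemma volume_preimage_mul {w : ι → ℝ} (hw : ∏ i, w i ≠ 0) (s : Set (ι → ℝ)) :
    volume ((fun z => w * z) ⁻¹' s) = ENNReal.ofReal |∏ i, w i|⁻¹ * volume s := by
  classical
  have hdet : LinearMap.det (Matrix.toLin' (Matrix.diagonal w)) = ∏ i, w i := by
    rw [LinearMap.det_toLin', Matrix.det_diagonal]
  have h := Measure.addHaar_preimage_linearMap volume
    (f := Matrix.toLin' (Matrix.diagonal w)) (by rwa [hdet]) s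
  rw [hdet, abs_inv] at h
  rw [← h]
  congr 1
  ext z
  simp only [Set.mem_preimage, Matrix.toLin'_apply]
  have : Matrix.mulVec (Matrix.diagonal w) z = w * z := by
    ext i; simp [Matrix.mulVec_diagonal]
  rw [this]

lemma volume_ellipsoid {w : ι → ℝ} (hw : ∀ i, 0 < w i) :
    volume {z : ι → ℝ | ∑ i, (w i * z i) ^ 2 < 1} =
      ENNReal.ofReal ((∏ i, w i)⁻¹ * ballVol (Fintype.card ι)) := by
  have hpos : 0 < ∏ i, w i := Finset.prod_pos fun i _ => hw i
  have h := volume_sum_rpow_lt_one ι (p := 2) (by norm_num)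
  have hset : {z : ι → ℝ | ∑ i, (w i * z i) ^ 2 < 1} =
      (fun z => w * z) ⁻¹' {x : ι → ℝ | ∑ i, |x i| ^ (2 : ℝ) < 1} := by
    ext z; simp
  rw [hset, volume_preimage_mul hpos.ne', h, abs_of_pos hpos,
    ← ENNReal.ofReal_mul (by positivity)]
  have : Real.Gamma (1 / 2 + 1) = √π / 2 := by
    rw [Real.Gamma_add_one (by norm_num), Real.Gamma_one_half_eq]; ring
  rw [this, ballVol, mul_div_cancel₀ _ (two_ne_zero' ℝ)]

lemma volume_simplex_ge :
    ENNReal.ofReal (1 / (Fintype.card ι).factorial) ≤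
      volume {c : ι → ℝ | (∀ i, 0 < c i) ∧ ∑ i, c i < 1} := by
  classical
  set n := Fintype.card ι
  set S : Set (ι → ℝ) := {c | (∀ i, 0 < c i) ∧ ∑ i, c i < 1}
  have h := volume_sum_rpow_lt_one ι (p := 1) le_rfl
  have hG : (2 * Real.Gamma (1 / 1 + 1)) ^ n / Real.Gamma ((n : ℝ) / 1 + 1) =
      2 ^ n * (1 / n.factorial) := by
    rw [div_one, div_one, Real.Gamma_nat_eq_factorial, one_add_one_eq_two, Real.Gamma_two]
    ring
  rw [hG] at h
  let sg : (ι → Bool) → ι → ℝ := fun s i => if s i then 1 else -1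
  have hsg : ∀ s, |∏ i, sg s i| = 1 := fun s => by
    rw [Finset.abs_prod]
    refine Finset.prod_eq_one fun i _ => ?_
    dsimp [sg]; split_ifs <;> simp
  have hcov : {x : ι → ℝ | ∑ i, |x i| ^ (1 : ℝ) < 1} ⊆
      (⋃ i, {x : ι → ℝ | x i = 0}) ∪ ⋃ s, (fun z => sg s * z) ⁻¹' S := by
    intro x hx
    by_cases hz : ∃ i, x i = 0
    · obtain ⟨i, hi⟩ := hz
      exact Or.inl (Set.mem_iUnion.2 ⟨i, hi⟩)
    · push Not at hz
      refine Or.inr (Set.mem_iUnion.2 ⟨fun i => decide (0 < x i), ?_⟩)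
      have habs : ∀ i, sg (fun i => decide (0 < x i)) i * x i = |x i| := by
        intro i
        rcases lt_or_gt_of_ne (hz i) with hi | hi
        · simp [sg, not_lt.2 hi.le, abs_of_neg hi]
        · simp [sg, hi, abs_of_pos hi]
      refine ⟨fun i => ?_, ?_⟩
      · simpa [habs] using hz i
      · simpa [habs] using hx
  have hnull : volume (⋃ i, {x : ι → ℝ | x i = 0}) = 0 := by
    refine measure_iUnion_null fun i => ?_
    exact Measure.pi_hyperplane (fun _ : ι => (volume : Measure ℝ)) i 0
  have h2 : ENNReal.ofReal (2 ^ n * (1 / n.factorial)) ≤ 2 ^ n * volume S := by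
    rw [← h]
    refine (measure_mono hcov).trans ((measure_union_le _ _).trans ?_)
    rw [hnull, zero_add]
    refine (measure_iUnion_le _).trans ?_
    have : ∀ s, volume ((fun z => sg s * z) ⁻¹' S) = volume S := fun s => by
      have h0 : ∏ i, sg s i ≠ 0 := fun h0 => by simpa [h0] using hsg s
      rw [volume_preimage_mul h0, hsg]; simp
    simp [this, n]
  rw [ENNReal.ofReal_mul (by positivity), ENNReal.ofReal_pow (by norm_num)] at h2
  have h3 : (2 : ENNReal) ^ n ≠ 0 := by simp
  have h4 : (2 : ENNReal) ^ n ≠ ⊤ := by simp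
  rw [show ENNReal.ofReal 2 = 2 by simp] at h2
  exact (ENNReal.mul_le_mul_iff_right h3 h4).1 h2

lemma volume_simplicial_cone_ge [DecidableEq ι] (A : Matrix ι ι ℝ) {t : ℝ} (ht : 0 ≤ t) :
    ENNReal.ofReal (|A.det| * t ^ Fintype.card ι / (Fintype.card ι).factorial) ≤
      volume (Matrix.toLin' (t • A) '' {c : ι → ℝ | (∀ i, 0 < c i) ∧ ∑ i, c i < 1}) := by
  rw [Measure.addHaar_image_linearMap, LinearMap.det_toLin', Matrix.det_smul, abs_mul, abs_pow,
    abs_of_nonneg ht]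
  calc _ = ENNReal.ofReal (t ^ Fintype.card ι * |A.det|) *
        ENNReal.ofReal (1 / (Fintype.card ι).factorial) := by
        rw [← ENNReal.ofReal_mul (by positivity)]; congr 1; ring
    _ ≤ _ := by gcongr; exact volume_simplex_ge

lemma volume_image_sq_le [Nonempty ι] {E : Set (ι → ℝ)} (hE : MeasurableSet E)
    (hpos : ∀ z ∈ E, ∀ i, 0 < z i) (hstar : ∀ z ∈ E, ∀ r : ℝ, 0 < r → r < 1 → r • z ∈ E)
    {C : ℝ} (hC : 0 ≤ C) (hprod : ∀ z ∈ E, ∏ i, z i ≤ C) (hfin : volume E ≠ ⊤) :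
    volume ((fun z => z ^ 2) '' E) ≤
      ENNReal.ofReal (3 / 4 * 2 ^ Fintype.card ι * C) * volume E := by
  classical
  set n := Fintype.card ι
  have hn : n ≠ 0 := Fintype.card_ne_zero
  obtain ⟨ρ, hρ0, hρn⟩ : ∃ ρ : ℝ, 0 < ρ ∧ ρ ^ n = 1 / 2 :=
    ⟨(1 / 2 : ℝ) ^ (1 / (n : ℝ)), by positivity, by
      rw [← Real.rpow_natCast, ← Real.rpow_mul (by norm_num), one_div_mul_cancel (by simpa),
        Real.rpow_one]⟩
  have hρ1 : ρ < 1 := by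
    by_contra! h
    have := one_le_pow₀ h (n := n)
    rw [hρn] at this; norm_num at this
  let f' : (ι → ℝ) → (ι → ℝ) →L[ℝ] (ι → ℝ) := fun z =>
    ContinuousLinearMap.pi fun i => (2 * z i) • ContinuousLinearMap.proj (R := ℝ) i
  have hder : ∀ z ∈ E, HasFDerivWithinAt (fun z : ι → ℝ => z ^ 2) (f' z) E z := by
    intro z _
    refine HasFDerivAt.hasFDerivWithinAt (hasFDerivAt_pi.2 fun i => ?_)
    have := (hasFDerivAt_apply (𝕜 := ℝ) i z).pow 2
    convert! this using 1
    simp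
  have hinj : Set.InjOn (fun z : ι → ℝ => z ^ 2) E := by
    intro z hz z' hz' h
    ext i
    have := congrFun h i
    simp only [Pi.pow_apply] at this
    exact (pow_left_inj₀ (hpos z hz i).le (hpos z' hz' i).le two_ne_zero).1 this
  have hdet : ∀ z, (f' z).det = 2 ^ n * ∏ i, z i := by
    intro z
    have : ((f' z : (ι → ℝ) →L[ℝ] (ι → ℝ)) : (ι → ℝ) →ₗ[ℝ] (ι → ℝ)) =
        Matrix.toLin' (Matrix.diagonal fun i => 2 * z i) := by
      refine LinearMap.ext fun w => funext fun i => ?_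
      simp [f', Matrix.toLin'_apply, Matrix.mulVec_diagonal]
    rw [ContinuousLinearMap.det, this, LinearMap.det_toLin', Matrix.det_diagonal,
      Finset.prod_mul_distrib]
    simp [n]
  have hcv := lintegral_image_eq_lintegral_abs_det_fderiv_mul volume hE hder hinj 1
  simp only [Pi.one_apply, lintegral_one, mul_one, Measure.restrict_apply MeasurableSet.univ,
    Set.univ_inter] at hcv
  rw [hcv]
  set E' : Set (ι → ℝ) := ρ • E
  have hE' : MeasurableSet E' := hE.const_smul_of_ne_zero hρ0.ne'
  have hsub : E' ⊆ E := by
    rintro _ ⟨z, hz, rfl⟩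
    exact hstar z hz ρ hρ0 hρ1
  have hvE' : volume E' = ENNReal.ofReal (1 / 2) * volume E := by
    rw [Measure.addHaar_smul, Module.finrank_fintype_fun_eq_card, hρn]; norm_num
  have hbd : ∀ z ∈ E, ENNReal.ofReal |(f' z).det| ≤ ENNReal.ofReal (2 ^ n * C) := by
    intro z hz
    rw [hdet, abs_of_nonneg (mul_nonneg (by positivity)
      (Finset.prod_nonneg fun i _ => (hpos z hz i).le))]
    exact ENNReal.ofReal_le_ofReal (by gcongr; exact hprod z hz)
  have hbd' : ∀ z ∈ E', ENNReal.ofReal |(f' z).det| ≤ ENNReal.ofReal (2 ^ n * C * (1 / 2)) := by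
    rintro _ ⟨z, hz, rfl⟩
    have : ∏ i, (ρ • z) i = 1 / 2 * ∏ i, z i := by
      simp [Finset.prod_mul_distrib, ← hρn, n]
    simp only [hdet, this]
    rw [abs_of_nonneg (mul_nonneg (by positivity) (mul_nonneg (by norm_num)
      (Finset.prod_nonneg fun i _ => (hpos z hz i).le)))]
    refine ENNReal.ofReal_le_ofReal ?_
    have := hprod z hz
    have h2 : (0 : ℝ) < 2 ^ n := by positivity
    nlinarith [mul_le_mul_of_nonneg_left this h2.le]
  have hdiff : volume (E \ E') = ENNReal.ofReal (1 / 2) * volume E := by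
    rw [measure_sdiff hsub hE'.nullMeasurableSet (measure_ne_top_of_subset hsub hfin), hvE']
    lift volume E to NNReal using hfin with v
    rw [ ← ENNReal.ofReal_coe_nnreal, ← ENNReal.ofReal_mul (by norm_num),
      ← ENNReal.ofReal_sub _ (by positivity)]
    congr 1; ring
  calc ∫⁻ z in E, ENNReal.ofReal |(f' z).det|
      = (∫⁻ z in E', ENNReal.ofReal |(f' z).det|) + ∫⁻ z in E \ E', ENNReal.ofReal |(f' z).det| := by
        rw [← lintegral_union (hE.diff hE') Set.disjoint_sdiff_right, Set.union_sdiff_cancel hsub]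
    _ ≤ ENNReal.ofReal (2 ^ n * C * (1 / 2)) * volume E' +
          ENNReal.ofReal (2 ^ n * C) * volume (E \ E') := by
        refine add_le_add ?_ ?_
        · exact (setLIntegral_mono' hE' hbd').trans_eq (setLIntegral_const _ _)
        · exact (setLIntegral_mono' (hE.diff hE') fun z hz => hbd z hz.1).trans_eq
            (setLIntegral_const _ _)
    _ = ENNReal.ofReal (3 / 4 * 2 ^ n * C) * volume E := by
        rw [hvE', hdiff, ← mul_assoc, ← mul_assoc, ← add_mul,
          ← ENNReal.ofReal_mul (by positivity), ← ENNReal.ofReal_mul (by positivity),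
          ← ENNReal.ofReal_add (by positivity) (by positivity)]
        congr 2; ring

/-- If translates of the `E q` under volume preserving diagonal maps are disjoint, and for each
`s ∈ S` the maps `d s u` can move any point of `E q` into `B`, then `#S · ∑ vol (E q) ≤ vol B`. -/
lemma packing {Q S U : Type*} [Fintype Q] [Fintype S] [Countable U]
    {E : Q → Set (ι → ℝ)} (hE : ∀ q, MeasurableSet (E q)) {B : Set (ι → ℝ)}
    (hB : MeasurableSet B) (d : S → U → ι → ℝ) (hd : ∀ s u, |∏ i, d s u i| = 1)
    (hdisj : ∀ q q' s s' u u', ∀ z ∈ E q, ∀ z' ∈ E q', d s u * z = d s' u' * z' →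
      q = q' ∧ s = s' ∧ u = u')
    (hcov : ∀ s, ∀ q, ∀ z ∈ E q, ∃ u, d s u * z ∈ B) :
    Fintype.card S * ∑ q, volume (E q) ≤ volume B := by
  have hd0 : ∀ s u, ∏ i, d s u i ≠ 0 := fun s u h => by simpa [h] using hd s u
  have hdi : ∀ s u i, d s u i ≠ 0 := fun s u i h =>
    hd0 s u (Finset.prod_eq_zero (Finset.mem_univ i) h)
  let D : Q × S × U → Set (ι → ℝ) := fun p =>
    (fun x => (d p.2.1 p.2.2)⁻¹ * x) ⁻¹' (E p.1 ∩ (fun z => d p.2.1 p.2.2 * z) ⁻¹' B)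
  have hmul : ∀ s u (x : ι → ℝ), d s u * ((d s u)⁻¹ * x) = x := fun s u x => by
    ext i; simp [hdi s u i]
  have hmeas : ∀ w : ι → ℝ, Measurable fun z : ι → ℝ => w * z := fun w => by fun_prop
  have hD : ∀ p, MeasurableSet (D p) := fun p =>
    hmeas _ ((hE _).inter (hmeas _ hB))
  have hDB : ∀ p, D p ⊆ B := fun p x hx => by
    have := hx.2
    simpa [hmul] using this
  have hDd : Pairwise (Function.onFun Disjoint D) := by
    rintro ⟨q, s, u⟩ ⟨q', s', u'⟩ hne
    refine Set.disjoint_left.2 fun x hx hx' => hne ?_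
    obtain ⟨rfl, rfl, rfl⟩ := hdisj q q' s s' u u' _ hx.1 _ hx'.1 (by simp [hmul])
    rfl
  have hvD : ∀ q s u, volume (D (q, s, u)) = volume (E q ∩ (fun z => d s u * z) ⁻¹' B) := by
    intro q s u
    have h1 : ∏ i, (d s u)⁻¹ i = (∏ i, d s u i)⁻¹ := by simp
    have h2 : |∏ i, (d s u)⁻¹ i| = 1 := by rw [h1, abs_inv, hd, inv_one]
    have h3 : ∏ i, (d s u)⁻¹ i ≠ 0 := by rw [h1]; exact inv_ne_zero (hd0 s u)
    change volume ((fun x => (d s u)⁻¹ * x) ⁻¹' _) = _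
    rw [volume_preimage_mul h3, h2]
    simp
  have hsum : ∑' p, volume (D p) ≤ volume B := by
    have : Countable (Q × S × U) := inferInstance
    rw [← measure_iUnion hDd hD]
    exact measure_mono (Set.iUnion_subset hDB)
  refine le_trans ?_ hsum
  rw [ENNReal.tsum_prod', tsum_fintype, Finset.mul_sum]
  refine Finset.sum_le_sum fun q _ => ?_
  rw [ENNReal.tsum_prod', tsum_fintype, ← nsmul_eq_mul, ← Finset.card_univ, ← Finset.sum_const]
  refine Finset.sum_le_sum fun s _ => ?_
  simp only [hvD]
  refine le_trans (measure_mono fun z hz => ?_) (measure_iUnion_le _)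
  obtain ⟨u, hu⟩ := hcov s q z hz
  exact Set.mem_iUnion.2 ⟨u, hz, hu⟩

end Volume

section Embeddings

variable {K : Type*} [Field K] [NumberField K]

/-- The real and complex embeddings of a totally real field agree. -/
noncomputable def embeddingEquiv (htr : TotallyReal K) : (K →+* ℝ) ≃ (K →ₐ[ℚ] ℂ) :=
  (Equiv.ofBijective (fun φ : K →+* ℝ => Complex.ofRealHom.comp φ) ⟨fun φ ψ h => by
      ext x
      exact Complex.ofReal_injective (RingHom.congr_fun h x), fun ψ => by
      have hreal : ComplexEmbedding.IsReal ψ :=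
        InfinitePlace.isReal_mk_iff.1 (htr (InfinitePlace.mk ψ))
      exact ⟨hreal.embedding, RingHom.ext fun x => hreal.coe_embedding_apply x⟩⟩).trans
    (RingHom.equivRatAlgHom K ℂ)

lemma embeddingEquiv_apply (htr : TotallyReal K) (φ : K →+* ℝ) (x : K) :
    embeddingEquiv htr φ x = (φ x : ℂ) := rfl

lemma card_embeddings (htr : TotallyReal K) : Fintype.card (K →+* ℝ) = Module.finrank ℚ K := by
  rw [Fintype.card_congr (embeddingEquiv htr), AlgHom.card]

lemma trace_eq_sum (htr : TotallyReal K) (x : K) :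
    ((Algebra.trace ℚ K x : ℚ) : ℝ) = ∑ φ : K →+* ℝ, φ x := by
  have h := trace_eq_sum_embeddings ℂ (K := ℚ) (x := x)
  rw [← (embeddingEquiv htr).sum_comp] at h
  simp only [embeddingEquiv_apply, eq_ratCast] at h
  exact_mod_cast h

lemma norm_eq_prod (htr : TotallyReal K) (x : K) :
    ((Algebra.norm ℚ x : ℚ) : ℝ) = ∏ φ : K →+* ℝ, φ x := by
  have h := Algebra.norm_eq_prod_embeddings ℚ ℂ x
  rw [← (embeddingEquiv htr).prod_comp] at h
  simp only [embeddingEquiv_apply, eq_ratCast] at h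
  exact_mod_cast h

lemma trForm_eq_sum (htr : TotallyReal K) (a : K) (x : 𝓞 K) :
    ((trForm a x : ℚ) : ℝ) = ∑ φ : K →+* ℝ, φ a * φ x ^ 2 := by
  simp [trForm, trace_eq_sum htr]

lemma nonempty_embeddings (htr : TotallyReal K) : Nonempty (K →+* ℝ) := by
  rw [← Fintype.card_pos_iff, card_embeddings htr]
  exact Module.finrank_pos

/-- An integral basis indexed by the real embeddings. -/
noncomputable def intBasis (htr : TotallyReal K) : Module.Basis (K →+* ℝ) ℤ (𝓞 K) :=
  (RingOfIntegers.basis K).reindex (Fintype.equivOfCardEq (by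
    rw [card_embeddings htr, ← Module.finrank_eq_card_basis (RingOfIntegers.basis K),
      RingOfIntegers.rank]))

/-- Rows are the images in `ℝ^n` of the elements of a family. -/
def embMatrix {ι : Type*} (v : ι → K) : Matrix ι (K →+* ℝ) ℝ := Matrix.of fun i φ => φ (v i)

lemma det_intBasis_sq (htr : TotallyReal K) [DecidableEq (K →+* ℝ)] :
    (embMatrix fun i => (intBasis htr i : K)).det ^ 2 = (discr K : ℝ) := by
  have h := discr_eq_discr K (intBasis htr)
  rw [← h, Algebra.discr_def, sq]
  nth_rewrite 2 [← Matrix.det_transpose]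
  rw [← Matrix.det_mul]
  have : ((Algebra.traceMatrix ℤ (intBasis htr)).map (Int.cast : ℤ → ℝ)) =
      (embMatrix fun i => (intBasis htr i : K)) *
        (embMatrix fun i => (intBasis htr i : K)).transpose := by
    ext i j
    have ht := Algebra.trace_localization ℤ (nonZeroDivisors ℤ) (Rₘ := ℚ) (Sₘ := K)
      (intBasis htr i * intBasis htr j)
    have h2 := trace_eq_sum htr (intBasis htr i * intBasis htr j : K)
    rw [map_mul] at ht
    rw [show (algebraMap (𝓞 K) K (intBasis htr i)) * algebraMap (𝓞 K) K (intBasis htr j) =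
      (intBasis htr i * intBasis htr j : K) from rfl] at ht
    rw [ht] at h2
    simp only [Matrix.map_apply, Algebra.traceMatrix_apply, Algebra.traceForm_apply,
      Matrix.mul_apply, Matrix.transpose_apply, embMatrix, Matrix.of_apply]
    simpa using h2
  rw [← this, Int.cast_det]

lemma discr_pos (htr : TotallyReal K) : (0 : ℝ) < discr K := by
  classical
  rw [← det_intBasis_sq htr]
  have h : (discr K : ℝ) ≠ 0 := by exact_mod_cast discr_ne_zero K
  rw [← det_intBasis_sq htr] at h
  positivity

lemma abs_det_intBasis (htr : TotallyReal K) [DecidableEq (K →+* ℝ)] :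
    |(embMatrix fun i => (intBasis htr i : K)).det| = √(discr K : ℝ) := by
  rw [← det_intBasis_sq htr, Real.sqrt_sq_eq_abs]

/-- The covolume of a full rank family of algebraic integers is at least that of `𝓞 K`. -/
lemma sqrt_discr_le_abs_det (htr : TotallyReal K) [DecidableEq (K →+* ℝ)] {v : (K →+* ℝ) → 𝓞 K}
    (hv : LinearIndependent ℤ v) :
    √(discr K : ℝ) ≤ |(embMatrix fun i => (v i : K)).det| := by
  set b := intBasis htr
  set P : Matrix (K →+* ℝ) (K →+* ℝ) ℤ := Matrix.of fun i j => b.repr (v i) j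
  have hP : P.det ≠ 0 := by
    intro h0
    obtain ⟨c, hc, hcP⟩ := Matrix.exists_vecMul_eq_zero_iff.2 h0
    refine hc (funext (Fintype.linearIndependent_iff.1 hv c (b.ext_elem fun j => ?_)))
    simpa [Matrix.vecMul, dotProduct, P, Finsupp.finsetSum_apply, -zsmul_eq_mul] using congrFun hcP j
  have hmul : (embMatrix fun i => (v i : K)) =
      P.map (Int.cast : ℤ → ℝ) * embMatrix fun i => (b i : K) := by
    ext i φ
    have h := congrArg (fun x : 𝓞 K => φ (x : K)) (b.sum_repr (v i))
    simp only [Matrix.mul_apply, embMatrix, Matrix.of_apply, Matrix.map_apply, P]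
    rw [← h]
    simp
  rw [hmul, Matrix.det_mul, abs_mul, abs_det_intBasis, ← Int.cast_det]
  have : (1 : ℝ) ≤ |(P.det : ℝ)| := by exact_mod_cast Int.one_le_abs hP
  nlinarith [Real.sqrt_nonneg (discr K : ℝ)]

end Embeddings

section Minima

variable {K : Type*} [Field K] [NumberField K]

lemma det_embMatrix_ne_zero (htr : TotallyReal K) [DecidableEq (K →+* ℝ)] {v : (K →+* ℝ) → 𝓞 K}
    (hv : LinearIndependent ℤ v) : (embMatrix fun i => (v i : K)).det ≠ 0 := by
  have h1 := sqrt_discr_le_abs_det htr hv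
  have h2 := Real.sqrt_pos.2 (discr_pos htr)
  exact abs_pos.1 (h2.trans_le h1)

lemma convex_ellipsoid {ι : Type*} [Fintype ι] (w : ι → ℝ) :
    Convex ℝ {z : ι → ℝ | ∑ i, (w i * z i) ^ 2 < 1} := by
  intro x hx y hy a b ha hb hab
  simp only [Set.mem_ofPred_eq, Pi.add_apply, Pi.smul_apply, smul_eq_mul] at *
  have hle : ∑ i, (w i * (a * x i + b * y i)) ^ 2 ≤
      a * ∑ i, (w i * x i) ^ 2 + b * ∑ i, (w i * y i) ^ 2 := by
    rw [Finset.mul_sum, Finset.mul_sum, ← Finset.sum_add_distrib]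
    refine Finset.sum_le_sum fun i _ => ?_
    obtain rfl : b = 1 - a := by linarith
    nlinarith [mul_nonneg (mul_nonneg ha hb) (sq_nonneg (w i * x i - w i * y i))]
  rcases ha.eq_or_lt with rfl | ha'
  · obtain rfl : b = 1 := by linarith
    linarith
  · nlinarith

/-- Minkowski's convex body theorem for the quadratic form `∑ y_φ φ(x)²` on `𝓞 K`. -/
lemma pow_mul_ballVol_sq_le (htr : TotallyReal K) {y : (K →+* ℝ) → ℝ} (hy : ∀ φ, 0 < y φ) {m : ℝ}
    (hm : 0 < m) (h : ∀ x : 𝓞 K, x ≠ 0 → m ≤ ∑ φ, y φ * φ x ^ 2) :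
    m ^ Fintype.card (K →+* ℝ) * ballVol (Fintype.card (K →+* ℝ)) ^ 2 ≤
      4 ^ Fintype.card (K →+* ℝ) * discr K * ∏ φ, y φ := by
  classical
  set n := Fintype.card (K →+* ℝ) with hn
  have : Nonempty (K →+* ℝ) := nonempty_embeddings htr
  set b := intBasis htr
  set A := embMatrix fun i => (b i : K)
  have hli : LinearIndependent ℝ (fun i => A i) :=
    Matrix.linearIndependent_rows_of_det_ne_zero (det_embMatrix_ne_zero htr b.linearIndependent)
  let B := basisOfLinearIndependentOfCardEqFinrank hli (by simp)
  have hB : ∀ i, B i = A i := fun i => by simp [B]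
  let w : (K →+* ℝ) → ℝ := fun φ => √(y φ / m)
  have hw : ∀ φ, 0 < w φ := fun φ => Real.sqrt_pos.2 (div_pos (hy φ) hm)
  have hwsq : ∀ φ, w φ ^ 2 = y φ / m := fun φ => Real.sq_sqrt (div_pos (hy φ) hm).le
  set s := {z : (K →+* ℝ) → ℝ | ∑ φ, (w φ * z φ) ^ 2 < 1}
  have hvol : volume s = ENNReal.ofReal ((∏ φ, w φ)⁻¹ * ballVol n) := volume_ellipsoid hw
  have hfund : volume (ZSpan.fundamentalDomain B) = ENNReal.ofReal √(discr K : ℝ) := by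
    rw [ZSpan.volume_fundamentalDomain, ← abs_det_intBasis htr]
    congr 3
    ext i φ
    simp [hB, A, b]
  have hpw : 0 < ∏ φ, w φ := Finset.prod_pos fun φ _ => hw φ
  have key : (∏ φ, w φ)⁻¹ * ballVol n ≤ √(discr K : ℝ) * 2 ^ n := by
    by_contra! hlt
    have hlt' : volume (ZSpan.fundamentalDomain B) *
        2 ^ Module.finrank ℝ ((K →+* ℝ) → ℝ) < volume s := by
      rw [hvol, hfund, Module.finrank_fintype_fun_eq_card,
        show (2 : ENNReal) = ENNReal.ofReal 2 by simp, ← ENNReal.ofReal_pow (by norm_num),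
        ← ENNReal.ofReal_mul (by positivity)]
      exact (ENNReal.ofReal_lt_ofReal_iff (mul_pos (inv_pos.2 hpw) (ballVol_pos n))).2 hlt
    have : Countable (Submodule.span ℤ (Set.range B)).toAddSubgroup := by
      change Countable (Submodule.span ℤ (Set.range B))
      infer_instance
    obtain ⟨⟨x, hx⟩, hx0, hxs⟩ := exists_ne_zero_mem_lattice_of_measure_mul_two_pow_lt_measure
      (ZSpan.isAddFundamentalDomain' B volume) (by simp) (convex_ellipsoid w) hlt'
    obtain ⟨c, rfl⟩ := (Submodule.mem_span_range_iff_exists_fun ℤ).1 hx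
    have hcoord : ∀ φ : K →+* ℝ, (∑ i, c i • B i) φ = φ ((∑ i, c i • b i : 𝓞 K) : K) := by
      intro φ
      simp [Finset.sum_apply, hB, A, embMatrix]
    have hX0 : (∑ i, c i • b i : 𝓞 K) ≠ 0 := by
      intro h0
      refine hx0 (Subtype.ext (funext fun φ => ?_))
      change (∑ i, c i • B i) φ = 0
      rw [hcoord, h0]; simp
    have h1 := h _ hX0
    have h2 : ∑ φ, (w φ * (∑ i, c i • B i) φ) ^ 2 < 1 := hxs
    simp only [hcoord, mul_pow, hwsq] at h2
    have h3 : ∑ φ : K →+* ℝ, y φ / m * φ ((∑ i, c i • b i : 𝓞 K) : K) ^ 2 =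
        (∑ φ : K →+* ℝ, y φ * φ ((∑ i, c i • b i : 𝓞 K) : K) ^ 2) / m := by
      rw [Finset.sum_div]
      exact Finset.sum_congr rfl fun φ _ => by ring
    rw [h3, div_lt_one hm] at h2
    linarith
  have hprod : (∏ φ, w φ) ^ 2 * m ^ n = ∏ φ, y φ := by
    rw [← Finset.prod_pow, Finset.prod_congr rfl fun φ _ => hwsq φ, Finset.prod_div_distrib,
      Finset.prod_const, Finset.card_univ, ← hn, div_mul_cancel₀ _ (by positivity)]
  rw [inv_mul_le_iff₀ hpw] at key
  have hsq := pow_le_pow_left₀ (ballVol_pos n).le key 2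
  have hd : √(discr K : ℝ) ^ 2 = discr K := Real.sq_sqrt (discr_pos htr).le
  calc m ^ n * ballVol n ^ 2 ≤ m ^ n * ((∏ φ, w φ) * (√(discr K : ℝ) * 2 ^ n)) ^ 2 := by gcongr
    _ = (2 ^ n) ^ 2 * √(discr K : ℝ) ^ 2 * ((∏ φ, w φ) ^ 2 * m ^ n) := by ring
    _ = 4 ^ n * discr K * ∏ φ, y φ := by
      rw [hd, hprod, ← pow_mul, mul_comm n 2, pow_mul]; norm_num

lemma trForm_pos (htr : TotallyReal K) {a : K} (ha : TotPos a) {x : 𝓞 K} (hx : x ≠ 0) :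
    0 < trForm a x := by
  have h := trForm_eq_sum htr a x
  have : Nonempty (K →+* ℝ) := nonempty_embeddings htr
  have h2 : (0 : ℝ) < ∑ φ : K →+* ℝ, φ a * φ x ^ 2 := by
    refine Finset.sum_pos (fun φ _ => ?_) Finset.univ_nonempty
    have : φ (x : K) ≠ 0 := by simpa using hx
    have := ha φ
    positivity
  rw [← h] at h2
  exact_mod_cast h2

lemma exists_trForm_min (htr : TotallyReal K) {a : K} (ha : TotPos a) :
    ∃ x : 𝓞 K, x ≠ 0 ∧ ∀ x' : 𝓞 K, x' ≠ 0 → trForm a x ≤ trForm a x' := by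
  classical
  obtain ⟨D, hD0, hD⟩ := IsAlgebraic.exists_integral_multiple
    ((IsFractionRing.isAlgebraic_iff ℤ ℚ K).2 (Algebra.IsAlgebraic.isAlgebraic a))
  have hint : ∀ x : 𝓞 K, ∃ k : ℤ, (k : ℚ) = D * trForm a x := by
    intro x
    have h1 : IsIntegral ℤ (D • a * (x : K) ^ 2) :=
      hD.mul ((RingOfIntegers.isIntegral_coe x).pow 2)
    obtain ⟨k, hk⟩ := IsIntegrallyClosed.isIntegral_iff.1
      (Algebra.isIntegral_trace (L := ℚ) h1)
    refine ⟨k, ?_⟩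
    rw [eq_intCast] at hk
    rw [hk, trForm, zsmul_eq_mul, mul_assoc, ← zsmul_eq_mul, map_zsmul, zsmul_eq_mul]
  choose k hk using hint
  have hDa : (0 : ℚ) < |(D : ℚ)| := by positivity
  have habs : ∀ x : 𝓞 K, x ≠ 0 → (((k x).natAbs : ℕ) : ℚ) = |(D : ℚ)| * trForm a x := by
    intro x hx
    rw [Nat.cast_natAbs, Int.cast_abs, hk, abs_mul, abs_of_pos (trForm_pos htr ha hx)]
  have hne : ∃ N, ∃ x : 𝓞 K, x ≠ 0 ∧ (k x).natAbs = N := ⟨_, 1, one_ne_zero, rfl⟩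
  obtain ⟨x, hx0, hx⟩ := Nat.find_spec hne
  refine ⟨x, hx0, fun x' hx' => ?_⟩
  have h1 : (k x).natAbs ≤ (k x').natAbs := hx ▸ Nat.find_min' hne ⟨x', hx', rfl⟩
  have h2 : (((k x).natAbs : ℕ) : ℚ) ≤ ((k x').natAbs : ℕ) := by exact_mod_cast h1
  rw [habs x hx0, habs x' hx'] at h2
  exact le_of_mul_le_mul_left h2 hDa

lemma muMin_eq {a : K} {x : 𝓞 K} (hx : x ≠ 0)
    (hmin : ∀ x' : 𝓞 K, x' ≠ 0 → trForm a x ≤ trForm a x') : muMin a = trForm a x := by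
  refine IsLeast.csInf_eq ⟨⟨x, hx, rfl⟩, ?_⟩
  rintro _ ⟨x', hx', rfl⟩
  exact_mod_cast hmin x' hx'

lemma exists_unit_of_totPos (htr : TotallyReal K) (hur : IsAReducible K 1) {a : K}
    (ha : TotPos a) : ∃ u : (𝓞 K)ˣ,
      (∑ φ : K →+* ℝ, φ a * φ (u : 𝓞 K) ^ 2) ^ Fintype.card (K →+* ℝ) *
          ballVol (Fintype.card (K →+* ℝ)) ^ 2 ≤
        4 ^ Fintype.card (K →+* ℝ) * discr K * ∏ φ : K →+* ℝ, φ a := by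
  obtain ⟨x, hx0, hmin⟩ := exists_trForm_min htr ha
  have hx : IsUnit x := by
    have h1 := hur a ha x (muMin_eq hx0 hmin).symm
    rw [NumberField.isUnit_iff_norm]
    have h2 : |Algebra.norm ℤ x| ≤ 1 := by
      have : (Algebra.norm ℚ (x : K)) = ((Algebra.norm ℤ x : ℤ) : ℚ) :=
        (Algebra.coe_norm_int x).symm
      rw [this] at h1
      exact_mod_cast h1
    have h3 : Algebra.norm ℤ x ≠ 0 := Algebra.norm_ne_zero_iff.2 hx0
    have h4 : |Algebra.norm ℤ x| = 1 := le_antisymm h2 (Int.one_le_abs h3)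
    rw [RingOfIntegers.coe_norm, ← Algebra.coe_norm_int]
    exact_mod_cast h4
  obtain ⟨u, rfl⟩ := hx
  refine ⟨u, ?_⟩
  have hpos := trForm_pos htr ha hx0
  have := pow_mul_ballVol_sq_le htr (y := fun φ => φ a) ha
    (m := ((trForm a (u : 𝓞 K) : ℚ) : ℝ)) (by exact_mod_cast hpos) fun x hx => by
      rw [← trForm_eq_sum htr]
      exact_mod_cast hmin x hx
  rwa [trForm_eq_sum htr] at this

lemma denseRange_embeddings (htr : TotallyReal K) :
    DenseRange fun (a : K) (φ : K →+* ℝ) => φ a := by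
  classical
  set b := intBasis htr
  set A := embMatrix fun i => (b i : K)
  have hA : IsUnit A := by
    rw [Matrix.isUnit_iff_isUnit_det, isUnit_iff_ne_zero]
    exact det_embMatrix_ne_zero htr b.linearIndependent
  have h1 : DenseRange fun (q : (K →+* ℝ) → ℚ) (i : K →+* ℝ) => ((q i : ℚ) : ℝ) :=
    DenseRange.piMap fun _ => Rat.denseRange_cast
  have h2 : Function.Surjective fun c : (K →+* ℝ) → ℝ => Matrix.vecMul c A :=
    Matrix.vecMul_surjective_iff_isUnit.2 hA
  have h3 : DenseRange _ := h2.denseRange.comp h1 (by fun_prop)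
  refine h3.mono ?_
  rintro _ ⟨q, rfl⟩
  refine ⟨∑ i, q i • (b i : K), funext fun φ => ?_⟩
  simp [Matrix.vecMul, dotProduct, A, embMatrix, Algebra.smul_def]

/-- In a unit reducible field every positive real point can be moved by a unit to a point whose
trace is controlled by its norm. -/
lemma exists_unit_of_pos (htr : TotallyReal K) (hur : IsAReducible K 1) {y : (K →+* ℝ) → ℝ}
    (hy : ∀ φ, 0 < y φ) {τ : ℝ} (hτ : 1 < τ) : ∃ u : (𝓞 K)ˣ,
      (∑ φ : K →+* ℝ, y φ * φ (u : 𝓞 K) ^ 2) ^ Fintype.card (K →+* ℝ) *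
          ballVol (Fintype.card (K →+* ℝ)) ^ 2 ≤
        4 ^ Fintype.card (K →+* ℝ) * discr K * (τ ^ Fintype.card (K →+* ℝ) * ∏ φ, y φ) := by
  set O : Set ((K →+* ℝ) → ℝ) := Set.univ.pi fun φ => Set.Ioo (y φ) (τ * y φ)
  have hO : IsOpen O := isOpen_set_pi Set.finite_univ fun φ _ => isOpen_Ioo
  have hne : O.Nonempty := Set.univ_pi_nonempty_iff.2 fun φ =>
    Set.nonempty_Ioo.2 (by nlinarith [hy φ])
  obtain ⟨a, ha⟩ := (denseRange_embeddings htr).exists_mem_open hO hne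
  have h1 : ∀ φ : K →+* ℝ, y φ < φ a := fun φ => (ha φ trivial).1
  have h2 : ∀ φ : K →+* ℝ, φ a < τ * y φ := fun φ => (ha φ trivial).2
  obtain ⟨u, hu⟩ := exists_unit_of_totPos htr hur fun φ => (hy φ).trans (h1 φ)
  refine ⟨u, le_trans ?_ (hu.trans ?_)⟩
  · have hs : ∑ φ : K →+* ℝ, y φ * φ (u : 𝓞 K) ^ 2 ≤ ∑ φ : K →+* ℝ, φ a * φ (u : 𝓞 K) ^ 2 :=
      Finset.sum_le_sum fun φ _ => mul_le_mul_of_nonneg_right (h1 φ).le (sq_nonneg _)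
    have h0 : 0 ≤ ∑ φ : K →+* ℝ, y φ * φ (u : 𝓞 K) ^ 2 :=
      Finset.sum_nonneg fun φ _ => mul_nonneg (hy φ).le (sq_nonneg _)
    gcongr
  · have hd := (discr_pos htr).le
    refine mul_le_mul_of_nonneg_left ?_ (by positivity)
    calc ∏ φ : K →+* ℝ, φ a ≤ ∏ φ, τ * y φ :=
          Finset.prod_le_prod (fun φ _ => ((hy φ).trans (h1 φ)).le) fun φ _ => (h2 φ).le
      _ = _ := by simp [Finset.prod_mul_distrib]

end Minima

section NormalForm

variable {K : Type*} [Field K] [NumberField K]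

/-- Small perturbations of a totally positive element are totally positive. -/
lemma exists_totPos_add {a : K} (ha : TotPos a) (d : K) :
    ∃ N : ℕ, N ≠ 0 ∧ TotPos (a + d / N) := by
  have h : ∀ φ : K →+* ℝ, ∀ᶠ N : ℕ in Filter.atTop, 0 < φ (a + d / N) := by
    intro φ
    have h1 : Filter.Tendsto (fun N : ℕ => φ a + φ d / (N : ℝ)) Filter.atTop (nhds (φ a + 0)) :=
      tendsto_const_nhds.add (tendsto_const_div_atTop_nhds_zero_nat _)
    rw [add_zero] at h1
    filter_upwards [h1.eventually (lt_mem_nhds (ha φ))] with N hN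
    simpa using hN
  obtain ⟨N, hN, hN0⟩ := ((Filter.eventually_all.2 h).and (Filter.eventually_ne_atTop 0)).exists
  exact ⟨N, hN0, hN⟩

lemma span_sq_minVecs {a : K} (ha : IsPerfectForm a) :
    Submodule.span ℚ ((fun x : 𝓞 K => (x : K) ^ 2) '' MinVecs a) = ⊤ := by
  by_contra hne
  obtain ⟨f, hf0, hf⟩ := Submodule.exists_le_ker_of_lt_top _ (lt_top_iff_ne_top.2 hne)
  set d := ((Algebra.traceForm ℚ K).toDual (traceForm_nondegenerate ℚ K)).symm f with hd
  have hdf : ∀ x, Algebra.trace ℚ K (d * x) = f x := by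
    intro x
    have := LinearMap.BilinForm.apply_toDual_symm_apply
      (hB := traceForm_nondegenerate ℚ K) f x
    rwa [Algebra.traceForm_apply] at this
  have hd0 : d ≠ 0 := by
    intro h0
    refine hf0 (LinearMap.ext fun x => ?_)
    rw [← hdf, h0]
    simp
  obtain ⟨N, hN0, hN⟩ := exists_totPos_add ha.1 d
  have hN0' : (N : K) ≠ 0 := by exact_mod_cast hN0
  have := ha.2 _ hN fun x hx => by
    have h1 : f ((x : K) ^ 2) = 0 := hf (Submodule.subset_span ⟨x, hx, rfl⟩)
    have h2 : trForm (a + d / N) x = trForm a x := by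
      have : (a + d / N) * (x : K) ^ 2 = a * (x : K) ^ 2 + (N : ℚ)⁻¹ • (d * (x : K) ^ 2) := by
        rw [Algebra.smul_def]
        simp
        field_simp
      rw [trForm, trForm, this, map_add, map_smul, hdf, h1]
      simp
    rw [h2]
    exact hx
  exact (div_ne_zero hd0 hN0') (by simpa using this)

/-- `a` has minimum `1`, attained at the `v i`, whose squares are linearly independent. -/
structure IsNormalized (a : K) (v : (K →+* ℝ) → 𝓞 K) : Prop where
  totPos : TotPos a
  eq_one : ∀ i, ∑ φ : K →+* ℝ, φ a * φ (v i) ^ 2 = 1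
  linearIndependent : LinearIndependent ℤ fun i => v i ^ 2
  one_le : ∀ x : 𝓞 K, x ≠ 0 → 1 ≤ ∑ φ : K →+* ℝ, φ a * φ x ^ 2

/-- Every perfect form can be normalized by a positive rational scaling. -/
lemma exists_normalized (htr : TotallyReal K) {a : K} (ha : IsPerfectForm a) :
    ∃ q : ℚ, 0 < q ∧ ∃ v, IsNormalized ((q : K) * a) v := by
  obtain ⟨x₀, hx₀, hmin⟩ := exists_trForm_min htr ha.1
  have hμ : muMin a = trForm a x₀ := muMin_eq hx₀ hmin
  have hpos : 0 < trForm a x₀ := trForm_pos htr ha.1 hx₀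
  have hposR : (0 : ℝ) < trForm a x₀ := by exact_mod_cast hpos
  have hscale : ∀ x : 𝓞 K, ∑ φ : K →+* ℝ, φ (((trForm a x₀)⁻¹ : ℚ) * a) * φ x ^ 2 =
      (trForm a x₀ : ℝ)⁻¹ * trForm a x := by
    intro x
    rw [trForm_eq_sum htr a x, Finset.mul_sum]
    refine Finset.sum_congr rfl fun φ _ => ?_
    rw [map_mul, map_ratCast]
    push_cast
    ring
  obtain ⟨b, hbs, hbspan, hbli⟩ :=
    exists_linearIndependent ℚ ((fun x : 𝓞 K => (x : K) ^ 2) '' MinVecs a)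
  rw [span_sq_minVecs ha] at hbspan
  let B : Module.Basis b ℚ K := Module.Basis.mk hbli (by rw [Subtype.range_coe]; exact hbspan.ge)
  have : Fintype b := FiniteDimensional.fintypeBasisIndex B
  let e : (K →+* ℝ) ≃ b := Fintype.equivOfCardEq (by
    rw [card_embeddings htr, Module.finrank_eq_card_basis B])
  choose v hv hvb using fun i => hbs (e i).2
  refine ⟨(trForm a x₀)⁻¹, inv_pos.2 hpos, v, fun φ => ?_, fun i => ?_, ?_, fun x hx => ?_⟩
  · rw [map_mul, map_ratCast]
    have := ha.1 φ
    push_cast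
    positivity
  · have h1 : (trForm a (v i) : ℝ) = muMin a := hv i
    rw [hscale, h1, hμ, inv_mul_cancel₀ hposR.ne']
  · have h1 : LinearIndependent ℤ (fun i => (e i : K)) :=
      (hbli.comp e e.injective).restrict_scalars' ℤ
    refine LinearIndependent.of_comp (Algebra.linearMap (𝓞 K) K |>.restrictScalars ℤ) ?_
    convert h1 using 2 with i
    simpa using hvb i
  · rw [hscale, inv_mul_eq_div, one_le_div hposR]
    exact_mod_cast hmin x hx

end NormalForm

section Cone

variable {K : Type*} [Field K] [NumberField K]

lemma IsNormalized.ne_zero {a : K} {v : (K →+* ℝ) → 𝓞 K} (h : IsNormalized a v) (i : K →+* ℝ) :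
    v i ≠ 0 := fun h0 => h.linearIndependent.ne_zero i (by simp [h0])

lemma IsNormalized.pos {a : K} {v : (K →+* ℝ) → 𝓞 K} (h : IsNormalized a v) (i φ : K →+* ℝ) :
    0 < φ (v i) ^ 2 := by
  have : φ (v i) ≠ 0 := by simpa using h.ne_zero i
  positivity

lemma sum_mul_sum_sq_comm {c y : (K →+* ℝ) → ℝ} (w : (K →+* ℝ) → 𝓞 K) :
    ∑ φ : K →+* ℝ, y φ * ∑ i, c i * φ (w i) ^ 2 = ∑ i, c i * ∑ φ : K →+* ℝ, y φ * φ (w i) ^ 2 := by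
  simp_rw [Finset.mul_sum]
  rw [Finset.sum_comm]
  exact Finset.sum_congr rfl fun i _ => Finset.sum_congr rfl fun φ _ => by ring

/-- The open simplicial cones spanned by the squares of the minimal vectors of two normalized forms
can meet only if the forms coincide. -/
lemma IsNormalized.eq_mul_sq (htr : TotallyReal K) {a b : K} {v v' : (K →+* ℝ) → 𝓞 K}
    (h : IsNormalized a v) (h' : IsNormalized b v') {c c' : (K →+* ℝ) → ℝ} (hc : ∀ i, 0 < c i)
    (hc' : ∀ i, 0 < c' i) (g : (𝓞 K)ˣ)
    (heq : ∀ φ : K →+* ℝ, φ (g : 𝓞 K) ^ 2 * ∑ i, c i * φ (v i) ^ 2 = ∑ i, c' i * φ (v' i) ^ 2) :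
    a = b * ((g : 𝓞 K) : K) ^ 2 := by
  classical
  have hg : ∀ φ : K →+* ℝ, φ (g : 𝓞 K) * φ (g⁻¹ : (𝓞 K)ˣ) = 1 := fun φ => by
    rw [← map_mul, show ((g : 𝓞 K) : K) * ((g⁻¹ : (𝓞 K)ˣ) : 𝓞 K) = 1 from
      (map_mul (algebraMap (𝓞 K) K) _ _).symm.trans (by rw [g.mul_inv, map_one]), map_one]
  let F : (K →+* ℝ) → ℝ := fun i => ∑ φ : K →+* ℝ, φ b * φ ((g : 𝓞 K) * v i : 𝓞 K) ^ 2
  let G : (K →+* ℝ) → ℝ := fun i => ∑ φ : K →+* ℝ, φ a * φ ((g⁻¹ : (𝓞 K)ˣ) * v' i : 𝓞 K) ^ 2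
  have hF : ∀ i, 1 ≤ F i := fun i => h'.one_le _ (mul_ne_zero g.ne_zero (h.ne_zero i))
  have hG : ∀ i, 1 ≤ G i := fun i => h.one_le _ (mul_ne_zero (g⁻¹).ne_zero (h'.ne_zero i))
  have e1 : ∑ i, c' i = ∑ i, c i * F i := by
    rw [← sum_mul_sum_sq_comm]
    have := sum_mul_sum_sq_comm (c := c') (y := fun φ => φ b) v'
    simp only [h'.eq_one, mul_one] at this
    rw [← this]
    refine Finset.sum_congr rfl fun φ _ => ?_
    rw [← heq, Finset.mul_sum]
    simp [mul_pow, mul_left_comm]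
  have e2 : ∑ i, c i = ∑ i, c' i * G i := by
    rw [← sum_mul_sum_sq_comm]
    have := sum_mul_sum_sq_comm (c := c) (y := fun φ => φ a) v
    simp only [h.eq_one, mul_one] at this
    rw [← this]
    refine Finset.sum_congr rfl fun φ _ => ?_
    have : ∑ i, c i * φ (v i) ^ 2 = φ (g⁻¹ : (𝓞 K)ˣ) ^ 2 * ∑ i, c' i * φ (v' i) ^ 2 := by
      rw [← heq, ← mul_assoc, ← mul_pow, mul_comm (φ _) (φ (g : 𝓞 K)), hg]
      simp
    rw [this, Finset.mul_sum]
    simp [mul_pow, mul_left_comm]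
  have i2 : ∑ i, c' i ≤ ∑ i, c i := by
    rw [e2]
    exact Finset.sum_le_sum fun i _ => le_mul_of_one_le_right (hc' i).le (hG i)
  have hle : ∀ i ∈ Finset.univ, c i ≤ c i * F i := fun i _ =>
    le_mul_of_one_le_right (hc i).le (hF i)
  have hsum : ∑ i, c i = ∑ i, c i * F i := le_antisymm (Finset.sum_le_sum hle) (e1 ▸ i2)
  have hF1 : ∀ i, F i = 1 := fun i => by
    have := (Finset.sum_eq_sum_iff_of_le hle).1 hsum i (Finset.mem_univ i)
    exact (mul_eq_left₀ (hc i).ne').1 this.symm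
  have hdet := det_embMatrix_ne_zero htr h.linearIndependent
  have hz := Matrix.eq_zero_of_mulVec_eq_zero hdet
    (v := fun φ : K →+* ℝ => φ (b * ((g : 𝓞 K) : K) ^ 2 - a)) (by
      ext i
      have := h.eq_one i
      rw [← hF1 i, ← sub_eq_zero, ← Finset.sum_sub_distrib] at this
      rw [Pi.zero_apply, ← neg_eq_zero, ← this, Matrix.mulVec, dotProduct, ← Finset.sum_neg_distrib]
      refine Finset.sum_congr rfl fun φ _ => ?_
      simp [embMatrix]
      ring)
  obtain ⟨φ⟩ := nonempty_embeddings htr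
  have := congr_fun hz φ
  simp only [Pi.zero_apply, map_eq_zero] at this
  exact (sub_eq_zero.1 this).symm

/-- The truncated open cone spanned by the squares of the `v i`. -/
def cone (v : (K →+* ℝ) → 𝓞 K) : Set ((K →+* ℝ) → ℝ) :=
  {y | ∃ c : (K →+* ℝ) → ℝ, ((∀ i, 0 < c i) ∧ ∑ i, c i < 1) ∧
    ∀ φ, y φ = Fintype.card (K →+* ℝ) * ∑ i, c i * φ (v i) ^ 2}

lemma cone_eq_image [DecidableEq (K →+* ℝ)] (v : (K →+* ℝ) → 𝓞 K) :
    cone v = Matrix.toLin' ((Fintype.card (K →+* ℝ) : ℝ) •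
      (embMatrix fun i => ((v i ^ 2 : 𝓞 K) : K)).transpose) ''
        {c : (K →+* ℝ) → ℝ | (∀ i, 0 < c i) ∧ ∑ i, c i < 1} := by
  ext y
  refine exists_congr fun c => and_congr Iff.rfl ?_
  rw [funext_iff]
  refine forall_congr' fun φ => ?_
  rw [eq_comm]
  simp [Matrix.mulVec, dotProduct, embMatrix, mul_comm]

lemma IsNormalized.det_ne_zero [DecidableEq (K →+* ℝ)] (htr : TotallyReal K) {a : K}
    {v : (K →+* ℝ) → 𝓞 K} (h : IsNormalized a v) :
    ((Fintype.card (K →+* ℝ) : ℝ) •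
      (embMatrix fun i => ((v i ^ 2 : 𝓞 K) : K)).transpose).det ≠ 0 := by
  have : Nonempty (K →+* ℝ) := nonempty_embeddings htr
  rw [Matrix.det_smul, Matrix.det_transpose]
  exact mul_ne_zero (pow_ne_zero _ (by simp)) (det_embMatrix_ne_zero htr h.linearIndependent)

lemma IsNormalized.isOpen_cone (htr : TotallyReal K) {a : K} {v : (K →+* ℝ) → 𝓞 K}
    (h : IsNormalized a v) : IsOpen (cone v) := by
  classical
  rw [cone_eq_image]
  have hu : IsUnit ((Fintype.card (K →+* ℝ) : ℝ) •
      (embMatrix fun i => ((v i ^ 2 : 𝓞 K) : K)).transpose) :=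
    (Matrix.isUnit_iff_isUnit_det _).2 (h.det_ne_zero htr).isUnit
  refine LinearMap.isOpenMap_of_finiteDimensional _ (Matrix.mulVec_surjective_iff_isUnit.2 hu) _ ?_
  have h1 : IsOpen {c : (K →+* ℝ) → ℝ | ∀ i, 0 < c i} := by
    simp only [Set.ofPred_forall]
    exact isOpen_iInter_of_finite fun i => isOpen_lt continuous_const (continuous_apply i)
  have h2 : Continuous fun c : (K →+* ℝ) → ℝ => ∑ i, c i := by fun_prop
  exact h1.inter (isOpen_lt h2 continuous_const)

lemma IsNormalized.volume_cone_ge (htr : TotallyReal K) {a : K} {v : (K →+* ℝ) → 𝓞 K}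
    (h : IsNormalized a v) :
    ENNReal.ofReal (√(discr K) * Fintype.card (K →+* ℝ) ^ Fintype.card (K →+* ℝ) /
      (Fintype.card (K →+* ℝ)).factorial) ≤ volume (cone v) := by
  classical
  rw [cone_eq_image]
  refine le_trans ?_ (volume_simplicial_cone_ge _ (Nat.cast_nonneg _))
  rw [Matrix.det_transpose]
  gcongr
  exact sqrt_discr_le_abs_det htr h.linearIndependent

lemma IsNormalized.pos_of_mem_cone (htr : TotallyReal K) {a : K} {v : (K →+* ℝ) → 𝓞 K}
    (h : IsNormalized a v) {y : (K →+* ℝ) → ℝ} (hy : y ∈ cone v) (φ : K →+* ℝ) : 0 < y φ := by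
  have : Nonempty (K →+* ℝ) := nonempty_embeddings htr
  obtain ⟨c, ⟨hc, -⟩, hy⟩ := hy
  rw [hy]
  have := Finset.sum_pos (fun i _ => mul_pos (hc i) (h.pos i φ)) Finset.univ_nonempty
  have := Fintype.card_pos (α := K →+* ℝ)
  positivity

/-- The positive square roots of the points of the truncated cone. -/
def sqrtCone (v : (K →+* ℝ) → 𝓞 K) : Set ((K →+* ℝ) → ℝ) :=
  {z | (∀ φ, 0 < z φ) ∧ z ^ 2 ∈ cone v}

lemma IsNormalized.measurableSet_sqrtCone (htr : TotallyReal K) {a : K} {v : (K →+* ℝ) → 𝓞 K}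
    (h : IsNormalized a v) : MeasurableSet (sqrtCone v) := by
  have h1 : IsOpen {z : (K →+* ℝ) → ℝ | ∀ i, 0 < z i} := by
    simp only [Set.ofPred_forall]
    exact isOpen_iInter_of_finite fun i => isOpen_lt continuous_const (continuous_apply i)
  exact (h1.inter ((h.isOpen_cone htr).preimage (continuous_id.pow 2))).measurableSet

lemma IsNormalized.image_sq_sqrtCone (htr : TotallyReal K) {a : K} {v : (K →+* ℝ) → 𝓞 K}
    (h : IsNormalized a v) : (fun z => z ^ 2) '' sqrtCone v = cone v := by
  refine Set.Subset.antisymm (fun _ ⟨z, hz, hzy⟩ => hzy ▸ hz.2) fun y hy => ?_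
  have hpos := h.pos_of_mem_cone htr hy
  have hsq : (fun φ => √(y φ)) ^ 2 = y := funext fun φ => Real.sq_sqrt (hpos φ).le
  exact ⟨fun φ => √(y φ), ⟨fun φ => Real.sqrt_pos.2 (hpos φ), hsq.symm ▸ hy⟩, hsq⟩

lemma smul_mem_sqrtCone {v : (K →+* ℝ) → 𝓞 K} {z : (K →+* ℝ) → ℝ} (hz : z ∈ sqrtCone v) {r : ℝ}
    (hr : 0 < r) (hr1 : r < 1) : r • z ∈ sqrtCone v := by
  obtain ⟨hpos, c, ⟨hc, hc1⟩, hy⟩ := hz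
  refine ⟨fun φ => mul_pos hr (hpos φ), fun i => r ^ 2 * c i,
    ⟨fun i => mul_pos (pow_pos hr 2) (hc i), ?_⟩, fun φ => ?_⟩
  · rw [← Finset.mul_sum]
    have := Finset.sum_nonneg fun i (_ : i ∈ Finset.univ) => (hc i).le
    have : r ^ 2 ≤ 1 := pow_le_one₀ hr.le hr1.le
    nlinarith
  · have := hy φ
    simp only [Pi.pow_apply, Pi.smul_apply, smul_eq_mul, mul_pow] at this ⊢
    rw [this]
    simp_rw [mul_assoc, ← Finset.mul_sum]
    ring

lemma IsNormalized.prod_le (htr : TotallyReal K) {a : K} {v : (K →+* ℝ) → 𝓞 K}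
    (h : IsNormalized a v) {z : (K →+* ℝ) → ℝ} (hz : z ∈ sqrtCone v) :
    ∏ φ, z φ ^ 2 ≤ 4 ^ Fintype.card (K →+* ℝ) * discr K /
      ballVol (Fintype.card (K →+* ℝ)) ^ 2 := by
  have : Nonempty (K →+* ℝ) := nonempty_embeddings htr
  have hb := ballVol_pos (Fintype.card (K →+* ℝ))
  have hM := pow_mul_ballVol_sq_le htr h.totPos one_pos h.one_le
  have hn := Fintype.card_pos (α := K →+* ℝ)
  have hd := discr_pos htr
  set n := Fintype.card (K →+* ℝ)
  have hn' : (0 : ℝ) < n := by exact_mod_cast hn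
  obtain ⟨hpos, c, ⟨hc, hc1⟩, hy⟩ := hz
  have hsum : ∑ φ : K →+* ℝ, φ a * z φ ^ 2 ≤ n := by
    have h1 : ∀ φ : K →+* ℝ, φ a * z φ ^ 2 = n * (φ a * ∑ i, c i * φ (v i) ^ 2) := fun φ => by
      have := hy φ
      rw [Pi.pow_apply] at this
      rw [this]
      ring
    simp_rw [h1]
    rw [← Finset.mul_sum, sum_mul_sum_sq_comm]
    simp only [h.eq_one, mul_one]
    nlinarith
  have hnn : ∀ φ : K →+* ℝ, 0 ≤ φ a * z φ ^ 2 := fun φ =>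
    mul_nonneg (h.totPos φ).le (sq_nonneg _)
  have hamgm := Real.geom_mean_le_arith_mean Finset.univ (fun _ : K →+* ℝ => (1 : ℝ))
    (fun φ => φ a * z φ ^ 2) (by simp) (by simpa using hn) fun φ _ => hnn φ
  simp only [Real.rpow_one, Finset.sum_const, Finset.card_univ, nsmul_eq_mul, mul_one,
    one_mul] at hamgm
  have hP : ∏ φ : K →+* ℝ, φ a * z φ ^ 2 ≤ 1 := by
    have h1 : (∏ φ : K →+* ℝ, φ a * z φ ^ 2) ^ (n : ℝ)⁻¹ ≤ 1 :=
      hamgm.trans ((div_le_one hn').2 hsum)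
    by_contra! hlt
    exact absurd h1 (not_le.2 (Real.one_lt_rpow hlt (inv_pos.2 hn')))
  rw [Finset.prod_mul_distrib] at hP
  rw [le_div_iff₀ (by positivity)]
  have hz0 : 0 ≤ ∏ φ, z φ ^ 2 := Finset.prod_nonneg fun φ _ => sq_nonneg _
  rw [one_pow, one_mul] at hM
  calc _ ≤ (∏ φ, z φ ^ 2) * (4 ^ n * discr K * ∏ φ : K →+* ℝ, φ a) := by gcongr
    _ = 4 ^ n * discr K * ((∏ φ : K →+* ℝ, φ a) * ∏ φ, z φ ^ 2) := by ring
    _ ≤ 4 ^ n * discr K * 1 := by gcongr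
    _ = _ := mul_one _

end Cone

section Counting

variable {K : Type*} [Field K] [NumberField K]

lemma countable_ringOfIntegers (htr : TotallyReal K) : Countable (𝓞 K) :=
  (intBasis htr).equivFun.injective.countable

lemma coe_sq_intUnit (e : ℤˣ) : ((e : ℤ) : ℝ) ^ 2 = 1 := by
  rcases Int.units_eq_one_or e with rfl | rfl <;> simp

lemma map_mul_inv_mul {F : Type*} [Field F] (φ : F →+* ℝ) (u u' : (𝓞 F)ˣ) :
    φ ((u * u'⁻¹ : (𝓞 F)ˣ) : 𝓞 F) * φ (u' : 𝓞 F) = φ (u : 𝓞 F) := by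
  rw [← map_mul]
  congr 1
  exact (map_mul (algebraMap (𝓞 F) F) _ _).symm.trans (by simp [← Units.val_mul])

/-- A positive point of the square root cone is moved by a unit into a small ball. -/
lemma IsNormalized.exists_unit_sum_lt (htr : TotallyReal K) (hur : IsAReducible K 1) {a : K}
    {v : (K →+* ℝ) → 𝓞 K} (h : IsNormalized a v) (φ₀ : K →+* ℝ) {R : ℝ} (hR : 0 < R)
    (hXR : 4 ^ Fintype.card (K →+* ℝ) * discr K / ballVol (Fintype.card (K →+* ℝ)) ^ 2 <
      R ^ Fintype.card (K →+* ℝ)) {z : (K →+* ℝ) → ℝ} (hz : z ∈ sqrtCone v) :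
    ∃ u : (𝓞 K)ˣ, 0 < φ₀ (u : 𝓞 K) ∧ ∑ φ : K →+* ℝ, φ (u : 𝓞 K) ^ 2 * z φ ^ 2 < R ^ 2 := by
  have hb := ballVol_pos (Fintype.card (K →+* ℝ))
  have hd := discr_pos htr
  have : Nonempty (K →+* ℝ) := ⟨φ₀⟩
  have hn : Fintype.card (K →+* ℝ) ≠ 0 := Fintype.card_ne_zero
  have hprod := h.prod_le htr hz
  have hunit := fun {τ : ℝ} => exists_unit_of_pos htr hur (fun φ => pow_pos (hz.1 φ) 2) (τ := τ)
  set n := Fintype.card (K →+* ℝ)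
  set X : ℝ := 4 ^ n * discr K / ballVol n ^ 2 with hX
  have hX0 : 0 < X := by positivity
  have hτ1 : (1 : ℝ) < (R ^ n / X) ^ (n : ℝ)⁻¹ :=
    Real.one_lt_rpow ((one_lt_div hX0).2 hXR) (by positivity)
  obtain ⟨u, hu⟩ := hunit hτ1
  rw [Real.rpow_inv_natCast_pow (by positivity) hn, ← le_div_iff₀ (by positivity)] at hu
  have hlt : (∑ φ : K →+* ℝ, φ (u : 𝓞 K) ^ 2 * z φ ^ 2) ^ n < (R ^ 2) ^ n := by
    simp_rw [mul_comm (_ ^ 2) (z _ ^ 2)]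
    calc _ ≤ _ := hu
      _ = R ^ n * ∏ φ, z φ ^ 2 := by
        rw [hX]
        field_simp
      _ ≤ R ^ n * X := by gcongr
      _ < R ^ n * R ^ n := by gcongr
      _ = _ := by ring
  have hlt' := lt_of_pow_lt_pow_left₀ n (by positivity) hlt
  rcases lt_or_ge 0 (φ₀ (u : 𝓞 K)) with hpos | hneg
  · exact ⟨u, hpos, hlt'⟩
  · refine ⟨-u, ?_, by simpa using hlt'⟩
    have : φ₀ (u : 𝓞 K) ≠ 0 := by simp
    simpa using lt_of_le_of_ne hneg this

lemma eq_of_signed_mul_eq (htr : TotallyReal K) {a b : K} {v v' : (K →+* ℝ) → 𝓞 K}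
    (h : IsNormalized a v) (h' : IsNormalized b v') {s s' : (K →+* ℝ) → ℤˣ} {u u' : (𝓞 K)ˣ}
    {z z' : (K →+* ℝ) → ℝ} (hz : z ∈ sqrtCone v) (hz' : z' ∈ sqrtCone v')
    (heq : ∀ φ : K →+* ℝ, ((s φ : ℤ) : ℝ) * φ (u : 𝓞 K) * z φ = ((s' φ : ℤ) : ℝ) *
      φ (u' : 𝓞 K) * z' φ) : a = b * (((u * u'⁻¹ : (𝓞 K)ˣ) : 𝓞 K) : K) ^ 2 := by
  have : Nonempty (K →+* ℝ) := nonempty_embeddings htr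
  obtain ⟨-, c, ⟨hc, -⟩, hy⟩ := hz
  obtain ⟨-, c', ⟨hc', -⟩, hy'⟩ := hz'
  refine h.eq_mul_sq htr h' hc hc' _ fun φ => ?_
  have h1 := congrArg (· ^ 2) (heq φ)
  have h2 := hy φ
  have h3 := hy' φ
  simp only [mul_pow, coe_sq_intUnit, one_mul, Pi.pow_apply] at h1 h2 h3
  have hn : (Fintype.card (K →+* ℝ) : ℝ) ≠ 0 := by simp
  have hu' : φ (u' : 𝓞 K) ≠ 0 := by simp
  rw [h2, h3, ← map_mul_inv_mul φ u u'] at h1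
  have h4 : φ (u' : 𝓞 K) ^ 2 * Fintype.card (K →+* ℝ) ≠ 0 := by positivity
  refine mul_left_cancel₀ h4 ?_
  linear_combination h1

/-- The packing bound for the number of pairwise inequivalent normalized forms. -/
lemma card_mul_le (htr : TotallyReal K) (hur : IsAReducible K 1) {Q : Type*} [Fintype Q]
    {a : Q → K} {v : Q → (K →+* ℝ) → 𝓞 K} (h : ∀ q, IsNormalized (a q) (v q))
    (hinj : ∀ q q' (g : (𝓞 K)ˣ), a q = a q' * ((g : 𝓞 K) : K) ^ 2 → q = q') {X Y : ℝ}
    (hX : X = 4 ^ Fintype.card (K →+* ℝ) * discr K / ballVol (Fintype.card (K →+* ℝ)) ^ 2)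
    (hXY : X < Y) :
    Fintype.card Q * (√(discr K) * Fintype.card (K →+* ℝ) ^ Fintype.card (K →+* ℝ) /
      (Fintype.card (K →+* ℝ)).factorial) ≤
        3 / 4 * √X * ballVol (Fintype.card (K →+* ℝ)) * Y := by
  classical
  have : Nonempty (K →+* ℝ) := nonempty_embeddings htr
  obtain ⟨φ₀⟩ := nonempty_embeddings htr
  have : Countable (𝓞 K) := countable_ringOfIntegers htr
  have : Countable (𝓞 K)ˣ := (Units.val_injective (α := 𝓞 K)).countable
  have hb := ballVol_pos (Fintype.card (K →+* ℝ))
  have hd := discr_pos htr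
  have hn : Fintype.card (K →+* ℝ) ≠ 0 := Fintype.card_ne_zero
  have hcone := fun q => (h q).volume_cone_ge htr
  have hcov := fun q {R : ℝ} => (h q).exists_unit_sum_lt htr hur φ₀ (R := R)
  have hprod := fun q {z} => (h q).prod_le htr (z := z)
  rw [← hX] at hcov hprod
  set n := Fintype.card (K →+* ℝ) with hnn
  have hX0 : 0 < X := by rw [hX]; positivity
  have hY0 : 0 < Y := hX0.trans hXY
  obtain ⟨R, hR, hRn⟩ : ∃ R : ℝ, 0 < R ∧ R ^ n = Y :=
    ⟨Y ^ (n : ℝ)⁻¹, by positivity, Real.rpow_inv_natCast_pow hY0.le hn⟩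
  set B : Set ((K →+* ℝ) → ℝ) := {z | ∑ φ, (R⁻¹ * z φ) ^ 2 < 1}
  have hBvol : volume B = ENNReal.ofReal (Y * ballVol n) := by
    have := volume_ellipsoid (w := fun _ : K →+* ℝ => R⁻¹) fun _ => inv_pos.2 hR
    rwa [Finset.prod_const, Finset.card_univ, ← hnn, inv_pow, inv_inv, hRn] at this
  have hBm : MeasurableSet B := (isOpen_lt (by fun_prop) continuous_const).measurableSet
  have hpack := packing (U := {u : (𝓞 K)ˣ // 0 < φ₀ (u : 𝓞 K)}) (S := (K →+* ℝ) → ℤˣ)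
    (fun q => (h q).measurableSet_sqrtCone htr) hBm
    (fun s u φ => ((s φ : ℤ) : ℝ) * φ ((u : (𝓞 K)ˣ) : 𝓞 K)) (fun s u => by
      rw [Finset.prod_mul_distrib, ← norm_eq_prod htr, abs_mul, Finset.abs_prod]
      have h1 : ∀ φ, |((s φ : ℤ) : ℝ)| = 1 := fun φ => by
        rcases Int.units_eq_one_or (s φ) with h | h <;> simp [h]
      simp only [h1, Finset.prod_const_one, one_mul]
      exact_mod_cast NumberField.Units.norm K u.1)
    (by
      intro q q' s s' u u' z hz z' hz' heq
      have heq' := congr_fun heq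
      simp only [Pi.mul_apply] at heq'
      have hab := eq_of_signed_mul_eq htr (h q) (h q') hz hz' heq'
      obtain rfl := hinj _ _ _ hab
      have ha0 : a q ≠ 0 := fun h0 => by simpa [h0] using (h q).totPos φ₀
      have hg : (((u.1 * u'.1⁻¹ : (𝓞 K)ˣ) : 𝓞 K) : K) ^ 2 = 1 :=
        (mul_eq_left₀ ha0).1 hab.symm
      have hu : u = u' := by
        have hw := map_mul_inv_mul φ₀ u.1 u'.1
        rw [sq, mul_self_eq_one_iff] at hg
        rcases hg with h1 | h1
        · refine Subtype.ext (mul_inv_eq_one.1 (Units.ext (RingOfIntegers.ext ?_)))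
          simpa using h1
        · rw [h1, map_neg, map_one] at hw
          linarith [u.2, u'.2]
      refine ⟨rfl, funext fun φ => ?_, hu⟩
      subst hu
      have hu0 : φ ((u : (𝓞 K)ˣ) : 𝓞 K) ≠ 0 := by simp
      have h1 : ((s φ : ℤ) : ℝ) * z φ = ((s' φ : ℤ) : ℝ) * z' φ :=
        mul_left_cancel₀ hu0 (by linear_combination heq' φ)
      have := hz.1 φ
      have := hz'.1 φ
      rcases Int.units_eq_one_or (s φ) with e | e <;>
        rcases Int.units_eq_one_or (s' φ) with e' | e' <;> rw [e, e'] <;>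
          simp [e, e'] at h1 <;> linarith)
    (by
      intro s q z hz
      obtain ⟨u, hu, hlt⟩ := hcov q hR (hRn ▸ hXY) hz
      refine ⟨⟨u, hu⟩, ?_⟩
      change ∑ φ : K →+* ℝ, (R⁻¹ * (((s φ : ℤ) : ℝ) * φ (u : 𝓞 K) * z φ)) ^ 2 < 1
      simp only [mul_pow, coe_sq_intUnit, one_mul]
      rw [← Finset.mul_sum, inv_pow, inv_mul_lt_iff₀ (by positivity), mul_one]
      exact hlt)
  rw [hBvol, Fintype.card_fun, Fintype.card_units_int, ← hnn] at hpack
  have hfin : ∀ q, volume (sqrtCone (v q)) ≠ ⊤ := by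
    intro q htop
    have h1 : ∑ q, volume (sqrtCone (v q)) = ⊤ := ENNReal.sum_eq_top.2 ⟨q, Finset.mem_univ q, htop⟩
    rw [h1, ENNReal.mul_top (by simp), top_le_iff] at hpack
    exact ENNReal.ofReal_ne_top hpack
  have hone : ∀ q, ENNReal.ofReal (√(discr K) * n ^ n / n.factorial) ≤
      ENNReal.ofReal (3 / 4 * 2 ^ n * √X) * volume (sqrtCone (v q)) := by
    intro q
    refine (hcone q).trans ?_
    rw [← (h q).image_sq_sqrtCone htr]
    refine volume_image_sq_le ((h q).measurableSet_sqrtCone htr) (fun z hz => hz.1)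
      (fun z hz r => smul_mem_sqrtCone hz) (Real.sqrt_nonneg _) (fun z hz => ?_) (hfin q)
    refine Real.le_sqrt_of_sq_le ?_
    rw [← Finset.prod_pow]
    exact hprod q hz
  have hall := Finset.sum_le_sum fun q (_ : q ∈ Finset.univ) => hone q
  rw [← Finset.mul_sum, Finset.sum_const, Finset.card_univ, nsmul_eq_mul] at hall
  have hfinal : ENNReal.ofReal (2 ^ n * (Fintype.card Q * (√(discr K) * n ^ n / n.factorial))) ≤
      ENNReal.ofReal (3 / 4 * 2 ^ n * √X * (Y * ballVol n)) := by
    rw [ENNReal.ofReal_mul (by positivity), ENNReal.ofReal_mul (by positivity),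
      ENNReal.ofReal_mul (p := 3 / 4 * 2 ^ n * √X) (by positivity), ENNReal.ofReal_natCast]
    calc _ ≤ ENNReal.ofReal (2 ^ n) * (ENNReal.ofReal (3 / 4 * 2 ^ n * √X) *
          ∑ q, volume (sqrtCone (v q))) := by gcongr
      _ = ENNReal.ofReal (3 / 4 * 2 ^ n * √X) * ((2 ^ n : ℕ) *
          ∑ q, volume (sqrtCone (v q))) := by
        rw [ENNReal.ofReal_pow (by norm_num)]
        simp
        ring
      _ ≤ _ := by gcongr
  rw [ENNReal.ofReal_le_ofReal_iff (by positivity)] at hfinal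
  have h2 : (0 : ℝ) < 2 ^ n := by positivity
  refine le_of_mul_le_mul_left (hfinal.trans_eq ?_) h2
  ring

/-- The limit `Y → X` of `card_mul_le`. -/
lemma card_mul_le_of_normalized (htr : TotallyReal K) (hur : IsAReducible K 1) {Q : Type*}
    [Fintype Q] {a : Q → K} {v : Q → (K →+* ℝ) → 𝓞 K} (h : ∀ q, IsNormalized (a q) (v q))
    (hinj : ∀ q q' (g : (𝓞 K)ˣ), a q = a q' * ((g : 𝓞 K) : K) ^ 2 → q = q') :
    Fintype.card Q * (Fintype.card (K →+* ℝ) : ℝ) ^ Fintype.card (K →+* ℝ) *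
        ballVol (Fintype.card (K →+* ℝ)) ^ 2 ≤
      3 / 4 * (Fintype.card (K →+* ℝ)).factorial * 8 ^ Fintype.card (K →+* ℝ) * discr K := by
  have hb := ballVol_pos (Fintype.card (K →+* ℝ))
  have hd := discr_pos htr
  have hlim := fun {X Y : ℝ} => card_mul_le htr hur h hinj (X := X) (Y := Y)
  set n := Fintype.card (K →+* ℝ)
  set X : ℝ := 4 ^ n * discr K / ballVol n ^ 2 with hX
  have hX0 : 0 < X := by positivity
  have hk : 0 < 3 / 4 * √X * ballVol n := by positivity
  have hle : Fintype.card Q * (√(discr K) * n ^ n / n.factorial) ≤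
      3 / 4 * √X * ballVol n * X := by
    rw [← div_le_iff₀' hk]
    refine le_of_forall_gt_imp_ge_of_dense fun Y hY => ?_
    rw [div_le_iff₀' hk]
    exact hlim hX hY
  have hsX : √X = 2 ^ n * √(discr K) / ballVol n := by
    rw [hX, show (4 : ℝ) ^ n = (2 ^ n) ^ 2 by rw [← pow_mul, mul_comm, pow_mul]; norm_num,
      Real.sqrt_div (by positivity), Real.sqrt_mul (by positivity),
      Real.sqrt_sq (by positivity), Real.sqrt_sq hb.le]
  have hs : 0 < √(discr K : ℝ) := Real.sqrt_pos.2 hd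
  have hf : (0 : ℝ) < n.factorial := by exact_mod_cast n.factorial_pos
  have h8 : (8 : ℝ) ^ n = 2 ^ n * 4 ^ n := by rw [← mul_pow]; norm_num
  rw [hsX, hX] at hle
  have hm : 0 < √(discr K : ℝ) / (n.factorial * ballVol n ^ 2) := by positivity
  refine le_of_mul_le_mul_right ?_ hm
  calc _ = Fintype.card Q * (√(discr K) * n ^ n / n.factorial) := by field_simp
    _ ≤ _ := hle
    _ = _ := by rw [h8]; field_simp

end Counting

lemma three_mul_pow_le (n : ℕ) (hn : 2 ≤ n) : 3 * (n : ℝ) ^ n ≤ ((n : ℝ) + 2) ^ n := by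
  have hn0 : (0 : ℝ) < n := by exact_mod_cast (by omega : 0 < n)
  have h := one_add_mul_le_pow (a := 2 / (n : ℝ)) (by
    have : 0 < 2 / (n : ℝ) := by positivity
    linarith) n
  rw [mul_div_cancel₀ _ hn0.ne'] at h
  calc 3 * (n : ℝ) ^ n ≤ (1 + 2 / (n : ℝ)) ^ n * (n : ℝ) ^ n := by gcongr; linarith
    _ = _ := by rw [← mul_pow]; congr 1; field_simp

lemma factorial_mul_pow_le (n : ℕ) (hn : 2 ≤ n) :
    3 / 4 * n.factorial * (2 * π) ^ n ≤
      (1 + (n : ℝ) / 2) ^ 4 * Real.Gamma (1 + (n : ℝ) / 2) ^ 2 * n ^ n := by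
  have hπ : π ^ 2 ≤ 10 := by nlinarith [Real.pi_lt_d2, Real.pi_pos]
  induction n using Nat.twoStepInduction with
  | zero => omega
  | one => omega
  | more n ih _ =>
    rcases Nat.lt_or_ge n 2 with hlt | hge
    · interval_cases n
      · norm_num [Nat.factorial, Real.Gamma_two]
        nlinarith
      · have h1 : Real.Gamma (1 + ((1 + 2 : ℕ) : ℝ) / 2) = 3 / 4 * √π := by
          rw [show (1 + ((1 + 2 : ℕ) : ℝ) / 2) = 1 / 2 + 1 + 1 by norm_num,
            Real.Gamma_add_one (by norm_num), Real.Gamma_add_one (by norm_num),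
            Real.Gamma_one_half_eq]
          ring
        rw [h1, mul_pow (3 / 4), Real.sq_sqrt Real.pi_pos.le]
        norm_num [Nat.factorial]
        nlinarith [Real.pi_pos]
    · have h := ih hge
      have h3 := three_mul_pow_le n hge
      have hn2 : (2 : ℝ) ≤ n := by exact_mod_cast hge
      have hG : Real.Gamma (1 + ((n + 2 : ℕ) : ℝ) / 2) =
          (1 + n / 2) * Real.Gamma (1 + n / 2) := by
        rw [← Real.Gamma_add_one (by positivity)]
        congr 1
        push_cast
        ring
      rw [hG, Nat.factorial_succ, Nat.factorial_succ]
      push_cast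
      set G := Real.Gamma (1 + (n : ℝ) / 2)
      set x : ℝ := (n : ℝ)
      have hnum : (x + 1) * (x + 2) * (4 * π ^ 2) * (1 + x / 2) ^ 2 ≤
          3 * (1 + (x + 2) / 2) ^ 4 * (x + 2) ^ 2 := by
        have e1 : (x + 1) * (x + 2) * (4 * π ^ 2) * (1 + x / 2) ^ 2 ≤
            (x + 1) * (x + 2) * (4 * 10) * (1 + x / 2) ^ 2 := by gcongr
        have e2 : 9 * (x + 2) ≤ (x + 4) ^ 2 := by nlinarith
        have e3 : (9 * (x + 2)) ^ 2 ≤ ((x + 4) ^ 2) ^ 2 := by gcongr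
        have e4 : 160 * (x + 1) * (x + 2) ≤ 3 * (x + 4) ^ 4 := by nlinarith
        calc _ ≤ _ := e1
          _ = (160 * (x + 1) * (x + 2)) * ((x + 2) ^ 2 / 16) := by ring
          _ ≤ (3 * (x + 4) ^ 4) * ((x + 2) ^ 2 / 16) := by gcongr
          _ = _ := by ring
      calc 3 / 4 * ((x + 1 + 1) * ((x + 1) * (n.factorial : ℝ))) * (2 * π) ^ (n + 2)
          = (3 / 4 * n.factorial * (2 * π) ^ n) * ((x + 1) * (x + 2) * (4 * π ^ 2)) := by ring
        _ ≤ ((1 + x / 2) ^ 4 * G ^ 2 * x ^ n) * ((x + 1) * (x + 2) * (4 * π ^ 2)) := by gcongr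
        _ = ((1 + x / 2) ^ 2 * G ^ 2 * x ^ n) *
            ((x + 1) * (x + 2) * (4 * π ^ 2) * (1 + x / 2) ^ 2) := by ring
        _ ≤ ((1 + x / 2) ^ 2 * G ^ 2 * x ^ n) *
            (3 * (1 + (x + 2) / 2) ^ 4 * (x + 2) ^ 2) := by gcongr
        _ = ((1 + x / 2) ^ 2 * G ^ 2) * (1 + (x + 2) / 2) ^ 4 * (x + 2) ^ 2 * (3 * x ^ n) := by
          ring
        _ ≤ ((1 + x / 2) ^ 2 * G ^ 2) * (1 + (x + 2) / 2) ^ 4 * (x + 2) ^ 2 * (x + 2) ^ n := by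
          gcongr
        _ = _ := by ring

end UnaryForm

/-- If `K` is a totally real number field of degree `n ≥ 2` which is
unit reducible, then the number of homothety classes of perfect unary forms satisfies
`n_K ≤ |Δ_K| · (2/π)^{2n} · Γ(2 + n/2)^4`. -/
theorem perfect_form_classes_bound_of_unitReducible
    (K : Type*) [Field K] [NumberField K] (n : ℕ)
    (hdeg : Module.finrank ℚ K = n) (hn : 2 ≤ n)
    (htr : TotallyReal K) (hur : IsAReducible K 1) :
    (numClasses K : ℝ) ≤
      |(NumberField.discr K : ℝ)| * (2 / π) ^ (2 * n) *
        Real.Gamma (2 + (n : ℝ) / 2) ^ 4 := by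
  have hcard : Fintype.card (K →+* ℝ) = n := (UnaryForm.card_embeddings htr).trans hdeg
  have hd := UnaryForm.discr_pos htr
  rw [abs_of_pos hd]
  have hΓ : 0 < Real.Gamma (2 + (n : ℝ) / 2) := Real.Gamma_pos_of_pos (by positivity)
  by_cases hfin : Finite (Quot fun a b : {a : K // IsPerfectForm a} => Homothetic (a : K) (b : K))
  swap
  · have := not_finite_iff_infinite.1 hfin
    rw [numClasses, Nat.card_eq_zero_of_infinite, Nat.cast_zero]
    positivity
  have := Fintype.ofFinite
    (Quot fun a b : {a : K // IsPerfectForm a} => Homothetic (a : K) (b : K))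
  choose r hr v hv using fun q : Quot fun a b : {a : K // IsPerfectForm a} =>
    Homothetic (a : K) (b : K) => UnaryForm.exists_normalized htr q.out.2
  have hinj : ∀ q q' (g : (𝓞 K)ˣ), (r q : K) * q.out.1 =
      (r q' : K) * q'.out.1 * ((g : 𝓞 K) : K) ^ 2 → q = q' := by
    intro q q' g hg
    have hom : Homothetic q'.out.1 q.out.1 := by
      refine ⟨(r q)⁻¹ * r q', mul_pos (inv_pos.2 (hr q)) (hr q'), g, ?_⟩
      have h0 : (r q : K) ≠ 0 := by exact_mod_cast (hr q).ne'
      push_cast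
      rw [mul_assoc, mul_assoc, ← mul_assoc (r q' : K), ← hg, inv_mul_cancel_left₀ h0]
    have := Quot.sound (r := fun a b : {a : K // IsPerfectForm a} =>
      Homothetic (a : K) (b : K)) hom
    rw [Quot.out_eq, Quot.out_eq] at this
    exact this.symm
  have hN := UnaryForm.card_mul_le_of_normalized htr hur hv hinj
  rw [← Nat.card_eq_fintype_card, hcard] at hN
  have hn0 : n ≠ 0 := by omega
  have hP := UnaryForm.factorial_mul_pow_le n hn
  have hG : Real.Gamma (2 + (n : ℝ) / 2) = (1 + n / 2) * Real.Gamma (1 + n / 2) := by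
    rw [← Real.Gamma_add_one (by positivity)]
    congr 1
    ring
  have hG0 : 0 < Real.Gamma (1 + (n : ℝ) / 2) := Real.Gamma_pos_of_pos (by positivity)
  have hnn : (0 : ℝ) < (n : ℝ) ^ n := by positivity
  rw [UnaryForm.ballVol, add_comm ((n : ℝ) / 2)] at hN
  rw [hG]
  unfold numClasses
  set N : ℝ := (Nat.card (Quot fun a b : {a : K // IsPerfectForm a} =>
    Homothetic (a : K) (b : K)) : ℝ)
  set G := Real.Gamma (1 + (n : ℝ) / 2)
  refine le_of_mul_le_mul_right ?_ hnn
  have hsq : (√π ^ n) ^ 2 = π ^ n := by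
    rw [← pow_mul, mul_comm, pow_mul, Real.sq_sqrt Real.pi_pos.le]
  calc N * n ^ n ≤ 3 / 4 * n.factorial * 8 ^ n * discr K / (√π ^ n / G) ^ 2 := by
        rw [le_div_iff₀ (by positivity)]
        linear_combination hN
    _ = (3 / 4 * n.factorial * (2 * π) ^ n) * (discr K * (2 / π) ^ (2 * n) * G ^ 2) := by
        rw [div_pow, hsq, show (8 : ℝ) ^ n = 2 ^ n * 2 ^ (2 * n) by
          rw [← pow_add, show n + 2 * n = 3 * n by ring, pow_mul]; norm_num]
        rw [mul_pow, div_pow, mul_comm 2 n, pow_mul π]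
        field_simp
    _ ≤ ((1 + n / 2) ^ 4 * G ^ 2 * n ^ n) * (discr K * (2 / π) ^ (2 * n) * G ^ 2) := by gcongr
    _ = _ := by ring
end

section
/- Let K be a totally real number field of degree n with 2 ≤ n ≤ 11 over ℚ, with discriminant Δ_K and regulator R_K, and suppose K is A-reducible for some A ≥ 1. Then the number n_K of homothety classes of perfect unary forms over K satisfies n_K ≤ exp(n·√(η² + θ)) · |Δ_K| · (2/π)^{2n} · Γ(2 + n/2)^4, where η = (√(n-1)/2) · R_K^{1/n} and θ = 4·(log A)²/(n-1). -/
open NumberField Real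

namespace PerfectUnary

noncomputable section

open scoped Classical
open NumberField.InfinitePlace NumberField.mixedEmbedding MeasureTheory Module

variable {K : Type*} [Field K]

section TotallyReal

variable [IsTotallyReal K]

/-- The real coordinate of a point of the mixed space at an infinite place of a totally real
field. -/
def coord (w : InfinitePlace K) : mixedSpace K →ₗ[ℝ] ℝ :=
  LinearMap.proj ⟨w, IsTotallyReal.isReal w⟩ ∘ₗ LinearMap.fst ℝ _ _

theorem coord_apply (w : InfinitePlace K) (y : mixedSpace K) :
    coord w y = y.1 ⟨w, IsTotallyReal.isReal w⟩ := rfl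

theorem coord_mul (w : InfinitePlace K) (y z : mixedSpace K) :
    coord w (y * z) = coord w y * coord w z := rfl

theorem coord_mixedEmbedding (w : InfinitePlace K) (x : K) :
    coord w (mixedEmbedding K x) = embedding_of_isReal (IsTotallyReal.isReal w) x := rfl

theorem coord_mixedEmbedding_ne_zero (w : InfinitePlace K) {x : K} (hx : x ≠ 0) :
    coord w (mixedEmbedding K x) ≠ 0 := by
  rw [coord_mixedEmbedding]
  exact (map_ne_zero _).mpr hx

theorem normAtPlace_eq_abs_coord (w : InfinitePlace K) (y : mixedSpace K) :
    normAtPlace w y = |coord w y| :=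
  normAtPlace_apply_of_isReal (IsTotallyReal.isReal w) y

variable [NumberField K]

theorem norm_eq_prod_abs_coord (y : mixedSpace K) :
    mixedEmbedding.norm y = ∏ w, |coord w y| := by
  simp [mixedEmbedding.norm_apply, normAtPlace_eq_abs_coord, IsTotallyReal.mult_eq]

theorem card_infinitePlace : Fintype.card (InfinitePlace K) = finrank ℚ K := by
  rw [card_eq_nrRealPlaces_add_nrComplexPlaces, IsTotallyReal.nrComplexPlaces_eq_zero, add_zero,
    IsTotallyReal.finrank]

theorem trace_eq_sum_coord (x : K) :
    (Algebra.trace ℚ K x : ℝ) = ∑ w, coord w (mixedEmbedding K x) := by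
  have hbij : Function.Bijective
      (fun w : InfinitePlace K ↦ RingHom.equivRatAlgHom K ℂ w.embedding) := by
    refine (RingHom.equivRatAlgHom K ℂ).bijective.comp ⟨fun w w' h ↦ ?_, fun φ ↦ ⟨mk φ, ?_⟩⟩
    · rw [← mk_embedding w, ← mk_embedding w', h]
    · exact embedding_mk_eq_of_isReal (IsTotallyReal.complexEmbedding_isReal φ)
  have h := trace_eq_sum_embeddings ℂ (K := ℚ) (x := x)
  rw [← hbij.sum_comp] at h
  apply Complex.ofReal_injective
  push_cast
  simpa [coord_mixedEmbedding] using h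

/-- The trace pairing between `K` and its mixed space. -/
def pairing (c : K) : mixedSpace K →ₗ[ℝ] ℝ :=
  ∑ w, coord w (mixedEmbedding K c) • coord w

theorem pairing_apply (c : K) (y : mixedSpace K) :
    pairing c y = ∑ w, coord w (mixedEmbedding K c) * coord w y := by
  simp [pairing]

theorem pairing_mixedEmbedding (c x : K) :
    pairing c (mixedEmbedding K x) = (Algebra.trace ℚ K (c * x) : ℝ) := by
  rw [trace_eq_sum_coord, pairing_apply]
  simp [coord_mul]

theorem pairing_mul (c x : K) (y : mixedSpace K) :
    pairing (c * x) y = pairing c (mixedEmbedding K x * y) := by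
  simp [pairing_apply, coord_mul, mul_assoc]

theorem pairing_sq (c : K) (x : 𝓞 K) :
    pairing c (mixedEmbedding K (x ^ 2 : K)) = (trForm c x : ℝ) :=
  pairing_mixedEmbedding _ _

omit [NumberField K] in
theorem coord_pos {c : K} (hc : TotPos c) (w : InfinitePlace K) :
    0 < coord w (mixedEmbedding K c) :=
  hc (embedding_of_isReal (IsTotallyReal.isReal w))

end TotallyReal

variable [NumberField K]

/-- A totally positive element whose trace form is at least `1` on nonzero integers. -/
structure Admissible (c : K) : Prop where
  totPos : TotPos c
  one_le : ∀ x : 𝓞 K, x ≠ 0 → 1 ≤ (trForm c x : ℝ)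

theorem Admissible.mul_unit_sq {c : K} (hc : Admissible c) (u : (𝓞 K)ˣ) :
    Admissible (c * (u : K) ^ 2) where
  totPos φ := by
    rw [map_mul, map_pow]
    have : φ (u : K) ≠ 0 := (map_ne_zero _).mpr (Units.coe_ne_zero u)
    have := hc.totPos φ
    positivity
  one_le x hx := by
    have := hc.one_le (u * x) (mul_ne_zero u.ne_zero hx)
    convert this using 2
    simp only [trForm, map_mul]
    congr 1
    ring

/-- The half-open parallelepiped spanned by a basis. -/
def openBox {ι : Type*} (b : Basis ι ℝ (mixedSpace K)) : Set (mixedSpace K) :=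
  {y | ∀ i, b.repr y i ∈ Set.Ioc (0 : ℝ) 1}

theorem openBox_eq {ι : Type*} [Fintype ι] (b : Basis ι ℝ (mixedSpace K)) :
    openBox b = (fun y ↦ (∑ i, b i) - y) ⁻¹' ZSpan.fundamentalDomain b := by
  ext y
  simp only [openBox, Set.mem_ofPred_eq, Set.mem_preimage, ZSpan.mem_fundamentalDomain]
  refine forall_congr' fun i ↦ ?_
  have : b.repr ((∑ i, b i) - y) i = 1 - b.repr y i := by
    classical
    simp [Finsupp.single_apply]
  rw [this, Set.mem_Ioc, Set.mem_Ico]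
  constructor <;> rintro ⟨h1, h2⟩ <;> constructor <;> linarith

theorem volume_openBox {ι : Type*} [Fintype ι] (b : Basis ι ℝ (mixedSpace K)) :
    volume (openBox b) = volume (ZSpan.fundamentalDomain b) := by
  have h : openBox b =
      (fun y ↦ (-1 : ℝ) • y) ⁻¹' ((fun y ↦ (∑ i, b i) + y) ⁻¹' ZSpan.fundamentalDomain b) := by
    simp [openBox_eq, Set.preimage_preimage, sub_eq_add_neg]
  rw [h, Measure.addHaar_preimage_smul _ (by norm_num), measure_preimage_add]
  simp [abs_inv, abs_pow]

theorem measurableSet_openBox {ι : Type*} [Fintype ι] (b : Basis ι ℝ (mixedSpace K)) :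
    MeasurableSet (openBox b) := by
  rw [openBox_eq]
  exact (ZSpan.fundamentalDomain_measurableSet b).preimage (by fun_prop)

theorem det_latticeBasis_eq_intCast
    (z : Free.ChooseBasisIndex ℤ (𝓞 K) → 𝓞 K) :
    (latticeBasis K).det (fun i ↦ mixedEmbedding K (z i)) =
      ((RingOfIntegers.basis K).det z : ℝ) := by
  rw [Basis.det_apply, Basis.det_apply, ← eq_intCast (Int.castRingHom ℝ), RingHom.map_det]
  congr 1
  ext i j
  simp [Basis.toMatrix_apply, latticeBasis_repr_apply, integralBasis_repr_apply]

theorem ringOfIntegers_det_ne_zero {z : Free.ChooseBasisIndex ℤ (𝓞 K) → 𝓞 K}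
    (hz : LinearIndependent ℚ (fun i ↦ (z i : K))) :
    (RingOfIntegers.basis K).det z ≠ 0 := by
  intro h0
  have hdet : (integralBasis K).det (fun i ↦ (z i : K)) =
      ((RingOfIntegers.basis K).det z : ℚ) := by
    rw [Basis.det_apply, Basis.det_apply, ← eq_intCast (Int.castRingHom ℚ), RingHom.map_det]
    congr 1
    ext i j
    simp [Basis.toMatrix_apply, integralBasis_repr_apply]
  have hspan : ⊤ ≤ Submodule.span ℚ (Set.range (fun i ↦ (z i : K))) := by
    rw [hz.span_eq_top_of_card_eq_finrank']
    rw [← finrank_eq_card_chooseBasisIndex, RingOfIntegers.rank]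
  have := (integralBasis K).isUnit_det (Basis.mk hz hspan)
  rw [Basis.coe_mk, hdet, h0] at this
  simp at this

/-- A rationally independent family of integers is a real basis of the mixed space, of covolume
at least that of the ring of integers. -/
theorem exists_basis_of_linearIndependent [IsTotallyReal K]
    {z : Free.ChooseBasisIndex ℤ (𝓞 K) → 𝓞 K} (hz : LinearIndependent ℚ (fun i ↦ (z i : K))) :
    ∃ b : Basis (Free.ChooseBasisIndex ℤ (𝓞 K)) ℝ (mixedSpace K),
      (∀ i, b i = mixedEmbedding K (z i)) ∧
      ENNReal.ofReal √|(discr K : ℝ)| ≤ volume (openBox b) := by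
  have h0 := ringOfIntegers_det_ne_zero hz
  have hd := det_latticeBasis_eq_intCast z
  obtain ⟨h1, h2⟩ := (Basis.is_basis_iff_det (latticeBasis K)
    (v := fun i ↦ mixedEmbedding K (z i))).mpr (by rw [hd]; exact (by exact_mod_cast h0 :
      (((RingOfIntegers.basis K).det z : ℤ) : ℝ) ≠ 0).isUnit)
  refine ⟨Basis.mk h1 h2.ge, fun i ↦ by rw [Basis.mk_apply], ?_⟩
  rw [volume_openBox, ZSpan.measure_fundamentalDomain _ _ (latticeBasis K), Basis.coe_mk, hd,
    volume_fundamentalDomain_latticeBasis, IsTotallyReal.nrComplexPlaces_eq_zero, pow_zero, one_mul]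
  have h3 : ENNReal.ofReal √|(discr K : ℝ)| = (NNReal.sqrt ‖discr K‖₊ : ENNReal) := by
    rw [← ENNReal.ofReal_coe_nnreal]
    simp [Int.norm_eq_abs]
  rw [h3]
  refine le_mul_of_one_le_left zero_le ?_
  rw [ENNReal.one_le_ofReal]
  exact_mod_cast Int.one_le_abs h0

theorem trForm_pos [IsTotallyReal K] {a : K} (ha : TotPos a) {x : 𝓞 K} (hx : x ≠ 0) :
    0 < (trForm a x : ℝ) := by
  rw [trForm, trace_eq_sum_coord]
  refine Finset.sum_pos (fun w _ ↦ ?_) Finset.univ_nonempty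
  have := coord_mixedEmbedding_ne_zero w (x := (x : K)) (by simpa using hx)
  have := coord_pos ha w
  rw [map_mul, map_pow, coord_mul, pow_two, coord_mul, ← pow_two]
  positivity

theorem muMin_le [IsTotallyReal K] {a : K} (ha : TotPos a) {x : 𝓞 K} (hx : x ≠ 0) :
    muMin a ≤ trForm a x :=
  csInf_le ⟨0, by rintro _ ⟨y, hy, rfl⟩; exact (trForm_pos ha hy).le⟩ ⟨x, hx, rfl⟩

theorem trForm_smul (q : ℚ) (a : K) (x : 𝓞 K) : trForm ((q : K) * a) x = q * trForm a x := by
  rw [trForm, trForm, ← smul_eq_mul q, ← map_smul, Algebra.smul_def, mul_assoc]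
  simp

theorem trForm_add (a b : K) (x : 𝓞 K) : trForm (a + b) x = trForm a x + trForm b x := by
  rw [trForm, trForm, trForm, add_mul, map_add]

/-- Total positivity is an open condition. -/
theorem exists_totPos_add_mul {a : K} (ha : TotPos a) (c : K) :
    ∃ q : ℚ, 0 < q ∧ TotPos (a + q * c) := by
  have h : ∀ φ : K →+* ℝ, ∀ᶠ m : ℕ in Filter.atTop, 0 < φ a + 1 / ((m : ℝ) + 1) * φ c := by
    intro φ
    have h1 : Filter.Tendsto (fun m : ℕ ↦ φ a + 1 / ((m : ℝ) + 1) * φ c) Filter.atTop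
        (nhds (φ a + 0 * φ c)) :=
      (tendsto_one_div_add_atTop_nhds_zero_nat.mul_const _).const_add _
    exact h1.eventually (lt_mem_nhds (by simpa using ha φ))
  obtain ⟨m, hm⟩ := (Filter.eventually_all.mpr h).exists
  refine ⟨1 / ((m : ℚ) + 1), by positivity, fun φ ↦ ?_⟩
  simpa using hm φ

theorem span_sq_minVecs_eq_top {a : K} (ha : IsPerfectForm a) :
    Submodule.span ℚ ((fun x : 𝓞 K ↦ (x : K) ^ 2) '' MinVecs a) = ⊤ := by
  by_contra h
  obtain ⟨f, hf0, hker⟩ := Submodule.exists_le_ker_of_lt_top _ (lt_top_iff_ne_top.mpr h)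
  have hnd := traceForm_nondegenerate ℚ K
  set c := ((Algebra.traceForm ℚ K).toDual hnd).symm f with hc
  have hcf (y : K) : Algebra.trace ℚ K (c * y) = f y := by
    rw [← Algebra.traceForm_apply, hc, LinearMap.BilinForm.apply_toDual_symm_apply]
  have hc0 : c ≠ 0 := by
    rintro h0
    exact hf0 (LinearMap.ext fun y ↦ by rw [← hcf, h0]; simp)
  obtain ⟨q, hq, hpos⟩ := exists_totPos_add_mul ha.1 c
  have := ha.2 _ hpos fun x hx ↦ by
    have h1 : trForm c x = 0 := by
      rw [trForm, hcf]
      exact hker (Submodule.subset_span ⟨x, hx, rfl⟩)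
    rw [trForm_add, trForm_smul, h1, mul_zero, add_zero]
    exact hx
  rw [add_eq_left, mul_eq_zero] at this
  simp [hc0, hq.ne'] at this

/-- A perfect form can be scaled so that its minimum is `1`, and the squares of its minimal
vectors contain a basis. -/
theorem exists_admissible_of_isPerfectForm [IsTotallyReal K] {a : K} (ha : IsPerfectForm a) :
    ∃ q : ℚ, 0 < q ∧ Admissible ((q : K) * a) ∧
      ∃ x : Free.ChooseBasisIndex ℤ (𝓞 K) → 𝓞 K,
        LinearIndependent ℚ (fun i ↦ ((x i ^ 2 : 𝓞 K) : K)) ∧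
        ∀ i, trForm ((q : K) * a) (x i) = 1 := by
  obtain ⟨f, hmem, -, hli⟩ := Submodule.exists_fun_fin_finrank_span_eq ℚ
    ((fun x : 𝓞 K ↦ (x : K) ^ 2) '' MinVecs a)
  have hcard : Fintype.card (Free.ChooseBasisIndex ℤ (𝓞 K)) =
      Fintype.card (Fin (finrank ℚ
        (Submodule.span ℚ ((fun x : 𝓞 K ↦ (x : K) ^ 2) '' MinVecs a)))) := by
    rw [Fintype.card_fin, span_sq_minVecs_eq_top ha, finrank_top,
      ← finrank_eq_card_chooseBasisIndex, RingOfIntegers.rank]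
  have e := Fintype.equivOfCardEq hcard
  choose x hx hxf using hmem
  have hli' : LinearIndependent ℚ (fun i ↦ ((x (e i) ^ 2 : 𝓞 K) : K)) := by
    have h1 : (fun i ↦ ((x (e i) ^ 2 : 𝓞 K) : K)) = f ∘ e := by
      ext i
      simpa using hxf (e i)
    rw [h1]
    exact hli.comp e e.injective
  have : Nonempty (Free.ChooseBasisIndex ℤ (𝓞 K)) := by
    rw [← Fintype.card_pos_iff, ← finrank_eq_card_chooseBasisIndex, RingOfIntegers.rank]
    exact finrank_pos
  obtain ⟨i₀⟩ := this
  have hx0 : x (e i₀) ≠ 0 := fun h0 ↦ hli'.ne_zero i₀ (by simp [h0])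
  have hpos : 0 < trForm a (x (e i₀)) := by exact_mod_cast trForm_pos ha.1 hx0
  have hmu : muMin a = (trForm a (x (e i₀)) : ℝ) := (hx (e i₀)).symm
  refine ⟨(trForm a (x (e i₀)))⁻¹, by positivity, ⟨fun φ ↦ ?_, fun y hy ↦ ?_⟩,
    fun i ↦ x (e i), hli', fun i ↦ ?_⟩
  · rw [map_mul, map_ratCast]
    have := ha.1 φ
    positivity
  · have := muMin_le ha.1 hy
    rw [hmu] at this
    rw [trForm_smul, ← Rat.cast_one, Rat.cast_le, inv_mul_eq_div, one_le_div hpos]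
    exact_mod_cast this
  · have h1 : ((trForm a (x (e i)) : ℚ) : ℝ) = muMin a := hx (e i)
    rw [hmu, Rat.cast_inj] at h1
    rw [trForm_smul, h1, inv_mul_cancel₀ hpos.ne']

theorem exists_intCast_eq_det_mulLeft (u : (𝓞 K)ˣ) :
    ∃ m : ℤ, LinearMap.det (LinearMap.mulLeft ℝ (mixedEmbedding K (u : K))) = m := by
  refine ⟨(RingOfIntegers.basis K).det fun i ↦ (u : 𝓞 K) * RingOfIntegers.basis K i, ?_⟩
  rw [← det_latticeBasis_eq_intCast, ← mul_one (LinearMap.det _), ← (latticeBasis K).det_self,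
    ← Basis.det_comp]
  congr 1
  ext1 i
  simp [integralBasis_apply]

theorem abs_det_mulLeft_unit (u : (𝓞 K)ˣ) :
    |LinearMap.det (LinearMap.mulLeft ℝ (mixedEmbedding K (u : K)))| = 1 := by
  obtain ⟨m, hm⟩ := exists_intCast_eq_det_mulLeft u
  obtain ⟨m', hm'⟩ := exists_intCast_eq_det_mulLeft u⁻¹
  have h : LinearMap.det (LinearMap.mulLeft ℝ (mixedEmbedding K (u : K))) *
      LinearMap.det (LinearMap.mulLeft ℝ (mixedEmbedding K ((u⁻¹ : (𝓞 K)ˣ) : K))) = 1 := by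
    rw [← LinearMap.det_comp, ← LinearMap.mulLeft_mul, ← map_mul]
    simp
  rw [hm, hm'] at h
  have h1 : m * m' = 1 := by exact_mod_cast h
  rw [hm]
  exact_mod_cast Int.isUnit_iff_abs_eq.mp (IsUnit.of_mul_eq_one m' h1)

theorem volume_preimage_unit_smul (u : (𝓞 K)ˣ) (s : Set (mixedSpace K)) :
    volume ((fun y ↦ u • y) ⁻¹' s) = volume s := by
  have h := abs_det_mulLeft_unit u
  have h0 : LinearMap.det (LinearMap.mulLeft ℝ (mixedEmbedding K (u : K))) ≠ 0 := by
    intro h0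
    rw [h0] at h
    simp at h
  have := Measure.addHaar_preimage_linearMap (volume : Measure (mixedSpace K)) h0 s
  rw [abs_inv, h, inv_one, ENNReal.ofReal_one, one_mul] at this
  exact this

theorem measurable_unit_smul (u : (𝓞 K)ˣ) : Measurable fun y : mixedSpace K ↦ u • y :=
  (LinearMap.continuous_of_finiteDimensional
    (LinearMap.mulLeft ℝ (mixedEmbedding K (u : K)))).measurable

variable (K) in
/-- The points of the fundamental cone of norm at most `B`. -/
def coneLE (B : ℝ) : Set (mixedSpace K) := fundamentalCone K ∩ {y | mixedEmbedding.norm y ≤ B}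

theorem measurableSet_coneLE (B : ℝ) : MeasurableSet (coneLE K B) :=
  (measurableSet_fundamentalCone K).inter <|
    measurableSet_le (mixedEmbedding.continuous_norm K).measurable measurable_const

theorem unit_smul_mem_coneLE_iff {B : ℝ} (u : (𝓞 K)ˣ) {x y : mixedSpace K}
    (h : ∀ w, normAtPlace w x = normAtPlace w y) : u • x ∈ coneLE K B ↔ u • y ∈ coneLE K B := by
  have key {x y : mixedSpace K} (h : ∀ w, normAtPlace w x = normAtPlace w y)
      (hx : u • x ∈ coneLE K B) : u • y ∈ coneLE K B := by
    refine ⟨fundamentalCone.mem_of_normAtPlace_eq hx.1 fun w ↦ ?_, ?_⟩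
    · rw [unitSMul_smul, unitSMul_smul, map_mul, map_mul, h]
    · have h1 := hx.2
      simp only [Set.mem_ofPred_eq] at h1 ⊢
      rwa [norm_unit_smul, norm_eq_of_normAtPlace_eq h, ← norm_unit_smul u] at h1
  exact ⟨key h, key fun w ↦ (h w).symm⟩

theorem countable_units : Countable (𝓞 K)ˣ := by
  have h1 : Countable K := (integralBasis K).equivFun.toEquiv.injective.countable
  have h2 : Countable (𝓞 K) := RingOfIntegers.coe_injective.countable
  exact Units.val_injective.countable

/-- Modulo squares and torsion there are only `2 ^ rank K` units. -/
theorem exists_torsion_mul_sq_mul_prod (u : (𝓞 K)ˣ) :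
    ∃ ζ ∈ Units.torsion K, ∃ v : (𝓞 K)ˣ, ∃ p : Finset (Fin (Units.rank K)),
      u = ζ * ((∏ i ∈ p, Units.fundSystem K i) * v ^ 2) := by
  obtain ⟨⟨ζ, e⟩, h, -⟩ := Units.exist_unique_eq_mul_prod K u
  refine ⟨ζ, ζ.2, ∏ i, Units.fundSystem K i ^ (e i / 2),
    Finset.univ.filter fun i ↦ e i % 2 = 1, ?_⟩
  rw [h, Finset.prod_filter, ← Finset.prod_pow, ← Finset.prod_mul_distrib]
  congr 1
  refine Finset.prod_congr rfl fun i _ ↦ ?_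
  rw [← zpow_natCast, ← zpow_mul]
  rcases Int.emod_two_eq_zero_or_one (e i) with h0 | h0
  · rw [if_neg (by omega), one_mul]
    congr 1
    push_cast
    omega
  · rw [if_pos h0, ← zpow_one_add]
    congr 1
    push_cast
    omega

variable [IsTotallyReal K]

theorem prod_le_one_of_sum_le_card {ι : Type*} [Fintype ι] {z : ι → ℝ} (hz : ∀ i, 0 ≤ z i)
    (h : ∑ i, z i ≤ Fintype.card ι) : ∏ i, z i ≤ 1 := by
  calc ∏ i, z i ≤ ∏ i, Real.exp (z i - 1) :=
        Finset.prod_le_prod (fun i _ ↦ hz i) fun i _ ↦ by linarith [Real.add_one_le_exp (z i - 1)]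
    _ = Real.exp (∑ i, (z i - 1)) := (Real.exp_sum _ _).symm
    _ ≤ 1 := by
        rw [Real.exp_le_one_iff]
        simpa using h

/-- An admissible element has norm bounded below, by Minkowski's theorem. -/
theorem Admissible.one_le_prod_coord {c : K} (hc : Admissible c) :
    1 ≤ (finrank ℚ K : ℝ) ^ finrank ℚ K * |(discr K : ℝ)| *
      ∏ w, coord w (mixedEmbedding K c) := by
  by_contra! hlt
  have hn : 0 < (finrank ℚ K : ℝ) := by exact_mod_cast finrank_pos (R := ℚ) (M := K)
  set P := ∏ w, coord w (mixedEmbedding K c) with hP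
  have hPpos : 0 < P := Finset.prod_pos fun w _ ↦ coord_pos hc.totPos w
  set f : InfinitePlace K → NNReal :=
    fun w ↦ Real.toNNReal √(1 / (finrank ℚ K * coord w (mixedEmbedding K c))) with hf
  have hfw (w : InfinitePlace K) :
      (f w : ℝ) = √(1 / (finrank ℚ K * coord w (mixedEmbedding K c))) :=
    Real.coe_toNNReal _ (Real.sqrt_nonneg _)
  have hprod : ((∏ w, f w : NNReal) : ℝ) = √(1 / ((finrank ℚ K : ℝ) ^ finrank ℚ K * P)) := by
    rw [NNReal.coe_prod, Finset.prod_congr rfl fun w _ ↦ hfw w, ← Real.sqrt_prod]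
    · rw [Finset.prod_div_distrib, Finset.prod_mul_distrib]
      simp [card_infinitePlace, hP]
    · intro w _
      have := coord_pos hc.totPos w
      positivity
  have hlt2 : NNReal.sqrt ‖discr K‖₊ < ∏ w, f w := by
    rw [← NNReal.coe_lt_coe, hprod, Real.coe_sqrt]
    apply Real.sqrt_lt_sqrt (by positivity)
    rw [lt_div_iff₀ (by positivity), coe_nnnorm, Int.norm_eq_abs]
    linarith
  obtain ⟨x, hx0, hx⟩ := exists_ne_zero_mem_ringOfIntegers_lt (K := K) (f := f) (by
    rw [minkowskiBound, volume_fundamentalDomain_fractionalIdealLatticeBasis,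
      Units.val_one, FractionalIdeal.absNorm_one, Rat.cast_one, ENNReal.ofReal_one, one_mul,
      mixedEmbedding.finrank, volume_fundamentalDomain_latticeBasis, convexBodyLT_volume,
      convexBodyLTFactor, IsTotallyReal.nrComplexPlaces_eq_zero, pow_zero, pow_zero, one_mul,
      mul_one, mul_comm, IsTotallyReal.finrank (K := K)]
    simp only [IsTotallyReal.mult_eq, pow_one]
    push_cast
    refine ENNReal.mul_lt_mul_right (by simp) (by finiteness) ?_
    exact_mod_cast hlt2)
  have h1 := hc.one_le x hx0
  rw [← pairing_sq, pairing_apply] at h1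
  have h2 : ∑ w, coord w (mixedEmbedding K c) * coord w (mixedEmbedding K ((x : K) ^ 2)) <
      ∑ _w : InfinitePlace K, 1 / (finrank ℚ K : ℝ) := by
    refine Finset.sum_lt_sum_of_nonempty Finset.univ_nonempty fun w _ ↦ ?_
    have hcw := coord_pos hc.totPos w
    have h3 := hx w
    rw [hfw, Real.lt_sqrt (by positivity), ← normAtPlace_apply, normAtPlace_eq_abs_coord, sq_abs,
      lt_div_iff₀ (by positivity)] at h3
    rw [lt_div_iff₀ hn, map_pow, pow_two, coord_mul]
    linarith
  rw [Finset.sum_const, Finset.card_univ, card_infinitePlace, nsmul_eq_mul,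
    mul_one_div_cancel hn.ne'] at h2
  linarith

/-- A basis of the mixed space consisting of squares of integers. -/
structure IsSquareBasis {ι : Type*} (b : Basis ι ℝ (mixedSpace K)) (x : ι → 𝓞 K) : Prop where
  eq_sq : ∀ i, b i = mixedEmbedding K ((x i : K) ^ 2)

namespace IsSquareBasis

variable {ι : Type*} {b : Basis ι ℝ (mixedSpace K)} {x : ι → 𝓞 K}

omit [NumberField K] [IsTotallyReal K] in
theorem ne_zero (hb : IsSquareBasis b x) (i : ι) : x i ≠ 0 := by
  intro h
  have := hb.eq_sq i
  rw [h] at this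
  exact b.ne_zero i (by simpa using this)

variable [Fintype ι]

theorem pairing_eq (hb : IsSquareBasis b x) (c : K) (y : mixedSpace K) :
    pairing c y = ∑ i, b.repr y i * (trForm c (x i) : ℝ) := by
  conv_lhs => rw [← b.sum_repr y]
  simp [hb.eq_sq, ← pairing_sq]

omit [NumberField K] in
theorem coord_pos_of_mem_openBox [Nonempty ι] (hb : IsSquareBasis b x) {y : mixedSpace K}
    (hy : y ∈ openBox b) (w : InfinitePlace K) : 0 < coord w y := by
  rw [← b.sum_repr y, map_sum]
  refine Finset.sum_pos (fun i _ ↦ ?_) Finset.univ_nonempty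
  have h1 := coord_mixedEmbedding_ne_zero w (x := (x i : K)) (by simpa using hb.ne_zero i)
  have h2 := (hy i).1
  rw [map_smul, hb.eq_sq, map_pow, pow_two, coord_mul, smul_eq_mul, ← pow_two]
  positivity

theorem norm_le_of_mem_openBox [Nonempty ι] (hb : IsSquareBasis b x) {c : K}
    (hc : Admissible c)
    (hcx : ∀ i, trForm c (x i) = 1) (hι : Fintype.card ι = finrank ℚ K) {y : mixedSpace K}
    (hy : y ∈ openBox b) :
    mixedEmbedding.norm y ≤ (finrank ℚ K : ℝ) ^ finrank ℚ K * |(discr K : ℝ)| := by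
  have hpos := hb.coord_pos_of_mem_openBox hy
  have h1 : ∏ w, coord w (mixedEmbedding K c) * coord w y ≤ 1 := by
    refine prod_le_one_of_sum_le_card
      (fun w ↦ (mul_pos (coord_pos hc.totPos w) (hpos w)).le) ?_
    rw [← pairing_apply, hb.pairing_eq, card_infinitePlace, ← hι, ← nsmul_one, ← Finset.card_univ,
      ← Finset.sum_const]
    exact Finset.sum_le_sum fun i _ ↦ by simpa [hcx i] using (hy i).2
  rw [norm_eq_prod_abs_coord, Finset.prod_congr rfl fun w _ ↦ abs_of_pos (hpos w)]
  rw [Finset.prod_mul_distrib] at h1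
  have h2 := hc.one_le_prod_coord
  have h3 : 0 < ∏ w, coord w y := Finset.prod_pos fun w _ ↦ hpos w
  have h4 : 0 ≤ (finrank ℚ K : ℝ) ^ finrank ℚ K * |(discr K : ℝ)| := by positivity
  nlinarith [mul_le_mul_of_nonneg_left h1 h4, mul_le_mul_of_nonneg_right h2 h3.le]

theorem pairing_le_of_mem_openBox (hb : IsSquareBasis b x) {c d : K}
    (hcx : ∀ i, trForm c (x i) = 1) (hd : Admissible d)
    {y : mixedSpace K} (hy : y ∈ openBox b) : pairing c y ≤ pairing d y := by
  rw [hb.pairing_eq, hb.pairing_eq]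
  refine Finset.sum_le_sum fun i _ ↦ mul_le_mul_of_nonneg_left ?_ (hy i).1.le
  rw [hcx i]
  exact_mod_cast hd.one_le _ (hb.ne_zero i)

theorem eq_of_pairing_eq_of_mem_openBox (hb : IsSquareBasis b x) {c d : K}
    (hcx : ∀ i, trForm c (x i) = 1)
    (hd : Admissible d) {y : mixedSpace K} (hy : y ∈ openBox b)
    (h : pairing c y = pairing d y) : c = d := by
  rw [hb.pairing_eq, hb.pairing_eq] at h
  have hle : ∀ i ∈ Finset.univ, b.repr y i * (trForm c (x i) : ℝ) ≤
      b.repr y i * (trForm d (x i) : ℝ) := fun i _ ↦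
    mul_le_mul_of_nonneg_left (by rw [hcx i]; exact_mod_cast hd.one_le _ (hb.ne_zero i)) (hy i).1.le
  have heq := (Finset.sum_eq_sum_iff_of_le hle).mp h
  have hpair : pairing c = pairing d := b.ext fun i ↦ by
    rw [hb.eq_sq, pairing_sq, pairing_sq]
    exact mul_left_cancel₀ (hy i).1.ne' (heq i (Finset.mem_univ i))
  rw [← sub_eq_zero]
  refine (traceForm_nondegenerate ℚ K).1 _ fun z ↦ ?_
  have h1 := LinearMap.congr_fun hpair (mixedEmbedding K z)
  rw [pairing_mixedEmbedding, pairing_mixedEmbedding, Rat.cast_inj] at h1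
  rw [Algebra.traceForm_apply, sub_mul, map_sub, h1, sub_self]

end IsSquareBasis

/-- Boxes of two admissible elements only meet, up to squares of units, when the elements are
equivalent. -/
theorem IsSquareBasis.eq_mul_unit_sq {ι : Type*} [Fintype ι] {b b' : Basis ι ℝ (mixedSpace K)}
    {x x' : ι → 𝓞 K} (hb : IsSquareBasis b x) (hb' : IsSquareBasis b' x') {c c' : K}
    (hc : Admissible c) (hcx : ∀ i, trForm c (x i) = 1)
    (hc' : Admissible c') (hcx' : ∀ i, trForm c' (x' i) = 1)
    {y y' : mixedSpace K} (hy : y ∈ openBox b) (hy' : y' ∈ openBox b') {u : (𝓞 K)ˣ}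
    (h : y = (u ^ 2) • y') : c' = c * (u : K) ^ 2 := by
  have h1 : pairing (c * (u : K) ^ 2) y' = pairing c y := by
    rw [pairing_mul, h, unitSMul_smul]
    simp
  have h2 : pairing (c' * ((u⁻¹ : (𝓞 K)ˣ) : K) ^ 2) y = pairing c' y' := by
    rw [pairing_mul, h, unitSMul_smul, ← mul_assoc, ← map_mul]
    simp
  have h3 := hb'.pairing_le_of_mem_openBox hcx' (hc.mul_unit_sq u) hy'
  have h4 := hb.pairing_le_of_mem_openBox hcx (hc'.mul_unit_sq u⁻¹) hy
  exact hb'.eq_of_pairing_eq_of_mem_openBox hcx' (hc.mul_unit_sq u) hy' (by linarith)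

theorem volume_coneLE {B : ℝ} (hB : 0 < B) :
    volume (coneLE K B) = 2 ^ finrank ℚ K * ENNReal.ofReal (B * Units.regulator K) := by
  have hn : finrank ℚ K ≠ 0 := finrank_pos.ne'
  set r := B ^ ((finrank ℚ K : ℝ)⁻¹) with hr
  have hr0 : 0 < r := Real.rpow_pos_of_pos hB _
  have hrn : r ^ finrank ℚ K = B := Real.rpow_inv_natCast_pow hB.le hn
  have h : coneLE K B = (fun y ↦ r⁻¹ • y) ⁻¹' fundamentalCone.normLeOne K := by
    ext y
    rw [Set.mem_preimage, fundamentalCone.mem_normLeOne,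
      fundamentalCone.smul_mem_iff_mem (inv_ne_zero hr0.ne'),
      mixedEmbedding.norm_smul, abs_of_pos (inv_pos.mpr hr0), inv_pow, hrn, inv_mul_le_one₀ hB]
    rfl
  rw [h, Measure.addHaar_preimage_smul _ (inv_ne_zero hr0.ne'), mixedEmbedding.finrank, inv_pow,
    inv_inv, hrn, abs_of_pos hB, fundamentalCone.volume_normLeOne,
    IsTotallyReal.nrComplexPlaces_eq_zero,
    IsTotallyReal.finrank (K := K), ENNReal.ofReal_mul hB.le]
  ring

theorem volume_plusPart_unit_smul_coneLE {B : ℝ} (hB : 0 < B) (u : (𝓞 K)ˣ) :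
    volume (plusPart ((fun y ↦ u • y) ⁻¹' coneLE K B)) =
      ENNReal.ofReal (B * Units.regulator K) := by
  have hm : MeasurableSet ((fun y ↦ u • y) ⁻¹' coneLE K B) :=
    measurable_unit_smul u (measurableSet_coneLE B)
  have h1 := volume_eq_two_pow_mul_volume_plusPart (fun x ↦ ?_) hm
  · rw [volume_preimage_unit_smul, volume_coneLE hB, ← IsTotallyReal.finrank (K := K)] at h1
    exact ((ENNReal.mul_right_inj (by simp) (by finiteness)).mp h1).symm
  · refine unit_smul_mem_coneLE_iff u fun w ↦ ?_
    simp only [normAtPlace_apply_of_isReal (IsTotallyReal.isReal w), norm_norm]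

omit [NumberField K] in
theorem coord_unit_sq_smul_pos {y : mixedSpace K} {w : InfinitePlace K} (hy : 0 < coord w y)
    (u : (𝓞 K)ˣ) : 0 < coord w ((u ^ 2) • y) := by
  have := coord_mixedEmbedding_ne_zero w (Units.coe_ne_zero u)
  rw [unitSMul_smul, coord_mul, Units.coe_pow, map_pow, pow_two, coord_mul, ← pow_two]
  positivity

/-- A set of totally positive points of bounded norm that are inequivalent modulo squares of units
has bounded volume. -/
theorem volume_le_of_unit_sq_inequivalent {S : Set (mixedSpace K)} (hS : MeasurableSet S) {B : ℝ}
    (hB : 0 < B) (hpos : ∀ y ∈ S, ∀ w, 0 < coord w y) (hnorm : ∀ y ∈ S, mixedEmbedding.norm y ≤ B)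
    (hineq : ∀ y ∈ S, ∀ y' ∈ S, ∀ u : (𝓞 K)ˣ, y = (u ^ 2) • y' → u ^ 2 = 1) :
    volume S ≤ 2 ^ Units.rank K * ENNReal.ofReal (B * Units.regulator K) := by
  have := countable_units (K := K)
  set G : Finset (Fin (Units.rank K)) → Set (mixedSpace K) := fun p ↦
    plusPart ((fun y ↦ (∏ i ∈ p, Units.fundSystem K i) • y) ⁻¹' coneLE K B)
  set V : Subgroup (𝓞 K)ˣ := (powMonoidHom 2).range
  have hcov : S ⊆ ⋃ p, ⋃ v : V, S ∩ (fun y ↦ (v : (𝓞 K)ˣ) • y) ⁻¹' G p := by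
    intro y hy
    have hy0 : mixedEmbedding.norm y ≠ 0 := by
      rw [norm_eq_prod_abs_coord, Finset.prod_ne_zero_iff]
      exact fun w _ ↦ abs_ne_zero.mpr (hpos y hy w).ne'
    obtain ⟨u, hu⟩ := fundamentalCone.exists_unit_smul_mem hy0
    obtain ⟨ζ, hζ, v, p, rfl⟩ := exists_torsion_mul_sq_mul_prod u
    have h1 := fundamentalCone.torsion_smul_mem_of_mem hu (inv_mem hζ)
    rw [smul_smul, inv_mul_cancel_left, ← smul_smul] at h1
    refine Set.mem_iUnion.mpr ⟨p, Set.mem_iUnion.mpr ⟨⟨v ^ 2, v, rfl⟩, hy, ⟨h1, ?_⟩, fun w ↦ ?_⟩⟩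
    · change mixedEmbedding.norm (_ • _ • y) ≤ B
      rw [norm_unit_smul, norm_unit_smul]
      exact hnorm y hy
    · exact coord_unit_sq_smul_pos (hpos y hy w) v
  have hGm (p) : MeasurableSet (G p) :=
    measurableSet_plusPart (measurable_unit_smul _ (measurableSet_coneLE B))
  have hp (p) : volume (⋃ v : V, S ∩ (fun y ↦ (v : (𝓞 K)ˣ) • y) ⁻¹' G p) ≤
      ENNReal.ofReal (B * Units.regulator K) := by
    refine (measure_iUnion_le _).trans ?_
    have h1 (v : V) : volume (S ∩ (fun y ↦ (v : (𝓞 K)ˣ) • y) ⁻¹' G p) =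
        volume ((fun y ↦ (v⁻¹ : (𝓞 K)ˣ) • y) ⁻¹' S ∩ G p) := by
      rw [← volume_preimage_unit_smul (v⁻¹ : (𝓞 K)ˣ), Set.preimage_inter, Set.preimage_preimage]
      simp only [smul_inv_smul, Set.preimage_id']
    simp_rw [h1]
    refine (tsum_meas_le_meas_iUnion_of_disjoint _ (fun v ↦ ?_) fun v v' hv ↦ ?_).trans
      ((measure_mono ?_).trans
        (volume_plusPart_unit_smul_coneLE hB (∏ i ∈ p, Units.fundSystem K i)).le)
    · exact (measurable_unit_smul _ hS).inter (hGm p)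
    · refine Set.disjoint_left.mpr fun z hz hz' ↦ hv ?_
      obtain ⟨u, hu⟩ := (v⁻¹ * v').2
      have h2 := hineq _ hz.1 _ hz'.1 u (by
        rw [show u ^ 2 = _ from hu]
        simp only [Subgroup.coe_mul, Subgroup.coe_inv, mul_smul, smul_inv_smul])
      rw [show u ^ 2 = _ from hu] at h2
      exact inv_mul_eq_one.mp (Subtype.ext h2)
    · exact Set.iUnion_subset fun v ↦ Set.inter_subset_right
  calc volume S ≤ _ := measure_mono hcov
    _ ≤ _ := measure_iUnion_le _
    _ ≤ ∑' p : Finset (Fin (Units.rank K)), ENNReal.ofReal (B * Units.regulator K) :=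
        ENNReal.tsum_le_tsum hp
    _ = _ := by simp [tsum_fintype, Fintype.card_finset]

omit [IsTotallyReal K] in
theorem homothetic_of_mul_unit_sq {a a' : K} {q q' : ℚ} (hq : 0 < q) (hq' : 0 < q') {u : (𝓞 K)ˣ}
    (h : (q' : K) * a' = q * a * (u : K) ^ 2) : Homothetic a a' := by
  refine ⟨q / q', by positivity, u, ?_⟩
  have : (q' : K) ≠ 0 := by exact_mod_cast hq'.ne'
  rw [Rat.cast_div]
  field_simp
  linear_combination h

variable (K) in
/-- A volume comparison bounds the number of classes of perfect forms. -/
theorem numClasses_mul_sqrt_discr_le :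
    (numClasses K : ℝ) * √|(discr K : ℝ)| ≤
      2 ^ Units.rank K * ((finrank ℚ K : ℝ) ^ finrank ℚ K * |(discr K : ℝ)| *
        Units.regulator K) := by
  have hR := Units.regulator_pos K
  have hn : 0 < (finrank ℚ K : ℝ) := by exact_mod_cast finrank_pos (R := ℚ) (M := K)
  have hΔ : 0 < |(discr K : ℝ)| := abs_pos.mpr (by exact_mod_cast discr_ne_zero K)
  rw [numClasses]
  set Q := Quot (fun a b : {a : K // IsPerfectForm a} => Homothetic (a : K) (b : K))
  rcases finite_or_infinite Q with hfin | hinf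
  swap
  · rw [Nat.card_eq_zero_of_infinite, Nat.cast_zero, zero_mul]
    positivity
  have := Fintype.ofFinite Q
  have : Nonempty (Free.ChooseBasisIndex ℤ (𝓞 K)) := by
    rw [← Fintype.card_pos_iff, ← finrank_eq_card_chooseBasisIndex, RingOfIntegers.rank]
    exact finrank_pos
  have hcard : Fintype.card (Free.ChooseBasisIndex ℤ (𝓞 K)) = finrank ℚ K := by
    rw [← finrank_eq_card_chooseBasisIndex, RingOfIntegers.rank]
  choose q hq hadm x hli hx using fun i : Q ↦ exists_admissible_of_isPerfectForm i.out.2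
  choose b hb hvol using fun i : Q ↦ exists_basis_of_linearIndependent (hli i)
  have hsq (i : Q) : IsSquareBasis (b i) (x i) := ⟨fun j ↦ by rw [hb]; simp⟩
  have key {i j : Q} {y y' : mixedSpace K} (hy : y ∈ openBox (b i)) (hy' : y' ∈ openBox (b j))
      {u : (𝓞 K)ˣ} (h : y = (u ^ 2) • y') : i = j ∧ u ^ 2 = 1 := by
    have h1 := (hsq i).eq_mul_unit_sq (hsq j) (hadm i) (hx i) (hadm j) (hx j) hy hy' h
    have hij : i = j := by
      rw [← i.out_eq, ← j.out_eq]
      exact Quot.sound (homothetic_of_mul_unit_sq (hq i) (hq j) h1)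
    subst hij
    refine ⟨rfl, ?_⟩
    have h0 : ((q i : ℚ) : K) * (i.out : K) ≠ 0 := by
      intro h0
      have := (hadm i).totPos (embedding_of_isReal (IsTotallyReal.isReal (Classical.arbitrary _)))
      rw [h0, map_zero] at this
      exact this.false
    have h2 : (u : K) ^ 2 = 1 := (mul_right_eq_self₀.mp h1.symm).resolve_right h0
    ext
    simpa using h2
  have hvolS : volume (⋃ i, openBox (b i)) = ∑ i, volume (openBox (b i)) := by
    rw [measure_iUnion (fun i j hij ↦ ?_) fun i ↦ measurableSet_openBox _, tsum_fintype]
    exact Set.disjoint_left.mpr fun y hy hy' ↦ hij (key hy hy' (u := 1) (by simp)).1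
  have hle := volume_le_of_unit_sq_inequivalent (S := ⋃ i, openBox (b i))
    (MeasurableSet.iUnion fun i ↦ measurableSet_openBox _)
    (B := (finrank ℚ K : ℝ) ^ finrank ℚ K * |(discr K : ℝ)|) (by positivity)
    (fun y hy w ↦ by
      obtain ⟨i, hi⟩ := Set.mem_iUnion.mp hy
      exact (hsq i).coord_pos_of_mem_openBox hi w)
    (fun y hy ↦ by
      obtain ⟨i, hi⟩ := Set.mem_iUnion.mp hy
      exact (hsq i).norm_le_of_mem_openBox (hadm i) (hx i) hcard hi)
    (fun y hy y' hy' u h ↦ by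
      obtain ⟨i, hi⟩ := Set.mem_iUnion.mp hy
      obtain ⟨j, hj⟩ := Set.mem_iUnion.mp hy'
      exact (key hi hj h).2)
  have hge : (Fintype.card Q : ENNReal) * ENNReal.ofReal √|(discr K : ℝ)| ≤
      volume (⋃ i, openBox (b i)) := by
    rw [hvolS, ← nsmul_eq_mul, ← Finset.card_univ, ← Finset.sum_const]
    exact Finset.sum_le_sum fun i _ ↦ hvol i
  have h := hge.trans hle
  rw [← ENNReal.ofReal_natCast, ← ENNReal.ofReal_mul (by positivity),
    show (2 : ENNReal) = ENNReal.ofReal 2 by simp, ← ENNReal.ofReal_pow (by norm_num),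
    ← ENNReal.ofReal_mul (by positivity), ENNReal.ofReal_le_ofReal_iff (by positivity)] at h
  rwa [Nat.card_eq_fintype_card]

variable (K) in
theorem pow_div_factorial_le_sqrt_discr :
    (finrank ℚ K : ℝ) ^ finrank ℚ K / (finrank ℚ K).factorial ≤ √|(discr K : ℝ)| := by
  have h := abs_discr_ge' K
  rw [IsTotallyReal.nrComplexPlaces_eq_zero, mul_zero, pow_zero, one_mul] at h
  refine Real.le_sqrt_of_sq_le ?_
  rw [div_pow, ← pow_mul, mul_comm _ 2]
  exact_mod_cast h

variable (K) in
theorem numClasses_le :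
    (numClasses K : ℝ) ≤ 2 ^ (finrank ℚ K - 1) * (finrank ℚ K).factorial * Units.regulator K *
      |(discr K : ℝ)| := by
  have hR := Units.regulator_pos K
  have hΔ : 0 < |(discr K : ℝ)| := abs_pos.mpr (by exact_mod_cast discr_ne_zero K)
  have hs : 0 < √|(discr K : ℝ)| := Real.sqrt_pos.mpr hΔ
  have h1 := numClasses_mul_sqrt_discr_le K
  have h2 := pow_div_factorial_le_sqrt_discr K
  rw [div_le_iff₀ (by positivity)] at h2
  rw [Units.rank, card_infinitePlace] at h1
  refine le_of_mul_le_mul_right (h1.trans ?_) hs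
  calc _ = 2 ^ (finrank ℚ K - 1) * Units.regulator K * |(discr K : ℝ)| *
        (finrank ℚ K : ℝ) ^ finrank ℚ K := by ring
    _ ≤ 2 ^ (finrank ℚ K - 1) * Units.regulator K * |(discr K : ℝ)| *
        (√|(discr K : ℝ)| * (finrank ℚ K).factorial) := by gcongr
    _ = _ := by ring

theorem two_pow_mul_factorial_le_of_le {n : ℕ} {s g : ℝ} (hs : 0 ≤ s) (hsn : s ^ 2 ≤ (n : ℝ) - 1)
    (hg : 0 ≤ g) (hgn : g ≤ Real.Gamma (2 + (n : ℝ) / 2))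
    (h : 2 ^ (n - 1) * (n.factorial : ℝ) ≤
      2.718 ^ n * (s / 2) ^ n * 0.6366 ^ (2 * n) * g ^ 4) :
    2 ^ (n - 1) * (n.factorial : ℝ) ≤ Real.exp 1 ^ n * (√((n : ℝ) - 1) / 2) ^ n *
      (2 / π) ^ (2 * n) * Real.Gamma (2 + (n : ℝ) / 2) ^ 4 := by
  refine h.trans ?_
  have he : (2.718 : ℝ) ≤ Real.exp 1 := by linarith [Real.exp_one_gt_d9]
  have hpi : (0.6366 : ℝ) ≤ 2 / π := by
    rw [le_div_iff₀ Real.pi_pos]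
    linarith [Real.pi_lt_d4]
  have hsn' : s ≤ √((n : ℝ) - 1) := Real.le_sqrt_of_sq_le hsn
  gcongr

theorem le_Gamma_nat_add_half (k : ℕ) :
    ((2 * k - 1).doubleFactorial : ℝ) * 1.77 / 2 ^ k ≤ Real.Gamma (k + 1 / 2) := by
  rw [Real.Gamma_nat_add_half]
  have : (1.77 : ℝ) ≤ √π := Real.le_sqrt_of_sq_le (by nlinarith [Real.pi_gt_d4])
  gcongr

theorem two_pow_mul_factorial_le {n : ℕ} (h2 : 2 ≤ n) (h11 : n ≤ 11) :
    2 ^ (n - 1) * (n.factorial : ℝ) ≤ Real.exp 1 ^ n * (√((n : ℝ) - 1) / 2) ^ n *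
      (2 / π) ^ (2 * n) * Real.Gamma (2 + (n : ℝ) / 2) ^ 4 := by
  have hev (k : ℕ) (hk : n = 2 * k) :
      ((k + 1).factorial : ℝ) ≤ Real.Gamma (2 + (n : ℝ) / 2) := by
    rw [← Real.Gamma_nat_eq_factorial, hk]
    apply le_of_eq
    congr 1
    push_cast
    ring
  have hodd (k : ℕ) (hk : n = 2 * k + 1) :
      ((2 * (k + 2) - 1).doubleFactorial : ℝ) * 1.77 / 2 ^ (k + 2) ≤
        Real.Gamma (2 + (n : ℝ) / 2) := by
    refine (le_Gamma_nat_add_half (k + 2)).trans_eq ?_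
    rw [hk]
    congr 1
    push_cast
    ring
  interval_cases n
  · exact two_pow_mul_factorial_le_of_le (s := 1) (by norm_num) (by norm_num) (by positivity)
      (hev 1 rfl) (by norm_num [Nat.factorial])
  · exact two_pow_mul_factorial_le_of_le (s := 1.4) (by norm_num) (by norm_num) (by positivity)
      (hodd 1 rfl) (by norm_num [Nat.factorial, Nat.doubleFactorial])
  · exact two_pow_mul_factorial_le_of_le (s := 1.7) (by norm_num) (by norm_num) (by positivity)
      (hev 2 rfl) (by norm_num [Nat.factorial])
  · exact two_pow_mul_factorial_le_of_le (s := 2) (by norm_num) (by norm_num) (by positivity)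
      (hodd 2 rfl) (by norm_num [Nat.factorial, Nat.doubleFactorial])
  · exact two_pow_mul_factorial_le_of_le (s := 2) (by norm_num) (by norm_num) (by positivity)
      (hev 3 rfl) (by norm_num [Nat.factorial])
  · exact two_pow_mul_factorial_le_of_le (s := 2) (by norm_num) (by norm_num) (by positivity)
      (hodd 3 rfl) (by norm_num [Nat.factorial, Nat.doubleFactorial])
  · exact two_pow_mul_factorial_le_of_le (s := 2) (by norm_num) (by norm_num) (by positivity)
      (hev 4 rfl) (by norm_num [Nat.factorial])
  · exact two_pow_mul_factorial_le_of_le (s := 2) (by norm_num) (by norm_num) (by positivity)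
      (hodd 4 rfl) (by norm_num [Nat.factorial, Nat.doubleFactorial])
  · exact two_pow_mul_factorial_le_of_le (s := 3) (by norm_num) (by norm_num) (by positivity)
      (hev 5 rfl) (by norm_num [Nat.factorial])
  · exact two_pow_mul_factorial_le_of_le (s := 3) (by norm_num) (by norm_num) (by positivity)
      (hodd 5 rfl) (by norm_num [Nat.factorial, Nat.doubleFactorial])

theorem mul_rpow_inv_pow_le_exp {n : ℕ} (hn : n ≠ 0) {r R θ : ℝ} (hr : 0 ≤ r) (hR : 0 ≤ R)
    (hθ : 0 ≤ θ) :
    Real.exp 1 ^ n * r ^ n * R ≤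
      Real.exp (n * √((r * R ^ ((1 : ℝ) / n)) ^ 2 + θ)) := by
  set η := r * R ^ ((1 : ℝ) / n) with hη
  have hη0 : 0 ≤ η := by positivity
  have h1 : η ≤ √(η ^ 2 + θ) := Real.le_sqrt_of_sq_le (by linarith)
  have h2 : Real.exp 1 * η ≤ Real.exp η := by
    have := Real.add_one_le_exp (η - 1)
    rw [Real.exp_sub, le_div_iff₀ (Real.exp_pos 1)] at this
    linarith
  calc Real.exp 1 ^ n * r ^ n * R = (Real.exp 1 * η) ^ n := by
        rw [hη, mul_pow, mul_pow, one_div, Real.rpow_inv_natCast_pow hR hn, mul_assoc]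
    _ ≤ Real.exp η ^ n := by gcongr
    _ = Real.exp (n * η) := (Real.exp_nat_mul _ _).symm
    _ ≤ _ := by gcongr

end

end PerfectUnary

/-- Bound on the number of homothety classes of perfect unary forms for
a totally real field of degree `2 ≤ n ≤ 11` which is `A`-reducible. -/
theorem perfect_form_classes_bound_small_degree
    (K : Type*) [Field K] [NumberField K] (n : ℕ)
    (hdeg : Module.finrank ℚ K = n) (hn2 : 2 ≤ n) (hn11 : n ≤ 11)
    (htr : TotallyReal K) (A : ℝ) (hA : 1 ≤ A) (hred : IsAReducible K A) :
    (numClasses K : ℝ) ≤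
      Real.exp ((n : ℝ) * Real.sqrt
          ((Real.sqrt ((n : ℝ) - 1) / 2 *
              NumberField.Units.regulator K ^ ((1 : ℝ) / (n : ℝ))) ^ 2 +
            4 * Real.log A ^ 2 / ((n : ℝ) - 1))) *
        |(NumberField.discr K : ℝ)| * (2 / π) ^ (2 * n) *
        Real.Gamma (2 + (n : ℝ) / 2) ^ 4 := by
  subst hdeg
  have : IsTotallyReal K := ⟨htr⟩
  have hn : (2 : ℝ) ≤ Module.finrank ℚ K := by exact_mod_cast hn2
  have hR := NumberField.Units.regulator_pos K
  have hexp := PerfectUnary.mul_rpow_inv_pow_le_exp (n := Module.finrank ℚ K) (by omega)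
    (r := √((Module.finrank ℚ K : ℝ) - 1) / 2) (by positivity) hR.le
    (θ := 4 * Real.log A ^ 2 / ((Module.finrank ℚ K : ℝ) - 1))
    (div_nonneg (by positivity) (by linarith))
  have hΓ : 0 ≤ Real.Gamma (2 + (Module.finrank ℚ K : ℝ) / 2) :=
    Real.Gamma_nonneg_of_nonneg (by positivity)
  calc (numClasses K : ℝ) ≤ 2 ^ (Module.finrank ℚ K - 1) * (Module.finrank ℚ K).factorial *
        NumberField.Units.regulator K * |(NumberField.discr K : ℝ)| := PerfectUnary.numClasses_le K
    _ ≤ Real.exp 1 ^ Module.finrank ℚ K *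
          (√((Module.finrank ℚ K : ℝ) - 1) / 2) ^ Module.finrank ℚ K *
          (2 / π) ^ (2 * Module.finrank ℚ K) *
          Real.Gamma (2 + (Module.finrank ℚ K : ℝ) / 2) ^ 4 *
        NumberField.Units.regulator K * |(NumberField.discr K : ℝ)| := by
        gcongr ?_ * _ * _
        exact PerfectUnary.two_pow_mul_factorial_le hn2 hn11
    _ = Real.exp 1 ^ Module.finrank ℚ K *
          (√((Module.finrank ℚ K : ℝ) - 1) / 2) ^ Module.finrank ℚ K *
          NumberField.Units.regulator K * |(NumberField.discr K : ℝ)| *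
          (2 / π) ^ (2 * Module.finrank ℚ K) *
          Real.Gamma (2 + (Module.finrank ℚ K : ℝ) / 2) ^ 4 := by ring
    _ ≤ _ := by gcongr
end

section
/- Let K be a totally real number field of degree n ≥ 12 over ℚ, with discriminant Δ_K and regulator R_K, and suppose K is A-reducible for some A ≥ 1. Then the number n_K of homothety classes of perfect unary forms over K satisfies n_K ≤ exp(n·√(η² + θ)) · |Δ_K| · (2/π)^{2n} · Γ(2 + n/2)^4, where η = (√(n-1)/2) · (2/π)^{n-1} · Γ(2 + (n-1)/2)² · ( √(2/n) · (1/1000) · ((log log n)/(log n))³ )^{2-n} · R_K and θ = 4·(log A)²/(n-1). -/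
open NumberField Real

/-- If nonzero vectors of a lattice have norm at least `c` and some point has distance at least
`m * c` from the lattice, then disjoint translates of `m + 1` balls bound the covolume below. -/
theorem add_one_mul_pow_le_covolume {ι : Type*} [Fintype ι] (L : Submodule ℤ (ι → ℝ))
    [DiscreteTopology L] [IsZLattice ℝ L] {c : ℝ} (hc : 0 < c)
    (hmin : ∀ x ∈ L, x ≠ 0 → c ≤ ‖x‖) (v : ι → ℝ) (m : ℕ)
    (hm : m * c ≤ Metric.infDist v (L : Set (ι → ℝ))) :
    (m + 1) * c ^ Fintype.card ι ≤ ZLattice.covolume L := by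
  classical
  set f : (ι → ℝ) → ℝ := fun x => Metric.infDist x (L : Set (ι → ℝ)) with hf
  have hfc : Continuous f := Metric.continuous_infDist_pt _
  have hne : (L : Set (ι → ℝ)).Nonempty := ⟨0, L.zero_mem⟩
  have hlip (x y : ι → ℝ) : f x ≤ f y + ‖x - y‖ := by
    rw [← dist_eq_norm]; exact Metric.infDist_le_infDist_add_dist
  have hinv (x ℓ : ι → ℝ) (hℓ : ℓ ∈ L) : f (ℓ + x) ≤ f x := by
    refine le_of_forall_pos_le_add fun ε hε => ?_
    obtain ⟨y, hy, hxy⟩ := (Metric.infDist_lt_iff hne).1 (lt_add_of_pos_right (f x) hε)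
    refine (Metric.infDist_le_dist_of_mem (L.add_mem hℓ hy)).trans ?_
    simpa using hxy.le
  have hp (k : Fin (m + 1)) : ∃ p, f p = k * c := by
    refine mem_range_of_exists_le_of_exists_ge hfc ⟨0, ?_⟩ ⟨v, le_trans ?_ hm⟩
    · simp only [hf, Metric.infDist_zero_of_mem L.zero_mem]; positivity
    · gcongr; exact_mod_cast Nat.lt_succ_iff.1 k.2
  choose p hp using hp
  have hsep (k j : Fin (m + 1)) (ℓ : ι → ℝ) (hℓ : ℓ ∈ L) (h : ‖ℓ + p k - p j‖ < c) :
      k = j ∧ ℓ = 0 := by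
    have key : ∀ k j : Fin (m + 1), ∀ ℓ ∈ L, ‖ℓ + p k - p j‖ < c → k ≤ j := by
      intro k j ℓ hℓ h
      have h1 := hlip (p k) (-ℓ + p j)
      have h2 := hinv (p j) (-ℓ) (L.neg_mem hℓ)
      rw [show p k - (-ℓ + p j) = ℓ + p k - p j by abel] at h1
      rw [hp] at h1 h2
      have h3 : (k : ℝ) * c < ((j : ℕ) + 1 : ℝ) * c := by linarith
      have h4 := lt_of_mul_lt_mul_right h3 hc.le
      have h5 : (k : ℕ) < j + 1 := by exact_mod_cast h4
      exact Fin.le_def.2 (by omega)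
    have hkj : k = j := by
      refine le_antisymm (key k j ℓ hℓ h) (key j k (-ℓ) (L.neg_mem hℓ) ?_)
      rwa [show -ℓ + p j - p k = -(ℓ + p k - p j) by abel, norm_neg]
    subst hkj
    refine ⟨rfl, by_contra fun h0 => ?_⟩
    have := hmin ℓ hℓ h0
    rw [add_sub_cancel_right] at h
    linarith
  let B : Fin (m + 1) → Set (ι → ℝ) := fun k => Metric.ball (p k) (c / 2)
  have hvol : MeasureTheory.volume (⋃ k, B k) =
      ENNReal.ofReal ((m + 1) * c ^ Fintype.card ι) := by
    rw [MeasureTheory.measure_iUnion]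
    · simp only [B, Real.volume_pi_ball _ (half_pos hc), tsum_fintype]
      rw [mul_div_cancel₀ _ (two_ne_zero), Finset.sum_const, Finset.card_univ, Fintype.card_fin,
        nsmul_eq_mul, ENNReal.ofReal_mul (by positivity)]
      congr 1
      rw [ENNReal.ofReal_add (by positivity) zero_le_one]; simp
    · intro k j hkj
      refine Metric.ball_disjoint_ball ?_
      rw [add_halves]
      by_contra! h
      rw [dist_eq_norm] at h
      exact hkj (hsep k j 0 L.zero_mem (by simpa using h)).1
    · exact fun k => measurableSet_ball
  have hfund := ZLattice.isAddFundamentalDomain (Module.Free.chooseBasis ℤ L)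
    MeasureTheory.volume
  rw [ZLattice.covolume_eq_measure_fundamentalDomain L _ hfund]
  by_contra! hlt
  rw [MeasureTheory.measureReal_def, ← ENNReal.lt_ofReal_iff_toReal_lt
    (Bornology.IsBounded.measure_lt_top (ZSpan.fundamentalDomain_isBounded _)).ne, ← hvol] at hlt
  have : MeasurableVAdd L (ι → ℝ) := (inferInstance : MeasurableVAdd L.toAddSubgroup (ι → ℝ))
  have : MeasureTheory.VAddInvariantMeasure L (ι → ℝ) MeasureTheory.volume :=
    (inferInstance : MeasureTheory.VAddInvariantMeasure L.toAddSubgroup (ι → ℝ) _)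
  have : Countable L := inferInstance
  obtain ⟨x, y, hxy, hd⟩ := MeasureTheory.exists_pair_mem_lattice_not_disjoint_vadd hfund
    (MeasurableSet.iUnion fun k => measurableSet_ball).nullMeasurableSet hlt
  obtain ⟨z, hz1, hz2⟩ := Set.not_disjoint_iff.1 hd
  obtain ⟨z1, hz1, rfl⟩ := hz1
  obtain ⟨z2, hz2, he⟩ := hz2
  obtain ⟨k, hk⟩ := Set.mem_iUnion.1 hz1
  obtain ⟨j, hj⟩ := Set.mem_iUnion.1 hz2
  simp only [Metric.mem_ball, dist_eq_norm] at hk hj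
  have he : (y : ι → ℝ) + z2 = x + z1 := he
  have := hsep k j ((x - y : L) : ι → ℝ) (x - y).2 (by
    rw [show ((x - y : L) : ι → ℝ) + p k - p j = (z2 - p j) - (z1 - p k) by
      rw [Submodule.coe_sub, ← sub_eq_zero]
      have := sub_eq_zero.2 he
      rw [← neg_eq_zero, ← this]; abel]
    exact (norm_sub_le _ _).trans_lt (by linarith))
  exact hxy (sub_eq_zero.1 (Subtype.ext this.2))

/-- The covering radius of a lattice is bounded in terms of its covolume and minimum. -/
theorem exists_mem_norm_sub_lt {ι : Type*} [Fintype ι] (L : Submodule ℤ (ι → ℝ))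
    [DiscreteTopology L] [IsZLattice ℝ L] {c : ℝ} (hc : 0 < c)
    (hmin : ∀ x ∈ L, x ≠ 0 → c ≤ ‖x‖) (v : ι → ℝ) :
    ∃ x ∈ L, ‖v - x‖ * c ^ Fintype.card ι < ZLattice.covolume L * c := by
  set D := Metric.infDist v (L : Set (ι → ℝ))
  have h1 := add_one_mul_pow_le_covolume L hc hmin v ⌊D / c⌋₊ (by
    rw [← le_div_iff₀ hc]; exact Nat.floor_le (div_nonneg Metric.infDist_nonneg hc.le))
  have h2 : D < (⌊D / c⌋₊ + 1) * c := by
    rw [← div_lt_iff₀ hc]; exact Nat.lt_floor_add_one _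
  obtain ⟨x, hx, hlt⟩ := (Metric.infDist_lt_iff ⟨0, L.zero_mem⟩).1 h2
  refine ⟨x, hx, ?_⟩
  rw [dist_eq_norm] at hlt
  have hp : 0 < c ^ Fintype.card ι := by positivity
  nlinarith [mul_le_mul_of_nonneg_right h1 hc.le, mul_lt_mul_of_pos_right hlt hp]

section RealEmbeddings

variable {K : Type*} [Field K] [IsTotallyReal K]

/-- The real embedding attached to an infinite place of a totally real field. -/
noncomputable def realEmb (w : InfinitePlace K) : K →+* ℝ :=
  InfinitePlace.embedding_of_isReal (IsTotallyReal.isReal w)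

theorem abs_realEmb (w : InfinitePlace K) (x : K) : |realEmb w x| = w x :=
  InfinitePlace.norm_embedding_of_isReal (IsTotallyReal.isReal w) x

theorem exists_realEmb_eq (φ : K →+* ℝ) : ∃ w, realEmb w = φ := by
  have hr : ComplexEmbedding.IsReal (Complex.ofRealHom.comp φ) := by
    ext x; simp
  refine ⟨InfinitePlace.mk (Complex.ofRealHom.comp φ), RingHom.ext fun x => ?_⟩
  have h := InfinitePlace.embedding_of_isReal_apply
    (IsTotallyReal.isReal (InfinitePlace.mk (Complex.ofRealHom.comp φ))) x
  rw [InfinitePlace.embedding_mk_eq_of_isReal hr] at h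
  exact Complex.ofReal_injective h

theorem totPos_iff {a : K} : TotPos a ↔ ∀ w, 0 < realEmb w a :=
  ⟨fun h w => h _, fun h φ => by obtain ⟨w, rfl⟩ := exists_realEmb_eq φ; exact h w⟩

variable [NumberField K]

theorem trace_eq_sum_realEmb (x : K) :
    ((Algebra.trace ℚ K x : ℚ) : ℝ) = ∑ w, realEmb w x := by
  have h := trace_eq_sum_embeddings ℂ (K := ℚ) (x := x)
  have hb : Function.Bijective
      (fun w : InfinitePlace K => (w.embedding.toRatAlgHom : K →ₐ[ℚ] ℂ)) := by
    constructor
    · intro w w' hw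
      rw [← InfinitePlace.mk_embedding w, ← InfinitePlace.mk_embedding w']
      congr 1
      ext y
      exact DFunLike.congr_fun hw y
    · intro φ
      refine ⟨InfinitePlace.mk φ.toRingHom, ?_⟩
      ext y
      have := InfinitePlace.embedding_mk_eq_of_isReal
        (IsTotallyReal.complexEmbedding_isReal φ.toRingHom)
      exact DFunLike.congr_fun this y
  rw [← Function.Bijective.sum_comp hb] at h
  apply Complex.ofReal_injective
  push_cast
  rw [eq_ratCast] at h
  rw [h]
  refine Finset.sum_congr rfl fun w _ => ?_
  exact (InfinitePlace.embedding_of_isReal_apply (IsTotallyReal.isReal w) x).symm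

theorem prod_place_eq_abs_norm (x : K) :
    ∏ w : InfinitePlace K, w x = |(Algebra.norm ℚ x : ℝ)| := by
  have := InfinitePlace.prod_eq_abs_norm x
  simp only [IsTotallyReal.mult_eq, pow_one] at this
  rw [this]; push_cast; rfl

theorem one_le_prod_place {x : 𝓞 K} (hx : x ≠ 0) : 1 ≤ ∏ w : InfinitePlace K, w (x : K) := by
  rw [prod_place_eq_abs_norm, ← Algebra.coe_norm_int]
  have h : Algebra.norm ℤ x ≠ 0 := Algebra.norm_ne_zero_iff.2 hx
  exact_mod_cast Int.one_le_abs h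

theorem card_place_eq_finrank : Fintype.card (InfinitePlace K) = Module.finrank ℚ K := by
  rw [IsTotallyReal.finrank, InfinitePlace.card_eq_nrRealPlaces_add_nrComplexPlaces,
    IsTotallyReal.nrComplexPlaces_eq_zero, add_zero]

theorem trForm_eq_sum (a : K) (x : 𝓞 K) :
    (trForm a x : ℝ) = ∑ w, realEmb w a * realEmb w (x : K) ^ 2 := by
  simp [trForm, trace_eq_sum_realEmb]

theorem trForm_pos {a : K} (ha : TotPos a) {x : 𝓞 K} (hx : x ≠ 0) : 0 < (trForm a x : ℝ) := by
  rw [trForm_eq_sum]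
  refine Finset.sum_pos (fun w _ => mul_pos (ha _) ?_) Finset.univ_nonempty
  have : (realEmb w) (x : K) ≠ 0 := by simpa using hx
  positivity

end RealEmbeddings

theorem eq_zero_of_trace_mul_eq_zero {K : Type*} [Field K] [NumberField K] {c : K} {s : Set K}
    (hs : Submodule.span ℚ s = ⊤) (h : ∀ v ∈ s, Algebra.trace ℚ K (c * v) = 0) : c = 0 := by
  refine (traceForm_nondegenerate ℚ K).1 c fun v => ?_
  have hle : Submodule.span ℚ s ≤ LinearMap.ker (Algebra.traceForm ℚ K c) :=
    Submodule.span_le.2 fun v hv => by simpa [Algebra.traceForm_apply] using h v hv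
  exact hle (hs ▸ Submodule.mem_top)

/-- A totally positive element with minimum one is determined by the sum of the squares of a
family of minimal vectors, among those whose minimal vectors have spanning squares. -/
theorem eq_of_sum_sq_eq {ι : Type*} [Fintype ι] {K : Type*} [Field K] [NumberField K]
    {a a' : K} {x x' : ι → 𝓞 K}
    (hx0 : ∀ i, x i ≠ 0) (hx : ∀ i, trForm a (x i) = 1)
    (hspan : Submodule.span ℚ (Set.range fun i => (x i : K) ^ 2) = ⊤)
    (ha' : ∀ y : 𝓞 K, y ≠ 0 → 1 ≤ trForm a' y) (hx' : ∀ i, trForm a' (x' i) = 1)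
    (hsum : ∑ i, (x i : K) ^ 2 = ∑ i, (x' i : K) ^ 2) : a = a' := by
  have h1 : ∑ i, trForm a' (x i) = ∑ i : ι, 1 := by
    rw [← Finset.sum_congr rfl fun i _ => hx' i]
    simp only [trForm, ← map_sum, ← Finset.mul_sum, hsum]
  have h2 := (Finset.sum_eq_sum_iff_of_le fun i _ => ha' (x i) (hx0 i)).1 h1.symm
  refine sub_eq_zero.1 (eq_zero_of_trace_mul_eq_zero hspan ?_)
  rintro _ ⟨i, rfl⟩
  have h3 := h2 i (Finset.mem_univ i)
  have h4 := hx i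
  simp only [trForm] at h3 h4
  rw [sub_mul, map_sub, h4, ← h3, sub_self]

section PerfectForms

variable {K : Type*} [Field K] [NumberField K] [IsTotallyReal K]

theorem muMin_le_trForm {a : K} (ha : TotPos a) {x : 𝓞 K} (hx : x ≠ 0) :
    muMin a ≤ (trForm a x : ℝ) := by
  refine csInf_le ⟨0, ?_⟩ ⟨x, hx, rfl⟩
  rintro _ ⟨y, hy, rfl⟩
  exact (trForm_pos ha hy).le

theorem IsPerfectForm.exists_minVec_ne_zero {a : K} (ha : IsPerfectForm a) :
    ∃ x ∈ MinVecs a, x ≠ 0 := by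
  by_contra! h
  have h2 : TotPos (2 * a) := fun φ => by
    rw [map_mul, map_ofNat]; exact mul_pos two_pos (ha.1 φ)
  have := ha.2 (2 * a) h2 fun x hx => by
    have h0 := h x hx
    subst h0
    have hx : (trForm a 0 : ℝ) = muMin a := hx
    rw [← hx]; simp [trForm]
  have h3 : a = 0 := by linear_combination this
  have h4 := ha.1 (realEmb (Classical.arbitrary (InfinitePlace K)))
  simp [h3] at h4

theorem IsPerfectForm.muMin_pos {a : K} (ha : IsPerfectForm a) : 0 < muMin a := by
  obtain ⟨x, hx, h0⟩ := ha.exists_minVec_ne_zero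
  exact (show (trForm a x : ℝ) = muMin a from hx) ▸ trForm_pos ha.1 h0

theorem exists_rat_totPos_add {a : K} (ha : TotPos a) (c : K) :
    ∃ ε : ℚ, 0 < ε ∧ TotPos (a + ε * c) := by
  have h (w : InfinitePlace K) : ∀ᶠ t : ℝ in nhds 0, 0 < realEmb w a + t * realEmb w c := by
    have hc : Continuous fun t : ℝ => realEmb w a + t * realEmb w c := by fun_prop
    exact hc.continuousAt.eventually (lt_mem_nhds (by simpa using ha (realEmb w)))
  obtain ⟨δ, hδ, hb⟩ := Metric.eventually_nhds_iff.1 (Filter.eventually_all.2 h)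
  obtain ⟨ε, hε, hεδ⟩ := exists_rat_btwn hδ
  refine ⟨ε, by exact_mod_cast hε, totPos_iff.2 fun w => ?_⟩
  have := hb (y := (ε : ℝ)) (by rwa [dist_zero_right, Real.norm_of_nonneg hε.le]) w
  simpa using this

theorem IsPerfectForm.span_sq_minVecs {a : K} (ha : IsPerfectForm a) :
    Submodule.span ℚ ((fun x : 𝓞 K => (x : K) ^ 2) '' MinVecs a) = ⊤ := by
  by_contra hne
  obtain ⟨f, hf0, hf⟩ := Submodule.exists_le_ker_of_lt_top _ (lt_top_iff_ne_top.2 hne)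
  let c := (Algebra.traceForm ℚ K).toDual (traceForm_nondegenerate ℚ K) |>.symm f
  have hc (v : K) : Algebra.trace ℚ K (c * v) = f v :=
    LinearMap.BilinForm.apply_toDual_symm_apply (hB := traceForm_nondegenerate ℚ K) f v
  obtain ⟨ε, hε, hpos⟩ := exists_rat_totPos_add ha.1 c
  have := ha.2 _ hpos fun x hx => by
    have hx' : (trForm a x : ℝ) = muMin a := hx
    have h0 : f ((x : K) ^ 2) = 0 := hf (Submodule.subset_span ⟨x, hx, rfl⟩)
    rw [← hx']
    congr 1
    rw [← hc] at h0
    have : (a + ε * c) * (x : K) ^ 2 = a * (x : K) ^ 2 + ε • (c * (x : K) ^ 2) := by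
      rw [Rat.smul_def]; ring
    rw [trForm, trForm, this, map_add, map_smul, h0, smul_zero, add_zero]
  have hc0 : c = 0 := by simpa [hε.ne'] using this
  exact hf0 (LinearMap.ext fun v => by simp [← hc, hc0])

theorem IsPerfectForm.exists_minVecs_span {a : K} (ha : IsPerfectForm a) :
    ∃ x : InfinitePlace K → 𝓞 K, (∀ i, x i ∈ MinVecs a) ∧
      Submodule.span ℚ (Set.range fun i => (x i : K) ^ 2) = ⊤ := by
  obtain ⟨b, hbs, hspan, hli⟩ :=
    exists_linearIndependent ℚ ((fun x : 𝓞 K => (x : K) ^ 2) '' MinVecs a)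
  rw [ha.span_sq_minVecs] at hspan
  let B := Module.Basis.mk hli (by rw [Subtype.range_coe, hspan])
  have : Fintype b := FiniteDimensional.fintypeBasisIndex B
  have hcard : Fintype.card (InfinitePlace K) = Fintype.card b := by
    rw [card_place_eq_finrank, Module.finrank_eq_card_basis B]
  let e := Fintype.equivOfCardEq hcard
  choose x hx hxe using fun i => hbs (e i).2
  refine ⟨x, hx, ?_⟩
  rw [show (fun i => (x i : K) ^ 2) = Subtype.val ∘ e from funext hxe, EquivLike.range_comp,
    Subtype.range_coe, hspan]

end PerfectForms

section Units

open NumberField.Units NumberField.Units.dirichletUnitTheorem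

variable {K : Type*} [Field K] [NumberField K] [IsTotallyReal K]

theorem logEmbedding_apply_of_totallyReal (u : (𝓞 K)ˣ) (w : {w : InfinitePlace K // w ≠ w₀}) :
    logEmbedding K (Additive.ofMul u) w = Real.log (w.1 u) := by
  rw [logEmbedding_component, IsTotallyReal.mult_eq, Nat.cast_one, one_mul]

open scoped Classical in
theorem one_fifth_le_norm_logEmbedding {u : (𝓞 K)ˣ}
    (hu : logEmbedding K (Additive.ofMul u) ≠ 0) :
    1 / 5 ≤ ‖logEmbedding K (Additive.ofMul u)‖ := by
  by_contra! hlt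
  have he : Real.exp (2 / 5) ≤ 3 / 2 := by
    refine le_of_pow_le_pow_left₀ (n := 5) (by norm_num) (by norm_num) ?_
    rw [← Real.exp_nat_mul, show ((5 : ℕ) : ℝ) * (2 / 5) = (2 : ℕ) * 1 by norm_num,
      Real.exp_nat_mul]
    have := Real.exp_one_lt_d9
    nlinarith [Real.exp_pos 1]
  have hlog (w : {w : InfinitePlace K // w ≠ w₀}) : |Real.log (w.1 u)| < 1 / 5 := by
    rw [← logEmbedding_apply_of_totallyReal, ← Real.norm_eq_abs]
    exact (norm_le_pi_norm _ w).trans_lt hlt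
  have hpos (w : InfinitePlace K) : 0 < w (u : K) := Units.pos_at_place u w
  have hsq (w : InfinitePlace K) : w (u : K) ^ 2 = Real.exp (2 * Real.log (w u)) := by
    rw [mul_comm, Real.exp_mul, Real.exp_log (hpos w), Real.rpow_two]
  obtain ⟨w₁, hw₁⟩ := Function.ne_iff.1 hu
  set y : 𝓞 K := (u : 𝓞 K) ^ 2 - 1 with hy
  have hyw (w : InfinitePlace K) : w (y : K) = |w (u : K) ^ 2 - 1| := by
    rw [← abs_realEmb, ← abs_realEmb w (u : K), sq_abs]
    simp [hy]
  have hy0 : y ≠ 0 := by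
    intro h0
    have h1 := hyw w₁
    rw [h0, RingOfIntegers.coe_eq_algebraMap, map_zero, map_zero, eq_comm,
      abs_eq_zero, sub_eq_zero, hsq, Real.exp_eq_one_iff] at h1
    apply hw₁
    rw [logEmbedding_apply_of_totallyReal]
    simpa using h1
  have hone := one_le_prod_place hy0
  rw [Fintype.prod_eq_mul_prod_subtype_ne _ w₀] at hone
  set d := Fintype.card {w : InfinitePlace K // w ≠ w₀} with hd
  have hsum : Real.log (w₀ (u : K)) ≤ d * (1 / 5) := by
    have h := sum_logEmbedding_component u
    rw [IsTotallyReal.mult_eq] at h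
    have h2 : Real.log (w₀ (u : K)) =
        ∑ w : {w : InfinitePlace K // w ≠ w₀}, -Real.log (w.1 u) := by
      rw [Finset.sum_neg_distrib, ← Finset.sum_congr rfl fun w _ =>
        logEmbedding_apply_of_totallyReal u w]
      rw [h]; simp
    rw [h2, ← nsmul_eq_mul, hd, ← Finset.card_univ]
    exact Finset.sum_le_card_nsmul _ _ _ fun w _ => (neg_le_abs _).trans (hlog w).le
  have h0 : w₀ (y : K) ≤ (3 / 2) ^ d := by
    have h1 : (1 : ℝ) ≤ (3 / 2) ^ d := one_le_pow₀ (by norm_num)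
    have h2 : w₀ (u : K) ^ 2 ≤ (3 / 2) ^ d := by
      calc w₀ (u : K) ^ 2 ≤ Real.exp (d * (2 / 5)) := by
            rw [hsq]; exact Real.exp_le_exp.2 (by linarith)
        _ ≤ (3 / 2) ^ d := by rw [Real.exp_nat_mul]; gcongr
    rw [hyw, abs_le]
    constructor <;> nlinarith [sq_nonneg (w₀ (u : K))]
  have h1 : ∏ w : {w : InfinitePlace K // w ≠ w₀}, w.1 (y : K) ≤ (1 / 2) ^ d := by
    refine (Finset.prod_le_prod (g := fun _ => (1 / 2 : ℝ)) (fun w _ => apply_nonneg _ _)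
      fun w _ => ?_).trans_eq (by rw [Finset.prod_const, Finset.card_univ])
    have hw := abs_lt.1 (hlog w)
    have h2 : w.1 (u : K) ^ 2 ≤ 3 / 2 := by
      rw [hsq]; exact (Real.exp_le_exp.2 (by linarith)).trans he
    have h3 : 1 / 2 ≤ w.1 (u : K) ^ 2 := by
      rw [hsq]; linarith [Real.add_one_le_exp (2 * Real.log (w.1 (u : K)))]
    rw [hyw, abs_le]
    constructor <;> linarith
  have h2 : (1 : ℝ) ≤ (3 / 4) ^ d := by
    calc (1 : ℝ) ≤ _ := hone
      _ ≤ (3 / 2) ^ d * (1 / 2) ^ d := by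
        gcongr
      _ = _ := by rw [← mul_pow]; norm_num
  have hd0 : d ≠ 0 := by
    have : Nonempty {w : InfinitePlace K // w ≠ w₀} := ⟨w₁⟩
    exact Fintype.card_ne_zero
  exact absurd h2 (not_le.2 (pow_lt_one₀ (by norm_num) (by norm_num) hd0))

open scoped Classical in
theorem one_fifth_le_norm_of_mem_unitLattice {x : logSpace K} (hx : x ∈ unitLattice K)
    (h0 : x ≠ 0) : 1 / 5 ≤ ‖x‖ := by
  obtain ⟨u, -, rfl⟩ := hx
  exact one_fifth_le_norm_logEmbedding h0

open scoped Classical in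
theorem card_ne_w₀ : Fintype.card {w : InfinitePlace K // w ≠ w₀} + 1 = Module.finrank ℚ K := by
  rw [← card_place_eq_finrank, Fintype.card_subtype_compl, Fintype.card_subtype_eq]
  exact Nat.sub_add_cancel Fintype.card_pos

theorem one_fifth_pow_le_regulator {d : ℕ} (hd : Module.finrank ℚ K = d + 1) :
    (1 / 5) ^ d ≤ regulator K := by
  classical
  have h := add_one_mul_pow_le_covolume (unitLattice K) (c := 1 / 5) (by norm_num)
    (fun x hx h0 => one_fifth_le_norm_of_mem_unitLattice hx h0) 0 0
    (by simpa using Metric.infDist_nonneg)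
  have hc : Fintype.card {w : InfinitePlace K // w ≠ w₀} = d := by
    have := card_ne_w₀ (K := K); omega
  simpa [regulator, hc] using h

theorem exists_unit_add_log_ge {d : ℕ} (hd : Module.finrank ℚ K = d + 2)
    (α : InfinitePlace K → ℝ) (hα : ∑ w, α w = 0) :
    ∃ u : (𝓞 K)ˣ, ∀ w, -((d + 1) * (2 * (5 ^ d * regulator K))) ≤
      α w + 2 * Real.log (w (u : K)) := by
  classical
  obtain ⟨x, hx, hlt⟩ := exists_mem_norm_sub_lt (unitLattice K) (c := 1 / 5) (by norm_num)
    (fun x hx h0 => one_fifth_le_norm_of_mem_unitLattice hx h0) (fun w => -(α w.1) / 2)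
  have hc : Fintype.card {w : InfinitePlace K // w ≠ w₀} = d + 1 := by
    have := card_ne_w₀ (K := K); omega
  change _ < regulator K * (1 / 5) at hlt
  have hR := Units.regulator_pos K
  obtain ⟨u, -, rfl⟩ := hx
  set u : (𝓞 K)ˣ := Additive.toMul u
  change ‖_ - logEmbedding K (Additive.ofMul u)‖ * _ < _ at hlt
  rw [hc] at hlt
  set r := 2 * (5 ^ d * regulator K) with hr
  have hr0 : 0 ≤ r := by positivity
  have hnorm : ‖(fun w : {w : InfinitePlace K // w ≠ w₀} => -(α w.1) / 2) -
      logEmbedding K (Additive.ofMul u)‖ ≤ r / 2 := by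
    rw [pow_succ, ← mul_assoc, mul_lt_mul_iff_left₀ (by norm_num), one_div, inv_pow,
      ← div_eq_mul_inv, div_lt_iff₀ (by positivity)] at hlt
    rw [hr]; linarith
  have hw (w : {w : InfinitePlace K // w ≠ w₀}) :
      |α w.1 + 2 * Real.log (w.1 (u : K))| ≤ r := by
    have h := (norm_le_pi_norm _ w).trans hnorm
    rw [Pi.sub_apply, logEmbedding_apply_of_totallyReal, Real.norm_eq_abs] at h
    rw [show α w.1 + 2 * Real.log (w.1 (u : K)) = -2 * (-(α w.1) / 2 - Real.log (w.1 (u : K))) by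
      ring, abs_mul]
    norm_num
    linarith
  refine ⟨u, fun w => ?_⟩
  by_cases h0 : w = w₀
  · subst h0
    have hs : ∑ w : InfinitePlace K, (α w + 2 * Real.log (w (u : K))) = 0 := by
      have := sum_mult_mul_log u
      simp only [IsTotallyReal.mult_eq, Nat.cast_one, one_mul] at this
      rw [Finset.sum_add_distrib, hα, ← Finset.mul_sum, this]; simp
    rw [Fintype.sum_eq_add_sum_subtype_ne _ w₀] at hs
    have hle : ∑ w : {w : InfinitePlace K // w ≠ w₀}, (α w.1 + 2 * Real.log (w.1 (u : K))) ≤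
        (d + 1) * r := by
      have := Finset.sum_le_card_nsmul (Finset.univ : Finset {w : InfinitePlace K // w ≠ w₀})
        (fun w => α w.1 + 2 * Real.log (w.1 (u : K))) r
        fun w _ => (le_abs_self _).trans (hw w)
      rw [Finset.card_univ, hc, nsmul_eq_mul] at this
      exact_mod_cast this
    linarith
  · have := (abs_le.1 (hw ⟨w, h0⟩)).1
    have hd0 : (0 : ℝ) ≤ d := Nat.cast_nonneg d
    nlinarith

end Units
theorem trForm_mul_sq_unit {K : Type*} [Field K] [NumberField K] (a : K) (u : (𝓞 K)ˣ)
    (y : 𝓞 K) : trForm (a * ((u : 𝓞 K) : K) ^ 2) ((u⁻¹ : (𝓞 K)ˣ) * y) = trForm a y := by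
  have h : ((u : 𝓞 K) : K) * (((u⁻¹ : (𝓞 K)ˣ) : 𝓞 K) : K) = 1 := by
    rw [← map_mul, Units.mul_inv, map_one]
  have e : ((((u⁻¹ : (𝓞 K)ˣ) : 𝓞 K) * y : 𝓞 K) : K) = (((u⁻¹ : (𝓞 K)ˣ) : 𝓞 K) : K) * (y : K) :=
    map_mul (algebraMap (𝓞 K) K) _ _
  rw [trForm, trForm, e]
  congr 1
  linear_combination (a * (y : K) ^ 2) *
    (((u : 𝓞 K) : K) * (((u⁻¹ : (𝓞 K)ˣ) : 𝓞 K) : K) + 1) * h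

section Counting

open NumberField.mixedEmbedding

variable {K : Type*} [Field K] [NumberField K] [IsTotallyReal K]

theorem minkowskiBound_one_eq :
    minkowskiBound K (1 : (FractionalIdeal (nonZeroDivisors (𝓞 K)) K)ˣ) =
      2 ^ Module.finrank ℚ K * ENNReal.ofReal (√|(discr K : ℝ)|) := by
  classical
  rw [minkowskiBound, volume_fundamentalDomain_fractionalIdealLatticeBasis,
    volume_fundamentalDomain_latticeBasis, IsTotallyReal.nrComplexPlaces_eq_zero,
    mixedEmbedding.finrank, mul_comm]
  congr 1
  rw [Units.val_one, FractionalIdeal.absNorm_one, Rat.cast_one, ENNReal.ofReal_one, pow_zero,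
    one_mul, one_mul, ← ENNReal.ofReal_coe_nnreal, Real.coe_sqrt, coe_nnnorm, Int.norm_eq_abs]

theorem one_le_pow_mul_discr_mul_prod {a : K} (ha : TotPos a)
    (hmin : ∀ y : 𝓞 K, y ≠ 0 → 1 ≤ trForm a y) :
    1 ≤ (Module.finrank ℚ K : ℝ) ^ Module.finrank ℚ K * |(discr K : ℝ)| *
      ∏ w, realEmb w a := by
  classical
  by_contra! hlt
  set n := Module.finrank ℚ K with hn
  have hn0 : (0 : ℝ) < n := by exact_mod_cast Module.finrank_pos
  have hpos (w : InfinitePlace K) : 0 < realEmb w a := ha _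
  let f : InfinitePlace K → NNReal := fun w => Real.toNNReal (√(n * realEmb w a)⁻¹)
  have hf (w : InfinitePlace K) : (f w : ℝ) = √(n * realEmb w a)⁻¹ :=
    Real.coe_toNNReal _ (Real.sqrt_nonneg _)
  have hf2 (w : InfinitePlace K) : (f w : ℝ) ^ 2 = (n * realEmb w a)⁻¹ := by
    rw [hf, Real.sq_sqrt (inv_nonneg.2 (mul_pos hn0 (hpos w)).le)]
  have hprod : √|(discr K : ℝ)| < ∏ w, (f w : ℝ) := by
    have hP : 0 < ∏ w, realEmb w a := Finset.prod_pos fun w _ => hpos w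
    refine Real.sqrt_lt' (Finset.prod_pos fun w _ => ?_) |>.2 ?_
    · rw [hf]; have := hpos w; positivity
    · rw [← Finset.prod_pow, Finset.prod_congr rfl fun w _ => hf2 w, Finset.prod_inv_distrib,
        Finset.prod_mul_distrib, Finset.prod_const, Finset.card_univ, card_place_eq_finrank,
        ← one_div, lt_div_iff₀ (by positivity)]
      linarith
  have hvol : minkowskiBound K (1 : (FractionalIdeal (nonZeroDivisors (𝓞 K)) K)ˣ) <
      MeasureTheory.volume (convexBodyLT K f) := by
    rw [minkowskiBound_one_eq, convexBodyLT_volume]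
    simp only [IsTotallyReal.mult_eq, pow_one, convexBodyLTFactor,
      IsTotallyReal.nrComplexPlaces_eq_zero, pow_zero, mul_one, IsTotallyReal.finrank]
    push_cast
    refine ENNReal.mul_lt_mul_right (by positivity) (by finiteness) ?_
    rw [← ENNReal.ofNNReal_finsetProd, ← ENNReal.ofReal_coe_nnreal,
      ENNReal.ofReal_lt_ofReal_iff_of_nonneg (Real.sqrt_nonneg _)]
    exact_mod_cast hprod
  obtain ⟨x, hx0, hx⟩ := exists_ne_zero_mem_ringOfIntegers_lt K hvol
  have h1 : (1 : ℝ) ≤ trForm a x := by exact_mod_cast hmin x hx0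
  rw [trForm_eq_sum] at h1
  have h2 : ∑ w, realEmb w a * realEmb w (x : K) ^ 2 < ∑ w : InfinitePlace K, (n : ℝ)⁻¹ := by
    refine Finset.sum_lt_sum_of_nonempty Finset.univ_nonempty fun w _ => ?_
    have h3 : realEmb w (x : K) ^ 2 < (n * realEmb w a)⁻¹ := by
      rw [← hf2, ← sq_abs, abs_realEmb]
      exact pow_lt_pow_left₀ (hx w) (apply_nonneg _ _) two_ne_zero
    calc _ < realEmb w a * (n * realEmb w a)⁻¹ := mul_lt_mul_of_pos_left h3 (hpos w)
      _ = _ := by have := (hpos w).ne'; field_simp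
  rw [Finset.sum_const, Finset.card_univ, card_place_eq_finrank, ← hn, nsmul_eq_mul,
    mul_inv_cancel₀ hn0.ne'] at h2
  linarith

/-- Algebraic integers of a totally real field with nonnegative conjugates can be told apart
by the integral parts of their conjugates. -/
theorem eq_of_floor_realEmb_eq {x y : 𝓞 K} (hx : ∀ w, 0 ≤ realEmb w (x : K))
    (hy : ∀ w, 0 ≤ realEmb w (y : K))
    (h : ∀ w, ⌊realEmb w (x : K)⌋₊ = ⌊realEmb w (y : K)⌋₊) : x = y := by
  by_contra hne
  have h1 := one_le_prod_place (sub_ne_zero.2 hne)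
  have h2 : ∏ w : InfinitePlace K, w ((x - y : 𝓞 K) : K) < ∏ w : InfinitePlace K, 1 := by
    refine Finset.prod_lt_prod_of_nonempty (fun w _ => ?_) (fun w _ => ?_) Finset.univ_nonempty
    · rw [InfinitePlace.pos_iff]
      exact RingOfIntegers.coe_ne_zero_iff.2 (sub_ne_zero.2 hne)
    · rw [← abs_realEmb, RingOfIntegers.coe_eq_algebraMap, map_sub, map_sub, abs_lt]
      have e1 := Nat.floor_le (hx w)
      have e2 := Nat.lt_floor_add_one (realEmb w (x : K))
      have e3 := Nat.floor_le (hy w)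
      have e4 := Nat.lt_floor_add_one (realEmb w (y : K))
      rw [h w] at e1 e2
      constructor <;> linarith
  rw [Finset.prod_const_one] at h2
  linarith

theorem exists_reduced_representative {d : ℕ} (hd : Module.finrank ℚ K = d + 2) {B : ℝ}
    (hB0 : 0 < B)
    (hB : (d + 1) * (2 * (5 ^ d * Units.regulator K)) +
      Real.log ((Module.finrank ℚ K : ℝ) ^ Module.finrank ℚ K * |(discr K : ℝ)|) /
        Module.finrank ℚ K ≤ Real.log B)
    {a₀ : K} (ha₀ : IsPerfectForm a₀) :
    ∃ (a : K) (q : ℚ) (u : (𝓞 K)ˣ) (x : InfinitePlace K → 𝓞 K), 0 < q ∧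
      a = q * a₀ * ((u : 𝓞 K) : K) ^ 2 ∧ (∀ i, x i ≠ 0) ∧ (∀ i, trForm a (x i) = 1) ∧
      Submodule.span ℚ (Set.range fun i => (x i : K) ^ 2) = ⊤ ∧
      (∀ y : 𝓞 K, y ≠ 0 → 1 ≤ trForm a y) ∧ ∀ w, B⁻¹ ≤ realEmb w a := by
  obtain ⟨x, hx, hspan⟩ := ha₀.exists_minVecs_span
  have hx (i) : (trForm a₀ (x i) : ℝ) = muMin a₀ := hx i
  obtain ⟨i₀⟩ : Nonempty (InfinitePlace K) := inferInstance
  set m := trForm a₀ (x i₀) with hm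
  have hmμ : (m : ℝ) = muMin a₀ := hx i₀
  have hm0 : 0 < m := by have := ha₀.muMin_pos; rw [← hmμ] at this; exact_mod_cast this
  have hxm (i) : trForm a₀ (x i) = m := by exact_mod_cast (hx i).trans hmμ.symm
  have hx0 (i) : x i ≠ 0 := by
    intro h0
    have := hxm i
    rw [h0] at this
    simp [trForm] at this
    exact hm0.ne this
  have hscale (y : 𝓞 K) : trForm ((m⁻¹ : ℚ) * a₀ : K) y = m⁻¹ * trForm a₀ y := by
    rw [trForm, trForm, mul_assoc, ← Rat.smul_def, map_smul, smul_eq_mul]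
  set a₁ : K := (m⁻¹ : ℚ) * a₀ with ha₁
  have hpos₁ : TotPos a₁ := fun φ => by
    rw [ha₁, map_mul, map_ratCast]
    exact mul_pos (by exact_mod_cast inv_pos.2 hm0) (ha₀.1 φ)
  have hmin₁ (y : 𝓞 K) (hy : y ≠ 0) : 1 ≤ trForm a₁ y := by
    have h : m ≤ trForm a₀ y := by
      have := muMin_le_trForm ha₀.1 hy
      rw [← hmμ] at this; exact_mod_cast this
    rw [hscale, ← inv_mul_cancel₀ hm0.ne']
    exact mul_le_mul_of_nonneg_left h (inv_nonneg.2 hm0.le)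
  have hprod := one_le_pow_mul_discr_mul_prod hpos₁ hmin₁
  set n := Module.finrank ℚ K with hn
  have hn0 : (0 : ℝ) < n := by exact_mod_cast Module.finrank_pos
  have hΔ : (0 : ℝ) < |(discr K : ℝ)| := by
    rw [abs_pos]; exact_mod_cast discr_ne_zero K
  have hPpos : 0 < ∏ w, realEmb w a₁ := Finset.prod_pos fun w _ => hpos₁ _
  set S := ∑ w, Real.log (realEmb w a₁) with hS
  have hlogS : 0 ≤ Real.log ((n : ℝ) ^ n * |(discr K : ℝ)|) + S := by
    rw [hS, ← Real.log_prod fun w _ => (hpos₁ (realEmb w)).ne',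
      ← Real.log_mul (by positivity) hPpos.ne']
    exact Real.log_nonneg hprod
  obtain ⟨u, hu⟩ := exists_unit_add_log_ge hd (fun w => Real.log (realEmb w a₁) - S / n) (by
    rw [Finset.sum_sub_distrib, ← hS, Finset.sum_const, Finset.card_univ, card_place_eq_finrank,
      ← hn, nsmul_eq_mul, mul_div_cancel₀ _ hn0.ne', sub_self])
  have hinv (y : 𝓞 K) : trForm (a₁ * ((u : 𝓞 K) : K) ^ 2) y = trForm a₁ (u * y) := by
    rw [← trForm_mul_sq_unit a₁ u (u * y), Units.inv_mul_cancel_left]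
  refine ⟨a₁ * ((u : 𝓞 K) : K) ^ 2, m⁻¹, u, fun i => (u⁻¹ : (𝓞 K)ˣ) * x i, inv_pos.2 hm0, rfl,
    fun i => mul_ne_zero (Units.ne_zero _) (hx0 i), fun i => ?_, ?_, fun y hy => ?_, fun w => ?_⟩
  · rw [trForm_mul_sq_unit, hscale, hxm, inv_mul_cancel₀ hm0.ne']
  · set v : K := (((u⁻¹ : (𝓞 K)ˣ) : 𝓞 K) : K) with hv
    have hv0 : v ≠ 0 := RingOfIntegers.coe_ne_zero_iff.2 (Units.ne_zero _)
    have himg : (Set.range fun i => ((((u⁻¹ : (𝓞 K)ˣ) : 𝓞 K) * x i : 𝓞 K) : K) ^ 2) =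
        LinearMap.mulLeft ℚ (v ^ 2) '' Set.range fun i => (x i : K) ^ 2 := by
      rw [← Set.range_comp]
      congr 1
      ext i
      simp [hv, mul_pow]
    rw [himg, ← Submodule.map_span, hspan, Submodule.map_top, LinearMap.range_eq_top]
    exact fun z => ⟨(v ^ 2)⁻¹ * z, by simp [hv0]⟩
  · rw [hinv]; exact hmin₁ _ (mul_ne_zero (Units.ne_zero _) hy)
  · have h := hu w
    have hau := hpos₁ (realEmb w)
    have huw : 0 < w ((u : 𝓞 K) : K) := Units.pos_at_place u w
    have he : realEmb w (a₁ * ((u : 𝓞 K) : K) ^ 2) =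
        realEmb w a₁ * w ((u : 𝓞 K) : K) ^ 2 := by
      rw [map_mul, map_pow, ← abs_realEmb, sq_abs]
    rw [he, ← Real.log_le_log_iff (by positivity) (by positivity), Real.log_inv,
      Real.log_mul hau.ne' (by positivity), Real.log_pow]
    have h3 : -(Real.log ((n : ℝ) ^ n * |(discr K : ℝ)|) / n) ≤ S / n := by
      rw [← neg_div]; gcongr; linarith
    push_cast
    linarith

theorem numClasses_le {d : ℕ} (hd : Module.finrank ℚ K = d + 2) {B : ℝ} (hB0 : 0 < B)
    (hB : (d + 1) * (2 * (5 ^ d * Units.regulator K)) +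
      Real.log ((Module.finrank ℚ K : ℝ) ^ Module.finrank ℚ K * |(discr K : ℝ)|) /
        Module.finrank ℚ K ≤ Real.log B) :
    (numClasses K : ℝ) ≤ (Module.finrank ℚ K * B + 1) ^ Module.finrank ℚ K := by
  classical
  choose! a q u x hq ha hx0 hx hspan hmin hBa using
    fun a₀ (ha₀ : IsPerfectForm a₀) => exists_reduced_representative hd hB0 hB ha₀
  set n := Module.finrank ℚ K with hn
  let s : K → 𝓞 K := fun a₀ => ∑ i, x a₀ i ^ 2
  have hs (a₀ : K) (w : InfinitePlace K) :
      realEmb w (s a₀ : K) = ∑ i, realEmb w (x a₀ i : K) ^ 2 := by simp [s]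
  have hs0 (a₀ : K) (w : InfinitePlace K) : 0 ≤ realEmb w (s a₀ : K) := by
    rw [hs]; exact Finset.sum_nonneg fun i _ => sq_nonneg _
  have hsB (a₀ : K) (ha₀ : IsPerfectForm a₀) (w : InfinitePlace K) :
      realEmb w (s a₀ : K) ≤ n * B := by
    rw [hs, hn, ← card_place_eq_finrank, ← nsmul_eq_mul, ← Finset.card_univ]
    refine Finset.sum_le_card_nsmul _ _ _ fun i _ => ?_
    have h1 : ((trForm (a a₀) (x a₀ i) : ℚ) : ℝ) = 1 := by rw [hx a₀ ha₀ i, Rat.cast_one]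
    rw [trForm_eq_sum] at h1
    have hpos (w : InfinitePlace K) : 0 ≤ realEmb w (a a₀) :=
      (inv_nonneg.2 hB0.le).trans (hBa a₀ ha₀ w)
    have h2 := Finset.single_le_sum (f := fun w => realEmb w (a a₀) * realEmb w (x a₀ i : K) ^ 2)
      (fun w _ => mul_nonneg (hpos w) (sq_nonneg _)) (Finset.mem_univ w)
    rw [h1] at h2
    have h3 := (mul_le_mul_of_nonneg_right (hBa a₀ ha₀ w)
      (sq_nonneg (realEmb w (x a₀ i : K)))).trans h2
    rwa [inv_mul_le_iff₀ hB0, mul_one] at h3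
  let F : Quot (fun a b : {a : K // IsPerfectForm a} => Homothetic (a : K) (b : K)) →
      InfinitePlace K → Fin (⌊n * B⌋₊ + 1) := fun c w =>
    ⟨⌊realEmb w (s c.out : K)⌋₊, Nat.lt_succ_of_le (Nat.floor_mono (hsB _ c.out.2 w))⟩
  have hF : Function.Injective F := by
    intro c c' h
    have hss : s c.out = s c'.out := by
      refine eq_of_floor_realEmb_eq (hs0 _) (hs0 _) fun w => ?_
      exact Fin.val_eq_of_eq (congrFun h w)
    have hc := c.out.2
    have hc' := c'.out.2
    have haa : a c.out = a c'.out := by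
      refine eq_of_sum_sq_eq (hx0 _ hc) (hx _ hc) (hspan _ hc) (hmin _ hc') (hx _ hc') ?_
      have := congrArg (fun z : 𝓞 K => (z : K)) hss
      simpa [s] using this
    rw [← Quot.out_eq c, ← Quot.out_eq c']
    refine Quot.sound ⟨q c.out / q c'.out, div_pos (hq _ hc) (hq _ hc'),
      u c.out * (u c'.out)⁻¹, ?_⟩
    rw [ha _ hc, ha _ hc'] at haa
    have hq0 : (q c'.out : K) ≠ 0 := by exact_mod_cast (hq _ hc').ne'
    have hu : (((u c'.out : (𝓞 K)ˣ) : 𝓞 K) : K) *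
        ((((u c'.out)⁻¹ : (𝓞 K)ˣ) : 𝓞 K) : K) = 1 := by
      rw [← map_mul, Units.mul_inv, map_one]
    rw [Units.val_mul, RingOfIntegers.coe_eq_algebraMap, map_mul, Rat.cast_div, mul_pow,
      div_mul_eq_mul_div, div_mul_eq_mul_div, eq_div_iff hq0, ← mul_assoc, haa]
    linear_combination (-(c'.out : K) * q c'.out *
      ((((u c'.out : (𝓞 K)ˣ) : 𝓞 K) : K) * ((((u c'.out)⁻¹ : (𝓞 K)ˣ) : 𝓞 K) : K) + 1)) * hu
  have hcard : numClasses K ≤ (⌊n * B⌋₊ + 1) ^ n := by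
    refine (Nat.card_le_card_of_injective F hF).trans_eq ?_
    rw [Nat.card_eq_fintype_card, Fintype.card_fun, Fintype.card_fin, card_place_eq_finrank]
  calc (numClasses K : ℝ) ≤ ((⌊n * B⌋₊ : ℝ) + 1) ^ n := by exact_mod_cast hcard
    _ ≤ _ := by
      gcongr
      exact Nat.floor_le (by positivity)

end Counting

section Estimates

theorem one_le_two_div_pi_pow_mul_Gamma_sq (m : ℕ) :
    1 ≤ (2 / π) ^ m * Gamma (2 + (m : ℝ) / 2) ^ 2 := by
  have hπ := Real.pi_pos
  have hπ4 := Real.pi_le_four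
  induction m using Nat.twoStepInduction with
  | zero => simp
  | one =>
    have h1 : Gamma (2 + ((1 : ℕ) : ℝ) / 2) = 3 / 4 * √π := by
      rw [show (2 : ℝ) + ((1 : ℕ) : ℝ) / 2 = (1 / 2 + 1) + 1 by norm_num,
        Real.Gamma_add_one (by norm_num), Real.Gamma_add_one (by norm_num),
        Real.Gamma_one_half_eq]
      ring
    rw [h1, mul_pow, Real.sq_sqrt hπ.le, pow_one]
    field_simp
    norm_num
  | more m ih _ =>
    have hm : (0 : ℝ) ≤ m := Nat.cast_nonneg m
    have h1 : Gamma (2 + ((m + 2 : ℕ) : ℝ) / 2) = (2 + m / 2) * Gamma (2 + (m : ℝ) / 2) := by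
      rw [← Real.Gamma_add_one (by positivity)]
      congr 1
      push_cast
      ring
    have h2 : 1 ≤ 2 / π * (2 + (m : ℝ) / 2) := by
      rw [div_mul_eq_mul_div, one_le_div hπ]
      linarith
    calc (1 : ℝ) ≤ (2 / π * (2 + (m : ℝ) / 2)) ^ 2 *
          ((2 / π) ^ m * Gamma (2 + (m : ℝ) / 2) ^ 2) :=
        one_le_mul_of_one_le_of_one_le (one_le_pow₀ h2) ih
      _ = _ := by rw [h1]; ring

theorem mul_add_two_sq_le_pow {d : ℕ} (hd : 10 ≤ d) : 14 * (d + 2) ^ 2 ≤ 200 ^ d := by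
  induction d, hd using Nat.le_induction with
  | base => norm_num
  | succ d hd ih => rw [pow_succ 200]; nlinarith only [ih, hd]

theorem pow_le_rpow_two_sub {d : ℕ} (hd : 10 ≤ d) :
    (1000 : ℝ) ^ d ≤ (√(2 / ((d : ℝ) + 2)) * (1 / 1000) *
      (log (log ((d : ℝ) + 2)) / log ((d : ℝ) + 2)) ^ 3) ^ ((2 : ℝ) - ((d : ℝ) + 2)) := by
  have hd' : (10 : ℝ) ≤ d := by exact_mod_cast hd
  have hlog : 1 < log ((d : ℝ) + 2) := by
    rw [Real.lt_log_iff_exp_lt (by positivity)]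
    linarith [Real.exp_one_lt_d9]
  have hloglog : 0 < log (log ((d : ℝ) + 2)) := Real.log_pos hlog
  have hle : log (log ((d : ℝ) + 2)) ≤ log ((d : ℝ) + 2) := Real.log_le_self (by linarith)
  set r := log (log ((d : ℝ) + 2)) / log ((d : ℝ) + 2)
  have hr0 : 0 < r := by positivity
  have hr1 : r ^ 3 ≤ 1 := pow_le_one₀ hr0.le ((div_le_one (by linarith)).2 hle)
  have hs1 : √(2 / ((d : ℝ) + 2)) ≤ 1 := by
    rw [Real.sqrt_le_one, div_le_one (by positivity)]
    linarith
  have hs0 : 0 < √(2 / ((d : ℝ) + 2)) := by positivity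
  set l := √(2 / ((d : ℝ) + 2)) * (1 / 1000) * r ^ 3 with hl
  have hl0 : 0 < l := by positivity
  have hl1 : l ≤ 1000⁻¹ := by
    rw [hl]
    calc _ ≤ 1 * (1 / 1000) * (1 : ℝ) := by gcongr
      _ = _ := by norm_num
  rw [show (2 : ℝ) - ((d : ℝ) + 2) = -(d : ℝ) by ring, Real.rpow_neg hl0.le, Real.rpow_natCast,
    ← inv_pow]
  gcongr
  exact (le_inv_comm₀ (by norm_num) hl0).2 hl1

theorem unit_distance_add_log_le {d : ℕ} (hd : 10 ≤ d) {R : ℝ} (hR : (1 / 5) ^ (d + 1) ≤ R) :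
    (d + 1) * (2 * (5 ^ d * R)) + log (2 * ((d : ℝ) + 2) ^ 2) ≤ 1000 ^ d * R := by
  have hR0 : 0 < R := lt_of_lt_of_le (by positivity) hR
  have h1 : 1 ≤ 5 * (5 ^ d * R) := by
    calc (1 : ℝ) = 5 ^ (d + 1) * (1 / 5) ^ (d + 1) := by rw [← mul_pow]; norm_num
      _ ≤ 5 ^ (d + 1) * R := by gcongr
      _ = _ := by ring
  have h2 : log (2 * ((d : ℝ) + 2) ^ 2) ≤ 2 * ((d : ℝ) + 2) ^ 2 := Real.log_le_self (by positivity)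
  have h3 : 14 * ((d : ℝ) + 2) ^ 2 ≤ 200 ^ d := by exact_mod_cast mul_add_two_sq_le_pow hd
  have h4 : (1000 : ℝ) ^ d * R = 200 ^ d * (5 ^ d * R) := by
    rw [← mul_assoc, ← mul_pow]; norm_num
  rw [h4]
  have hd0 : (0 : ℝ) ≤ d := Nat.cast_nonneg d
  set T := 5 ^ d * R
  have hT : 0 < T := by positivity
  have h5 := mul_le_mul_of_nonneg_right h3 hT.le
  have h6 := mul_le_mul_of_nonneg_left h1 (show (0 : ℝ) ≤ 2 * ((d : ℝ) + 2) ^ 2 by positivity)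
  have h7 := mul_nonneg hT.le (show (0 : ℝ) ≤ 4 * ((d : ℝ) + 2) ^ 2 - 2 * (d + 1) by nlinarith)
  linarith

theorem numClasses_le_exp {K : Type*} [Field K] [NumberField K] [IsTotallyReal K] {d : ℕ}
    (hd : Module.finrank ℚ K = d + 2) {η : ℝ}
    (hη : (d + 1) * (2 * (5 ^ d * Units.regulator K)) + log (2 * ((d : ℝ) + 2) ^ 2) ≤ η) :
    (numClasses K : ℝ) ≤ exp (((d : ℝ) + 2) * η) * |(discr K : ℝ)| := by
  have hΔ : (1 : ℝ) ≤ |(discr K : ℝ)| := by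
    exact_mod_cast Int.one_le_abs (discr_ne_zero K)
  have hR : 0 < Units.regulator K := Units.regulator_pos K
  set Δ := |(discr K : ℝ)|
  set s := (d + 1) * (2 * (5 ^ d * Units.regulator K)) with hs
  set N : ℝ := (d : ℝ) + 2 with hN
  have hN1 : 1 ≤ N := by have : (0 : ℝ) ≤ d := Nat.cast_nonneg d; linarith
  have hcast : ((Module.finrank ℚ K : ℕ) : ℝ) = N := by rw [hd]; push_cast; rfl
  have hNc : ((d + 2 : ℕ) : ℝ) = N := by push_cast; rfl
  have hpow : 1 ≤ N ^ (d + 2) * Δ := one_le_mul_of_one_le_of_one_le (one_le_pow₀ hN1) hΔ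
  set B := exp (s + log (N ^ (d + 2) * Δ) / N) with hB
  have hB1 : 1 ≤ B := Real.one_le_exp (by have := Real.log_nonneg hpow; positivity)
  have hBpow : B ^ (d + 2) = exp (N * s) * (N ^ (d + 2) * Δ) := by
    rw [hB, ← Real.exp_nat_mul, hNc, mul_add, mul_div_cancel₀ _ (by positivity), Real.exp_add,
      Real.exp_log (by positivity)]
  have h := numClasses_le (K := K) hd (Real.exp_pos _) (B := B) (by
    rw [hcast, hd, hB, Real.log_exp])
  rw [hcast, hd] at h
  calc (numClasses K : ℝ) ≤ (N * B + 1) ^ (d + 2) := h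
    _ ≤ (2 * N * B) ^ (d + 2) := by
      gcongr
      nlinarith [one_le_mul_of_one_le_of_one_le hN1 hB1]
    _ = exp (N * s) * (2 * N ^ 2) ^ (d + 2) * Δ := by
      rw [mul_pow, hBpow, show 2 * N ^ 2 = 2 * N * N by ring, mul_pow (2 * N) N]; ring
    _ = exp (N * (s + log (2 * N ^ 2))) * Δ := by
      rw [mul_add, Real.exp_add, ← hNc, Real.exp_nat_mul (log _), hNc,
        Real.exp_log (by positivity)]
    _ ≤ exp (N * η) * Δ := by gcongr

end Estimates

/-- Bound on the number of homothety classes of perfect unary forms for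
a totally real field of degree `n ≥ 12` which is `A`-reducible. -/
theorem perfect_form_classes_bound_large_degree
    (K : Type*) [Field K] [NumberField K] (n : ℕ)
    (hdeg : Module.finrank ℚ K = n) (hn : 12 ≤ n)
    (htr : TotallyReal K) (A : ℝ) (hA : 1 ≤ A) (hred : IsAReducible K A) :
    (numClasses K : ℝ) ≤
      Real.exp ((n : ℝ) * Real.sqrt
          ((Real.sqrt ((n : ℝ) - 1) / 2 * (2 / π) ^ (n - 1) *
              Real.Gamma (2 + ((n : ℝ) - 1) / 2) ^ 2 *
              (Real.sqrt (2 / (n : ℝ)) * (1 / 1000) *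
                  (Real.log (Real.log (n : ℝ)) / Real.log (n : ℝ)) ^ 3) ^
                ((2 : ℝ) - (n : ℝ)) *
              NumberField.Units.regulator K) ^ 2 +
            4 * Real.log A ^ 2 / ((n : ℝ) - 1))) *
        |(NumberField.discr K : ℝ)| * (2 / π) ^ (2 * n) *
        Real.Gamma (2 + (n : ℝ) / 2) ^ 4 := by
  have : IsTotallyReal K := ⟨htr⟩
  obtain ⟨d, rfl⟩ : ∃ d, n = d + 2 := ⟨n - 2, by omega⟩
  have hd : 10 ≤ d := by omega
  have hd' : (10 : ℝ) ≤ d := by exact_mod_cast hd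
  have hR0 : 0 < Units.regulator K := Units.regulator_pos K
  have hreg : (1 / 5) ^ (d + 1) ≤ Units.regulator K := one_fifth_pow_le_regulator hdeg
  have hG1 := one_le_two_div_pi_pow_mul_Gamma_sq (d + 1)
  have hG2 := one_le_two_div_pi_pow_mul_Gamma_sq (d + 2)
  have hl := pow_le_rpow_two_sub hd
  have hc : (((d + 2 : ℕ) : ℝ)) = (d : ℝ) + 2 := by push_cast; rfl
  have hc1 : (d : ℝ) + 2 - 1 = ((d + 1 : ℕ) : ℝ) := by push_cast; ring
  have hsqrt : 1 ≤ √((d + 1 : ℕ) : ℝ) / 2 := by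
    rw [one_le_div two_pos]
    apply Real.le_sqrt_of_sq_le
    push_cast
    linarith
  rw [hc] at hG2 ⊢
  rw [show d + 2 - 1 = d + 1 from rfl, hc1]
  set l := (√(2 / ((d : ℝ) + 2)) * (1 / 1000) *
    (log (log ((d : ℝ) + 2)) / log ((d : ℝ) + 2)) ^ 3) ^ ((2 : ℝ) - ((d : ℝ) + 2))
  set η := √((d + 1 : ℕ) : ℝ) / 2 * (2 / π) ^ (d + 1) *
    Gamma (2 + ((d + 1 : ℕ) : ℝ) / 2) ^ 2 * l * Units.regulator K with hη
  have hη1 : 1000 ^ d * Units.regulator K ≤ η := by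
    have h1 : 1 ≤ √((d + 1 : ℕ) : ℝ) / 2 * ((2 / π) ^ (d + 1) *
        Gamma (2 + ((d + 1 : ℕ) : ℝ) / 2) ^ 2) := one_le_mul_of_one_le_of_one_le hsqrt hG1
    rw [hη, mul_assoc (_ / 2)]
    gcongr
    exact hl.trans (le_mul_of_one_le_left ((by positivity : (0 : ℝ) ≤ 1000 ^ d).trans hl) h1)
  have hbound := numClasses_le_exp hdeg ((unit_distance_add_log_le hd hreg).trans
    (hη1.trans (Real.le_sqrt_of_sq_le (le_add_of_nonneg_right
      (show 0 ≤ 4 * log A ^ 2 / ((d + 1 : ℕ) : ℝ) by positivity)))))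
  refine hbound.trans ?_
  rw [mul_assoc]
  refine le_mul_of_one_le_right (by positivity) ?_
  calc (1 : ℝ) ≤ ((2 / π) ^ (d + 2) * Gamma (2 + ((d : ℝ) + 2) / 2) ^ 2) ^ 2 := one_le_pow₀ hG2
    _ = _ := by ring
end
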